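/- arXiv:2603.15146 — 4 statements merged into one kernel-verified Lean document; each statement's English description precedes it below -/
import Mathlib

section
/- Let m ≥ 3 be an odd integer, let i be a positive integer with gcd(i,m) = 1, set q = 2^i, and let a ∈ 𝔽_{2^m}^*. Then the polynomial Q_a(T) = T^{q²+q+1} + aT + 1 has no root in 𝔽_{2^m} \ {0} if and only if for every nonzero direction d ∈ 𝔽_{2^m}³, the differential kernel ker D_d G_a = { v ∈ 𝔽_{2^m}³ : G_a(v + d) + G_a(v) + G_a(d) = 0 } has exactly 2 elements. -/
/-- The trivariate map `G_a(x,y,z) = (x^{q+1}+a x^q z + y z^q, x^q z + y^{q+1},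
x y^q + a y^q z + z^{q+1})`. -/
def Gmap {F : Type*} [Field F] (q : ℕ) (a : F) : F × F × F → F × F × F :=
  fun v =>
    (v.1 ^ (q + 1) + a * v.1 ^ q * v.2.2 + v.2.1 * v.2.2 ^ q,
     v.1 ^ q * v.2.2 + v.2.1 ^ (q + 1),
     v.1 * v.2.1 ^ q + a * v.2.1 ^ q * v.2.2 + v.2.2 ^ (q + 1))

section LinearizedPolynomials

variable {F : Type*} [Field F]

/-- A linearized trinomial `X^{q³} + aX^q + X` over a finite field has a nonzero root if and only if
the trinomial `X^{q³} + aX^{q²} + X` has one, because they are adjoint for the trace form. -/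
theorem exists_linearized_root_iff_adjoint [Finite F] (s : F →+* F) (τ : F →+ ZMod 2)
    (hτs : ∀ x, τ (s x) = τ x) (hτ : ∃ c, τ c ≠ 0) (a : F) :
    (∃ x, x ≠ 0 ∧ s (s (s x)) + a * s x + x = 0) ↔
      ∃ u, u ≠ 0 ∧ s (s (s u)) + a * s (s u) + u = 0 := by
  obtain ⟨c, hc⟩ := hτ
  let L : F →+ F :=
    { toFun := fun x => s (s (s x)) + a * s x + x
      map_zero' := by simp
      map_add' := fun x y => by simp only [map_add]; ring }
  let L' : F →+ F :=
    { toFun := fun x => s (s (s x)) + a * s (s x) + x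
      map_zero' := by simp
      map_add' := fun x y => by simp only [map_add]; ring }
  have adj (u x : F) : τ (s (s u) * L x) = τ (L' u * s x) := by
    have h1 : τ (s (s u) * s (s (s x))) = τ (u * s x) := by
      rw [← map_mul, ← map_mul, hτs, hτs]
    have h2 : τ (s (s u) * x) = τ (s (s (s u)) * s x) := by
      rw [← map_mul, hτs]
    have e1 : s (s u) * L x
        = s (s u) * s (s (s x)) + s (s u) * x + a * s (s u) * s x := by
      change s (s u) * (s (s (s x)) + a * s x + x) = _
      ring
    have e2 : L' u * s x
        = u * s x + s (s (s u)) * s x + a * s (s u) * s x := by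
      change (s (s (s u)) + a * s (s u) + u) * s x = _
      ring
    rw [e1, e2]
    simp only [map_add, h1, h2]
  have key (K : F →+ F) (hK : ¬ Function.Surjective K) : ∃ x, x ≠ 0 ∧ K x = 0 := by
    by_contra! h
    refine hK (Finite.surjective_of_injective ((injective_iff_map_eq_zero K).2 fun x hx => ?_))
    by_contra hx0
    exact h x hx0 hx
  constructor
  · rintro ⟨x, hx, hLx⟩
    refine key L' fun hsurj => hc ?_
    obtain ⟨u, hu⟩ := hsurj (c / s x)
    have hsx : s x ≠ 0 := (map_ne_zero s).2 hx
    have h := adj u x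
    rw [hu, div_mul_cancel₀ c hsx, show L x = 0 from hLx, mul_zero, map_zero] at h
    exact h.symm
  · rintro ⟨u, hu, hLu⟩
    refine key L fun hsurj => hc ?_
    obtain ⟨x, hx⟩ := hsurj (c / s (s u))
    have hsu : s (s u) ≠ 0 := (map_ne_zero s).2 ((map_ne_zero s).2 hu)
    have h := adj u x
    rwa [hx, mul_div_cancel₀ c hsu, show L' u = 0 from hLu, zero_mul, map_zero] at h

end LinearizedPolynomials

section FiniteFieldFacts

variable {F : Type*} [Field F] [Fintype F]

theorem card_units_coprime_two_pow_sub_one {m i : ℕ} (hgcd : Nat.gcd i m = 1)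
    (hF : Fintype.card F = 2 ^ m) : (Nat.card Fˣ).Coprime (2 ^ i - 1) := by
  rw [Nat.card_units, Nat.card_eq_fintype_card, hF, Nat.Coprime,
    Nat.pow_sub_one_gcd_pow_sub_one, Nat.gcd_comm, hgcd]
  norm_num

theorem exists_pow_sub_one_eq {m i : ℕ} (hgcd : Nat.gcd i m = 1)
    (hF : Fintype.card F = 2 ^ m) {t : F} (ht : t ≠ 0) :
    ∃ c : F, c ≠ 0 ∧ c ^ (2 ^ i - 1) = t := by
  have hcop := card_units_coprime_two_pow_sub_one hgcd hF
  refine ⟨(powCoprime hcop).symm (Units.mk0 t ht), Units.ne_zero _, ?_⟩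
  have h := (powCoprime hcop).apply_symm_apply (Units.mk0 t ht)
  rw [powCoprime_apply] at h
  exact congrArg Units.val h

theorem eq_one_of_pow_two_pow_eq_self {m i : ℕ} (hgcd : Nat.gcd i m = 1)
    (hF : Fintype.card F = 2 ^ m) {t : F} (ht : t ≠ 0) (h : t ^ 2 ^ i = t) : t = 1 := by
  have hcop := card_units_coprime_two_pow_sub_one hgcd hF
  have hu : Units.mk0 t ht ^ (2 ^ i - 1) = 1 := by
    ext
    have h' : t ^ (2 ^ i - 1) * t = 1 * t := by
      rw [← pow_succ, Nat.sub_add_cancel Nat.one_le_two_pow, h, one_mul]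
    simpa using mul_right_cancel₀ ht h'
  have := (powCoprime hcop).injective (a₁ := Units.mk0 t ht) (a₂ := 1)
    (by simpa only [powCoprime_apply, one_pow] using hu)
  exact congrArg Units.val this

theorem exists_frobenius_invariant_functional [CharP F 2] (i : ℕ) :
    ∃ τ : F →+ ZMod 2, (∀ x, τ (x ^ 2 ^ i) = τ x) ∧ ∃ c, τ c ≠ 0 := by
  let := ZMod.algebra F 2
  refine ⟨(Algebra.trace (ZMod 2) F).toAddMonoidHom, fun x => ?_, ?_⟩
  · have h2 (y : F) : Algebra.trace (ZMod 2) F (y ^ 2) = Algebra.trace (ZMod 2) F y := by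
      have h := Algebra.trace_eq_of_algEquiv (FiniteField.frobeniusAlgEquiv (ZMod 2) F 2) y
      simpa using h
    change Algebra.trace (ZMod 2) F (x ^ 2 ^ i) = Algebra.trace (ZMod 2) F x
    induction i with
    | zero => simp
    | succ n ih => rw [pow_succ, pow_mul, h2, ih]
  · obtain ⟨c, hc⟩ := Algebra.trace_surjective (ZMod 2) F 1
    exact ⟨c, by
      change Algebra.trace (ZMod 2) F c ≠ 0
      rw [hc]
      exact one_ne_zero⟩

end FiniteFieldFacts

section Geometry

variable {F : Type*} [Field F] [CharP F 2] (s : F →+* F) (a : F)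

theorem exists_eq_smul_of_minors_eq_zero {x y z α β γ : F} (hd : ¬ (α = 0 ∧ β = 0 ∧ γ = 0))
    (h₁ : y * γ + z * β = 0) (h₂ : x * γ + z * α = 0) (h₃ : x * β + y * α = 0) :
    ∃ t, x = t * α ∧ y = t * β ∧ z = t * γ := by
  have two : (2 : F) = 0 := CharTwo.two_eq_zero
  by_cases hα : α = 0
  · by_cases hβ : β = 0
    · have hγ : γ ≠ 0 := fun hγ => hd ⟨hα, hβ, hγ⟩
      refine ⟨z / γ, ?_, ?_, ?_⟩ <;> field_simp <;> grind
    · refine ⟨y / β, ?_, ?_, ?_⟩ <;> field_simp <;> grind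
  · refine ⟨x / α, ?_, ?_, ?_⟩ <;> field_simp <;> grind

/-- If `m ≠ 0` and `m^σ` is parallel to `A⁻ᵀ m`, where `A (x, y, z) = (y, z, x + a z)`, then the
ratio of the first and last coordinates of `m` is a root of `T^{q²+q+1} + aT + 1`. -/
theorem exists_root_of_parallel {m₁ m₂ m₃ : F} (hm : ¬ (m₁ = 0 ∧ m₂ = 0 ∧ m₃ = 0))
    (h₁₃ : m₂ * s m₃ = m₁ * s m₁) (h₂₃ : (m₃ + a * m₁) * s m₃ = m₁ * s m₂)
    (h₁₂ : m₂ * s m₂ = (m₃ + a * m₁) * s m₁) :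
    ∃ t : F, t ≠ 0 ∧ s (s t) * s t * t + a * t + 1 = 0 := by
  have two : (2 : F) = 0 := CharTwo.two_eq_zero
  have h3 : m₃ ≠ 0 := by
    rintro rfl
    have h1 : m₁ = 0 := by simpa using h₁₃.symm
    subst h1
    exact hm ⟨rfl, by simpa using h₁₂, rfl⟩
  obtain ⟨t, rfl⟩ : ∃ t, m₁ = t * m₃ := ⟨m₁ / m₃, by field_simp⟩
  have hs3 : s m₃ ≠ 0 := (map_ne_zero s).2 h3
  have h2 : m₂ = s t * t * m₃ := by
    apply mul_right_cancel₀ hs3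
    rw [h₁₃, map_mul]
    ring
  subst h2
  have key : s (s t) * s t * t + a * t + 1 = 0 := by
    apply mul_right_cancel₀ (mul_ne_zero h3 hs3)
    simp only [map_mul] at h₂₃
    linear_combination h₂₃ + (s (s t) * s t * t * m₃ * s m₃) * two
  refine ⟨t, ?_, key⟩
  rintro rfl
  simp at key

/-- For `A (x, y, z) = (y, z, x + a z)` of determinant one, a linearly independent pair `v, d` with
`v^σ × A d = A v × d^σ` spans a plane `P` with `A P = P^σ`; its normal vector yields a root. -/
theorem exists_root_of_independent {x y z α β γ : F}
    (hm : ¬ (y * γ + z * β = 0 ∧ x * γ + z * α = 0 ∧ x * β + y * α = 0))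
    (e₁ : s x * (α + a * γ) + s z * β + (s α * (x + a * z) + s γ * y) = 0)
    (e₂ : s x * γ + s y * β + (s α * z + s β * y) = 0)
    (e₃ : s y * (α + a * γ) + s z * γ + (s β * (x + a * z) + s γ * z) = 0) :
    ∃ t : F, t ≠ 0 ∧ s (s t) * s t * t + a * t + 1 = 0 := by
  have two : (2 : F) = 0 := CharTwo.two_eq_zero
  apply exists_root_of_parallel s a hm <;> simp only [map_mul, map_add] <;> grind

/-- A nonzero zero of `v^σ × A v` can be rescaled to a solution of `A v = v^σ`. -/
theorem exists_adjoint_root_of_parallel {x y z : F} (hd : ¬ (x = 0 ∧ y = 0 ∧ z = 0))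
    (hscale : ∀ t : F, t ≠ 0 → ∃ c, c ≠ 0 ∧ s c = t * c)
    (e₁ : s x * (x + a * z) + s z * y = 0) (e₂ : s x * z + s y * y = 0)
    (e₃ : s y * (x + a * z) + s z * z = 0) :
    ∃ u, u ≠ 0 ∧ s (s (s u)) + a * s (s u) + u = 0 := by
  have two : (2 : F) = 0 := CharTwo.two_eq_zero
  have hx : x ≠ 0 := by
    rintro rfl
    have hy : y = 0 := by simpa using e₂
    subst hy
    exact hd ⟨rfl, rfl, by simpa using e₃⟩
  have hsx : s x ≠ 0 := (map_ne_zero s).2 hx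
  obtain ⟨t, rfl⟩ : ∃ t, y = t * s x := ⟨y / s x, by field_simp⟩
  have hz : z = t * s (t * s x) := by
    apply mul_left_cancel₀ hsx
    linear_combination e₂ - s (t * s x) * t * s x * two
  have hxz : x + a * z = t * s z := by
    apply mul_left_cancel₀ hsx
    linear_combination e₁ - s z * t * s x * two
  have ht : t ≠ 0 := by
    rintro rfl
    rw [zero_mul] at hz hxz
    exact hx (by simpa [hz] using hxz)
  obtain ⟨c, hc, hsc⟩ := hscale t ht
  refine ⟨c * x, mul_ne_zero hc hx, ?_⟩
  have h1 : s (c * x) = c * (t * s x) := by rw [map_mul, hsc]; ring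
  have h2 : s (s (c * x)) = c * z := by rw [h1, map_mul, hsc, hz]; ring
  have h3 : s (s (s (c * x))) = c * (x + a * z) := by rw [h2, map_mul, hsc, hxz]; ring
  rw [h3, h2]
  linear_combination c * (x + a * z) * two

end Geometry

theorem stmt_8 (m i : ℕ) (hm : 3 ≤ m) (hmodd : Odd m) (hi : 0 < i)
    (hgcd : Nat.gcd i m = 1) (q : ℕ) (hq : q = 2 ^ i)
    (F : Type*) [Field F] [Fintype F] (hF : Fintype.card F = 2 ^ m)
    (a : F) (ha : a ≠ 0) :
    (¬ ∃ t : F, t ≠ 0 ∧ t ^ (q ^ 2 + q + 1) + a * t + 1 = 0) ↔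
    (∀ d : F × F × F, d ≠ 0 →
      {v : F × F × F | Gmap q a (v + d) + Gmap q a v + Gmap q a d = 0}.ncard = 2) := by
  have : CharP F 2 := charP_of_card_eq_prime_pow (f := m) hF
  have two : (2 : F) = 0 := CharTwo.two_eq_zero
  let s : F →+* F := iterateFrobenius F 2 i
  have hs (x : F) : x ^ q = s x := by rw [hq]; rfl
  have hroot (t : F) : t ^ (q ^ 2 + q + 1) = s (s t) * s t * t := by
    rw [pow_add, pow_add, sq, pow_mul, pow_one, hs, hs]
  have hscale (t : F) (ht : t ≠ 0) : ∃ c, c ≠ 0 ∧ s c = t * c := by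
    obtain ⟨c, hc, hct⟩ := exists_pow_sub_one_eq hgcd hF ht
    refine ⟨c, hc, ?_⟩
    rw [← hs, ← hct, ← pow_succ, Nat.sub_add_cancel Nat.one_le_two_pow, hq]
  have hG (x y z : F) : Gmap q a (x, y, z) =
      (s x * (x + a * z) + s z * y, s x * z + s y * y, s y * (x + a * z) + s z * z) := by
    simp only [Gmap, pow_succ, hs, Prod.mk.injEq]
    refine ⟨by ring, trivial, by ring⟩
  have hadj : (∃ x, x ≠ 0 ∧ s (s (s x)) + a * s x + x = 0) ↔
      ∃ u, u ≠ 0 ∧ s (s (s u)) + a * s (s u) + u = 0 := by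
    obtain ⟨τ, hτ, hc⟩ := exists_frobenius_invariant_functional (F := F) i
    exact exists_linearized_root_iff_adjoint s τ hτ hc a
  simp only [hroot]
  constructor
  · rintro hno ⟨α, β, γ⟩ hd
    have hd' : ¬ (α = 0 ∧ β = 0 ∧ γ = 0) := by simpa using hd
    have hnoroot : ¬ ∃ u, u ≠ 0 ∧ s (s (s u)) + a * s (s u) + u = 0 := by
      rw [← hadj]
      rintro ⟨x, hx, hL⟩
      have hsx : s x ≠ 0 := (map_ne_zero s).2 hx
      have hssx : s (s x) ≠ 0 := (map_ne_zero s).2 hsx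
      refine hno ⟨s x / x, div_ne_zero hsx hx, ?_⟩
      simp only [map_div₀]
      field_simp
      linear_combination hL
    have hset : {v : F × F × F | Gmap q a (v + (α, β, γ)) + Gmap q a v
        + Gmap q a (α, β, γ) = 0} = {0, (α, β, γ)} := by
      ext ⟨x, y, z⟩
      simp only [Set.mem_ofPred_eq, Set.mem_insert_iff, Set.mem_singleton_iff, Prod.mk_add_mk, hG,
        Prod.mk_eq_zero, map_add, Prod.mk.injEq]
      constructor
      · rintro ⟨e₁, e₂, e₃⟩
        by_contra hne
        by_cases hm' : y * γ + z * β = 0 ∧ x * γ + z * α = 0 ∧ x * β + y * α = 0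
        · obtain ⟨t, rfl, rfl, rfl⟩ := exists_eq_smul_of_minors_eq_zero hd' hm'.1 hm'.2.1 hm'.2.2
          simp only [map_mul] at e₁ e₂ e₃
          by_cases hst : s t + t = 0
          · rcases eq_or_ne t 0 with rfl | ht
            · simp at hne
            · have ht1 : t = 1 := eq_one_of_pow_two_pow_eq_self hgcd hF ht (by
                rw [← hq, hs]
                linear_combination hst - t * two)
              simp [ht1] at hne
          · refine hnoroot (exists_adjoint_root_of_parallel s a hd' hscale ?_ ?_ ?_) <;>
              apply mul_left_cancel₀ hst <;> grind
        · exact hno (exists_root_of_independent s a hm' (by grind) (by grind) (by grind))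
      · rintro (⟨rfl, rfl, rfl⟩ | ⟨rfl, rfl, rfl⟩) <;>
          refine ⟨?_, ?_, ?_⟩ <;> grind
    rw [hset, Set.ncard_pair hd.symm]
  · rintro hker ⟨t, ht, hQ⟩
    obtain ⟨x, hx, hsx⟩ := hscale t ht
    obtain ⟨u, hu, hLu⟩ := hadj.1 ⟨x, hx, by
      simp only [hsx, map_mul]
      linear_combination x * hQ⟩
    have hline : Set.range (fun c : F => (c * u, c * s u, c * s (s u))) ⊆
        {v : F × F × F | Gmap q a (v + (u, s u, s (s u))) + Gmap q a v
          + Gmap q a (u, s u, s (s u)) = 0} := by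
      rintro _ ⟨c, rfl⟩
      simp only [Set.mem_ofPred_eq, Prod.mk_add_mk, hG, Prod.mk_eq_zero, map_add, map_mul]
      refine ⟨?_, ?_, ?_⟩ <;> grind
    have hcard := Set.ncard_le_ncard hline
    rw [hker _ (by simp [hu]), Set.ncard_range_of_injective fun c c' h => by
      simpa [hu] using congrArg Prod.fst h, Nat.card_eq_fintype_card, hF] at hcard
    have : 2 ^ 3 ≤ 2 ^ m := Nat.pow_le_pow_right two_pos hm
    omega
end

section
/- Let m ≥ 3 be an odd integer, let i be a positive integer with gcd(i,m) = 1, set q = 2^i, and let a ∈ 𝔽_{2^m}^*. Then the following three statements are equivalent: (i) the polynomial Q_a(T) = T^{q²+q+1} + aT + 1 has no root in 𝔽_{2^m}; (ii) the map G_a : 𝔽_{2^m}³ → 𝔽_{2^m}³ is a bijection; (iii) G_a is almost perfect nonlinear (APN). -/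
/-- A function on `F³` is almost perfect nonlinear (APN) if every nontrivial
derivative equation `f(x+u) + f(x) = b` has at most two solutions. -/
def IsAPN {F : Type*} [Field F] (f : F × F × F → F × F × F) : Prop :=
  ∀ u : F × F × F, u ≠ 0 → ∀ b : F × F × F,
    {x : F × F × F | f (x + u) + f x = b}.ncard ≤ 2

/-- The absolute trace of a finite field is invariant under field endomorphisms. -/
lemma trace_map_ringHom {p : ℕ} [Fact p.Prime] {F : Type*} [Field F] [Finite F]
    [Algebra (ZMod p) F] (s : F →+* F) (x : F) :
    Algebra.trace (ZMod p) F (s x) = Algebra.trace (ZMod p) F x := by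
  let f : F →ₐ[ZMod p] F :=
    { s with
      commutes' := fun r => RingHom.congr_fun
        (Subsingleton.elim (s.comp (algebraMap (ZMod p) F)) (algebraMap (ZMod p) F)) r }
  exact Algebra.trace_eq_of_algEquiv
    (AlgEquiv.ofBijective f (Finite.injective_iff_bijective.mp s.injective)) x

/-- Nonzero elements of the kernel of `s³ + a s² + 1` give nonzero elements of the kernel of
`s³ + a s + 1`, its adjoint up to a power of `s`. -/
lemma exists_adjoint_kernel {F : Type*} [Field F] [Finite F] [Algebra (ZMod 2) F]
    (s : F →+* F) (a : F) {p : F} (hp : p ≠ 0)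
    (h : s (s (s p)) + a * s (s p) + p = 0) :
    ∃ w : F, w ≠ 0 ∧ s (s (s w)) + a * s w + w = 0 := by
  let φ : F →+ F := AddMonoidHom.mk' (fun w => s (s (s w)) + a * s w + w) fun v w => by
    simp only [map_add]; ring
  by_contra! hker
  have hinj : Function.Injective φ := by
    refine (injective_iff_map_eq_zero φ).mpr fun w hw => ?_
    by_contra hw0
    exact hker w hw0 hw
  have hsurj : Function.Surjective φ := Finite.injective_iff_surjective.mp hinj
  have hzero (w : F) : Algebra.trace (ZMod 2) F (s (s p) * φ w) = 0 := by
    have hsplit : s (s p) * φ w = s (s (p * s w)) + s (s p) * (a * s w) + s (s p) * w := by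
      change s (s p) * (s (s (s w)) + a * s w + w) = _
      simp only [map_mul]; ring
    rw [hsplit, map_add, map_add, trace_map_ringHom, trace_map_ringHom,
      ← trace_map_ringHom s (s (s p) * w),
      ← map_add, ← map_add, map_mul]
    have hfactor : p * s w + s (s p) * (a * s w) + s (s (s p)) * s w = 0 := by
      linear_combination s w * h
    rw [hfactor, map_zero]
  have hpp : s (s p) = 0 := by
    refine (traceForm_nondegenerate (ZMod 2) F).1 _ fun y => ?_
    obtain ⟨w, rfl⟩ := hsurj y
    exact hzero w
  exact hp (by simpa using hpp)

section SemilinearGeometry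

variable {F : Type*} [Field F] [CharP F 2] (s : F →+* F) (a : F)

/-- A plane with normal vector `(α, β, γ)` that is carried to the same plane by `s` and by
`(x, y, z) ↦ (y, z, x + a z)` gives a root of `s² t * s t * t + a t + 1`. -/
lemma exists_root_of_normal {α β γ : F} (hn : ¬ (α = 0 ∧ β = 0 ∧ γ = 0))
    (h₁ : s γ * β = s α * α) (h₂ : s γ * γ = α * (s β + a * s γ))
    (h₃ : s α * γ = β * (s β + a * s γ)) :
    ∃ t : F, s (s t) * s t * t + a * t + 1 = 0 := by
  have two : (2 : F) = 0 := CharTwo.two_eq_zero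
  have hγ : γ ≠ 0 := by
    rintro rfl
    have hα : α = 0 := by simpa using h₁
    subst hα
    have hβ : β = 0 := by simpa using h₃
    exact hn ⟨rfl, hβ, rfl⟩
  have hsγ : s γ ≠ 0 := by simpa using hγ
  have hβ : s (α / γ) * (α / γ) = β / γ := by
    rw [map_div₀]
    field_simp
    linear_combination -h₁
  refine ⟨α / γ, ?_⟩
  have hssβ : s (s (α / γ)) * s (α / γ) = s β / s γ := by rw [← map_mul, hβ, map_div₀]
  rw [hssβ]
  field_simp
  linear_combination -h₂ + s γ * γ * two

/-- If the polar form of `v ↦ s v ∧ L v` pairs independent vectors `u`, `v` to `e` times the value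
at `u`, then the plane they span is invariant, whence a root. -/
lemma exists_root_of_polar {x y z x' y' z' e : F}
    (hn : ¬ (y * z' + z * y' = 0 ∧ x * z' + z * x' = 0 ∧ x * y' + y * x' = 0))
    (h₁ : (s x' + e * s x) * (x + a * z) + (s z' + e * s z) * y
      = s x * (x' + a * z') + s z * y')
    (h₂ : (s x' + e * s x) * z + (s y' + e * s y) * y = s x * z' + s y * y')
    (h₃ : (s y' + e * s y) * (x + a * z) + (s z' + e * s z) * z
      = s y * (x' + a * z') + s z * z') :
    ∃ t : F, s (s t) * s t * t + a * t + 1 = 0 := by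
  have two : (2 : F) = 0 := CharTwo.two_eq_zero
  have hu : (s y * s z' + s z * s y') * y + (s x * s z' + s z * s x') * z
      + (s x * s y' + s y * s x') * (x + a * z) = 0 := by
    grind
  have hv : (s y * s z' + s z * s y') * y' + (s x * s z' + s z * s x') * z'
      + (s x * s y' + s y * s x') * (x' + a * z') = 0 := by
    grind
  refine exists_root_of_normal s a hn ?_ ?_ ?_ <;> simp only [map_add, map_mul]
  · grind
  · grind
  · grind

/-- A nonzero vector `u` with `s u` proportional to `L u` gives a root. -/
lemma exists_root_of_isotropic [Finite F] [Algebra (ZMod 2) F]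
    (hs : ∀ l : F, l ≠ 0 → ∃ r : F, r ≠ 0 ∧ s r = l * r) {x y z : F}
    (hu : ¬ (x = 0 ∧ y = 0 ∧ z = 0)) (h₁ : s x * (x + a * z) + s z * y = 0)
    (h₂ : s x * z + s y * y = 0) (h₃ : s y * (x + a * z) + s z * z = 0) :
    ∃ t : F, s (s t) * s t * t + a * t + 1 = 0 := by
  have two : (2 : F) = 0 := CharTwo.two_eq_zero
  obtain ⟨l, hx, hy, hz⟩ : ∃ l : F, s x = l * y ∧ s y = l * z ∧ s z = l * (x + a * z) := by
    by_cases hy : y = 0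
    · by_cases hz : z = 0
      · have hx : x ≠ 0 := fun hx => hu ⟨hx, hy, hz⟩
        simp [hy, hz, hx] at h₁
      · refine ⟨s y / z, ?_, ?_, ?_⟩ <;> field_simp <;> grind
    · refine ⟨s x / y, ?_, ?_, ?_⟩ <;> field_simp <;> grind
  have hl : l ≠ 0 := by
    rintro rfl
    simp only [zero_mul, map_eq_zero] at hx hy hz
    exact hu ⟨hx, hy, hz⟩
  obtain ⟨r, hr, hsr⟩ := hs l hl
  have hp₁ : s (x / r) = y / r := by rw [map_div₀, hx, hsr]; field_simp
  have hp₂ : s (y / r) = z / r := by rw [map_div₀, hy, hsr]; field_simp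
  have hp₃ : s (z / r) = (x + a * z) / r := by rw [map_div₀, hz, hsr]; field_simp
  have hp : x / r ≠ 0 := by
    intro h
    rw [h, map_zero] at hp₁
    rw [← hp₁, map_zero] at hp₂
    simp only [div_eq_zero_iff, hr, or_false, eq_comm (a := (0 : F))] at h hp₁ hp₂
    exact hu ⟨h, hp₁, hp₂⟩
  obtain ⟨w, hw, hker⟩ := exists_adjoint_kernel s a hp (by
    rw [hp₁, hp₂, hp₃]
    field_simp
    linear_combination (x + a * z) * two)
  refine ⟨s w / w, ?_⟩
  have hsw : s w ≠ 0 := by simpa using hw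
  have hssw : s (s w) ≠ 0 := by simpa using hsw
  simp only [map_div₀]
  field_simp
  linear_combination hker

/-- A root yields a plane on which `v ↦ s v ∧ L v` takes values in a line. -/
lemma mem_line_of_root {t x y z : F} (ht : s (s t) * s t * t + a * t + 1 = 0)
    (hz : z = t * x + s t * t * y) :
    s x * (x + a * z) + s z * y = s (s t) * s t * (s x * z + s y * y) ∧
      s y * (x + a * z) + s z * z = s t * (s x * z + s y * y) := by
  have two : (2 : F) = 0 := CharTwo.two_eq_zero
  have hsz : s z = s t * s x + s (s t) * s t * s y := by rw [hz]; simp only [map_add, map_mul]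
  have hL : x + a * z = s t * y + s (s t) * s t * z := by grind
  rw [hL, hsz]
  constructor <;> grind

end SemilinearGeometry

section GmapProperties

variable {F : Type*} [Field F]

lemma Gmap_eq (s : F →+* F) {q : ℕ} (hs : ∀ x, x ^ q = s x) (a x y z : F) :
    Gmap q a (x, y, z) = (s x * (x + a * z) + s z * y, s x * z + s y * y,
      s y * (x + a * z) + s z * z) := by
  simp only [Gmap, pow_succ, hs, Prod.mk.injEq, true_and]
  constructor <;> ring

lemma Gmap_polar_add [CharP F 2] (s : F →+* F) {q : ℕ} (hs : ∀ x, x ^ q = s x) (a : F)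
    (v w u : F × F × F) :
    Gmap q a (v + w + u) + Gmap q a (v + w) + Gmap q a u =
      Gmap q a (v + u) + Gmap q a v + (Gmap q a (w + u) + Gmap q a w) := by
  have two : (2 : F) = 0 := CharTwo.two_eq_zero
  obtain ⟨x, y, z⟩ := u
  obtain ⟨x', y', z'⟩ := v
  obtain ⟨x'', y'', z''⟩ := w
  simp only [Prod.mk_add_mk, Gmap_eq s hs, Prod.mk.injEq, map_add]
  refine ⟨?_, ?_, ?_⟩ <;> grind

/-- If `s² t * s t * t + a t + 1` has no root, a vector `v` with `B(u, v) = e * G u` for the polar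
form `B` of `G` is a multiple `c u`, and `s c + c = e`. -/
lemma exists_smul_of_polar [CharP F 2] [Finite F] [Algebra (ZMod 2) F] (s : F →+* F) {q : ℕ}
    (hs : ∀ x, x ^ q = s x) (hdiv : ∀ l : F, l ≠ 0 → ∃ r : F, r ≠ 0 ∧ s r = l * r) (a : F)
    (hroot : ¬ ∃ t : F, s (s t) * s t * t + a * t + 1 = 0) {u v : F × F × F} (hu : u ≠ 0) {e : F}
    (h : Gmap q a (v + u) + Gmap q a v + Gmap q a u = e • Gmap q a u) :
    ∃ c : F, v = c • u ∧ s c + c = e := by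
  have two : (2 : F) = 0 := CharTwo.two_eq_zero
  obtain ⟨x, y, z⟩ := u
  obtain ⟨x', y', z'⟩ := v
  have hu' : ¬ (x = 0 ∧ y = 0 ∧ z = 0) := fun ⟨hx, hy, hz⟩ => hu (by simp [hx, hy, hz])
  simp only [Prod.mk_add_mk, Gmap_eq s hs, Prod.smul_mk, Prod.mk.injEq, smul_eq_mul,
    map_add] at h
  obtain ⟨h₁, h₂, h₃⟩ := h
  have hn : y * z' + z * y' = 0 ∧ x * z' + z * x' = 0 ∧ x * y' + y * x' = 0 := by
    by_contra hn
    refine hroot (exists_root_of_polar s a (e := e) hn ?_ ?_ ?_) <;> grind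
  obtain ⟨hn₁, hn₂, hn₃⟩ := hn
  obtain ⟨c, rfl, rfl, rfl⟩ : ∃ c : F, x' = c * x ∧ y' = c * y ∧ z' = c * z := by
    by_cases hx : x = 0
    · by_cases hy : y = 0
      · have hz : z ≠ 0 := fun hz => hu' ⟨hx, hy, hz⟩
        refine ⟨z' / z, ?_, ?_, ?_⟩ <;> field_simp <;> grind
      · refine ⟨y' / y, ?_, ?_, ?_⟩ <;> field_simp <;> grind
    · refine ⟨x' / x, ?_, ?_, ?_⟩ <;> field_simp <;> grind
  refine ⟨c, by simp, ?_⟩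
  by_contra hc
  have hc' : s c + c - e ≠ 0 := sub_ne_zero.mpr hc
  simp only [map_mul] at h₁ h₂ h₃
  refine hroot (exists_root_of_isotropic s a hdiv hu' ?_ ?_ ?_) <;>
    refine (mul_eq_zero.mp ?_).resolve_left hc' <;> grind

/-- A root yields, by the pigeonhole principle, many solutions of derivative equations. -/
lemma not_isAPN_and_not_injective_of_root [CharP F 2] [Fintype F] (hcard : 2 < Fintype.card F)
    (s : F →+* F) {q : ℕ} (hs : ∀ x, x ^ q = s x) {a t : F}
    (ht : s (s t) * s t * t + a * t + 1 = 0) :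
    ¬ IsAPN (Gmap q a) ∧ ¬ Function.Injective (Gmap q a) := by
  classical
  let P : F × F → F × F × F := fun p => (p.1, p.2, t * p.1 + s t * t * p.2)
  have hPinj : Function.Injective P := fun p p' h => by
    simp only [P, Prod.mk.injEq] at h
    exact Prod.ext h.1 h.2.1
  have hline (p : F × F) : Gmap q a (P p) = (s (s t) * s t * (Gmap q a (P p)).2.1,
      (Gmap q a (P p)).2.1, s t * (Gmap q a (P p)).2.1) := by
    have := mem_line_of_root s a (x := p.1) (y := p.2) ht rfl
    simp only [P, Gmap_eq s hs]
    rw [this.1, this.2]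
  have hPadd (p p' : F × F) : P p + P p' = P (p + p') := by
    simp only [P, Prod.mk_add_mk, Prod.fst_add, Prod.snd_add, Prod.mk.injEq, true_and]
    ring
  constructor
  · intro hapn
    let u : F × F := (1, 0)
    let f : F × F → F := fun p => (Gmap q a (P (p + u)) + Gmap q a (P p)).2.1
    obtain ⟨b, -, hb⟩ := Finset.exists_lt_card_fiber_of_mul_lt_card_of_maps_to
      (s := (Finset.univ : Finset (F × F))) (t := Finset.univ) (f := f) (n := 2)
      (fun _ _ => Finset.mem_univ _) (by
        simp only [Finset.card_univ, Fintype.card_prod]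
        exact Nat.mul_lt_mul_of_pos_left hcard (by omega))
    have hu : P u ≠ 0 := fun h => one_ne_zero (congrArg Prod.fst h)
    have hle := hapn (P u) hu (s (s t) * s t * b, b, s t * b)
    refine absurd (hb.trans_le ?_) (not_lt.mpr hle)
    rw [← Finset.card_image_of_injective _ hPinj, ← Set.ncard_coe_finset]
    refine Set.ncard_le_ncard ?_ (Set.toFinite _)
    intro v hv
    simp only [Finset.coe_image, Finset.coe_filter, Finset.mem_univ, true_and, Set.mem_image,
      Set.mem_ofPred_eq] at hv
    obtain ⟨p, rfl, rfl⟩ := hv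
    simp only [Set.mem_ofPred_eq, hPadd, f]
    rw [hline p, hline (p + u)]
    simp only [Prod.mk_add_mk, Prod.mk.injEq, true_and]
    constructor <;> ring
  · intro hinj
    have hfinj : Function.Injective fun p : F × F => (Gmap q a (P p)).2.1 := fun p p' h =>
      hPinj (hinj (by rw [hline p, hline p']; simp only at h; rw [h]))
    have hle := Fintype.card_le_of_injective _ hfinj
    rw [Fintype.card_prod] at hle
    nlinarith

end GmapProperties

theorem stmt_9 (m i : ℕ) (hm : 3 ≤ m) (hmodd : Odd m) (hi : 0 < i)
    (hgcd : Nat.gcd i m = 1) (q : ℕ) (hq : q = 2 ^ i)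
    (F : Type*) [Field F] [Fintype F] (hF : Fintype.card F = 2 ^ m)
    (a : F) (ha : a ≠ 0) :
    [(¬ ∃ t : F, t ^ (q ^ 2 + q + 1) + a * t + 1 = 0),
     Function.Bijective (Gmap q a),
     IsAPN (Gmap q a)].TFAE := by
  have : Fact (Nat.Prime 2) := ⟨Nat.prime_two⟩
  have : CharP F 2 := charP_of_card_eq_prime_pow hF
  let _ : Algebra (ZMod 2) F := ZMod.algebra F 2
  let s : F →+* F := iterateFrobenius F 2 i
  have hs (x : F) : x ^ q = s x := by rw [hq]; rfl
  have hpow (t : F) : t ^ (q ^ 2 + q + 1) = s (s t) * s t * t := by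
    rw [pow_succ, pow_add, pow_two, pow_mul, hs, hs]
  simp only [hpow]
  have hcard : 2 < Fintype.card F := by
    rw [hF]
    exact lt_of_lt_of_le (by norm_num) (Nat.pow_le_pow_right two_pos hm)
  have hq1 : 1 ≤ q := hq ▸ Nat.one_le_two_pow
  have hcop : (Nat.card Fˣ).Coprime (q - 1) := by
    rw [Nat.card_units, Nat.card_eq_fintype_card, hF, hq, Nat.Coprime,
      Nat.pow_sub_one_gcd_pow_sub_one, Nat.gcd_comm, hgcd]
    norm_num
  have hbij := hcop.pow_left_bijective
  have hdiv (l : F) (hl : l ≠ 0) : ∃ r : F, r ≠ 0 ∧ s r = l * r := by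
    obtain ⟨r, hr⟩ := hbij.2 (Units.mk0 l hl)
    refine ⟨r, r.ne_zero, ?_⟩
    have hr' : (r : F) ^ (q - 1) = l := by simpa using congrArg Units.val hr
    rw [← hs, ← hr', ← pow_succ, Nat.sub_add_cancel hq1]
  have hfix (c : F) (hc : s c + c = 0) : c = 0 ∨ c = 1 := by
    by_cases hc0 : c = 0
    · exact Or.inl hc0
    · right
      have hsc : c ^ (q - 1) * c = 1 * c := by
        rw [← pow_succ, Nat.sub_add_cancel hq1, hs, one_mul]
        exact CharTwo.add_eq_zero.mp hc
      have hunit : Units.mk0 c hc0 = 1 := hbij.1 (by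
        ext
        simpa using mul_right_cancel₀ hc0 hsc)
      simpa using congrArg Units.val hunit
  have hone (c : F) : s c + c ≠ 1 := by
    intro hc
    have htr := congrArg (Algebra.trace (ZMod 2) F) hc
    have hfinrank : Module.finrank (ZMod 2) F = m := by
      have hcard' := Module.card_eq_pow_finrank (K := ZMod 2) (V := F)
      rw [hF, ZMod.card] at hcard'
      exact (Nat.pow_right_injective le_rfl hcard').symm
    rw [map_add, trace_map_ringHom, CharTwo.add_self_eq_zero,
      ← map_one (algebraMap (ZMod 2) F), Algebra.trace_algebraMap, hfinrank, nsmul_one,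
      ZMod.natCast_eq_one_iff_odd.mpr hmodd] at htr
    exact zero_ne_one htr
  have add_self (v : F × F × F) : v + v = 0 :=
    Prod.ext (CharTwo.add_self_eq_zero _)
      (Prod.ext (CharTwo.add_self_eq_zero _) (CharTwo.add_self_eq_zero _))
  have eq_of_add {v w : F × F × F} (h : v + w = 0) : v = w := by
    rw [← add_zero v, ← add_self w, ← add_assoc, h, zero_add]
  tfae_have 1 → 2 := by
    intro hroot
    refine Finite.injective_iff_bijective.mp fun v w hvw => ?_
    by_contra hne
    have hu : v + w ≠ 0 := fun h => hne (eq_of_add h)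
    obtain ⟨c, -, hc⟩ := exists_smul_of_polar s hs hdiv a hroot (v := w) hu (e := 1) (by
      rw [add_left_comm, add_self, add_zero, hvw, add_self, zero_add, one_smul])
    exact hone c hc
  tfae_have 2 → 1 := by
    rintro hb ⟨t, ht⟩
    exact (not_isAPN_and_not_injective_of_root hcard s hs ht).2 hb.1
  tfae_have 1 → 3 := by
    intro hroot u hu b
    rcases Set.eq_empty_or_nonempty {v | Gmap q a (v + u) + Gmap q a v = b} with hS | ⟨w, hw⟩
    · simp [hS]
    · refine (Set.ncard_le_ncard (t := {w, w + u}) (fun v hv => ?_) (Set.toFinite _)).trans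
        ((Set.ncard_insert_le _ _).trans_eq (by rw [Set.ncard_singleton]))
      obtain ⟨c, hvw, hc⟩ := exists_smul_of_polar s hs hdiv a hroot (v := v + w) hu (e := 0) (by
        rw [Gmap_polar_add s hs, show _ = b from hv, show _ = b from hw, add_self,
          zero_smul])
      rcases hfix c hc with rfl | rfl
      · exact Or.inl (eq_of_add (by rw [hvw, zero_smul]))
      · right
        refine eq_of_add ?_
        rw [← add_assoc, hvw, one_smul, add_self]
  tfae_have 3 → 1 := by
    rintro hapn ⟨t, ht⟩
    exact (not_isAPN_and_not_injective_of_root hcard s hs ht).1 hapn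
  tfae_finish
end

section
/- Let m ≥ 3 be an odd integer, let i be a positive integer with gcd(i,m) = 1, set q = 2^i and d = q² + q + 1. Let B_{m,q} = { a ∈ 𝔽_{2^m}^* : the polynomial Q_a(T) = T^{q²+q+1} + aT + 1 has no root in 𝔽_{2^m} \ {0} }. Then the cardinality of B_{m,q} satisfies |B_{m,q}| ≥ (2^m + 1 − (d−1)(d−2)·√(2^m) − d)/d (an inequality of real numbers), and for every a ∈ B_{m,q}, the map G_a : 𝔽_{2^m}³ → 𝔽_{2^m}³ is a bijection and is almost perfect nonlinear (APN). -/
open Matrix Finset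

/-! ### Power maps and the Frobenius on a field of odd degree over `𝔽₂` -/

theorem coprime_two_pow_sub_one {k m : ℕ} (h : Nat.Coprime k m) :
    Nat.Coprime (2 ^ m - 1) (2 ^ k - 1) := by
  rw [Nat.Coprime, Nat.pow_sub_one_gcd_pow_sub_one, Nat.gcd_comm, h.gcd_eq_one]
  rfl

theorem coprime_two_pow_add_one {m : ℕ} (hm : Odd m) {k : ℕ} (hk : 0 < k) :
    Nat.Coprime (2 ^ m - 1) (2 ^ k + 1) := by
  have h1 : Nat.gcd (2 ^ m - 1) (2 ^ k + 1) ∣ 2 ^ k - 1 := by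
    have h2 : Nat.gcd (2 ^ m - 1) (2 ^ k + 1) ∣ Nat.gcd (2 ^ m - 1) (2 ^ (2 * k) - 1) := by
      refine Nat.gcd_dvd_gcd_of_dvd_right _ ⟨2 ^ k - 1, ?_⟩
      rw [mul_comm 2 k, pow_mul]
      simpa using Nat.sq_sub_sq (2 ^ k) 1
    rw [Nat.pow_sub_one_gcd_pow_sub_one,
      (Nat.Coprime.gcd_mul_left_cancel_right k hm.coprime_two_left)] at h2
    exact h2.trans (Nat.pow_sub_one_dvd_pow_sub_one 2 (Nat.gcd_dvd_right m k))
  have hdvd : Nat.gcd (2 ^ m - 1) (2 ^ k + 1) ∣ 2 := by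
    have h3 := Nat.dvd_sub (Nat.gcd_dvd_right (2 ^ m - 1) (2 ^ k + 1)) h1
    have h4 : 1 ≤ 2 ^ k := Nat.one_le_two_pow
    rwa [show 2 ^ k + 1 - (2 ^ k - 1) = 2 by omega] at h3
  rcases (Nat.dvd_prime Nat.prime_two).1 hdvd with h | h
  · exact h
  · have h5 := Nat.gcd_dvd_right (2 ^ m - 1) (2 ^ k + 1)
    rw [h] at h5
    have h6 : 2 ∣ 2 ^ k := dvd_pow_self 2 hk.ne'
    omega

section PowerMaps

variable {F : Type*} [Field F] [Fintype F]

theorem exists_pow_eq_of_coprime {n : ℕ} (h : Nat.Coprime (Fintype.card F - 1) n) {c : F}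
    (hc : c ≠ 0) : ∃ x : F, x ≠ 0 ∧ x ^ n = c := by
  have h' : (Nat.card Fˣ).Coprime n := by
    classical rwa [Nat.card_eq_fintype_card, Fintype.card_units]
  obtain ⟨x, hx⟩ := (powCoprime h').surjective (Units.mk0 c hc)
  exact ⟨x, x.ne_zero, by simpa using congrArg Units.val hx⟩

theorem eq_one_of_pow_eq_one_of_coprime {n : ℕ} (h : Nat.Coprime (Fintype.card F - 1) n) {x : F}
    (hx : x ≠ 0) (hxn : x ^ n = 1) : x = 1 := by
  have h1 : orderOf x ∣ n := orderOf_dvd_of_pow_eq_one hxn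
  have h2 : orderOf x ∣ Fintype.card F - 1 :=
    orderOf_dvd_of_pow_eq_one (FiniteField.pow_card_sub_one_eq_one x hx)
  exact orderOf_eq_one_iff.1 (Nat.eq_one_of_dvd_coprimes h h2 h1)

end PowerMaps

/-- The properties of the automorphism `x ↦ x ^ 2 ^ i` of `𝔽_{2^m}`, for `m` odd and coprime
to `i`, on which the results below rest. -/
structure IsOddGenerator {F : Type*} [Field F] (σ : F →+* F) : Prop where
  add_self_ne_one : ∀ v, σ v + v ≠ 1
  eq_of_fixed : ∀ x, σ x = x → x = 0 ∨ x = 1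
  exists_eigenvector : ∀ c, c ≠ 0 → ∃ x, x ≠ 0 ∧ σ x = c * x
  exists_eigenvector_sq : ∀ c, c ≠ 0 → ∃ x, x ≠ 0 ∧ σ (σ x) = c * x
  eq_one_of_norm : ∀ x, x * σ x = 1 → x = 1
  surjective : Function.Surjective σ

theorem isOddGenerator_iterateFrobenius {F : Type*} [Field F] [Fintype F] [CharP F 2] {m i : ℕ}
    (hm : Odd m) (hi : 0 < i) (hgcd : Nat.Coprime i m) (hF : Fintype.card F = 2 ^ m) :
    IsOddGenerator (iterateFrobenius F 2 i) := by
  have hq : 1 ≤ 2 ^ i := Nat.one_le_two_pow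
  have hq' : (2 ^ i - 1) + 1 = 2 ^ i := by omega
  have hsub : Nat.Coprime (Fintype.card F - 1) (2 ^ i - 1) := hF ▸ coprime_two_pow_sub_one hgcd
  refine ⟨fun v hv => ?_, fun x hx => ?_, fun c hc => ?_, fun c hc => ?_, fun x hx => ?_,
    ?_⟩
  · set σ := iterateFrobenius F 2 i with hσ
    have h1 : σ v = v + 1 := by
      rw [← hv, add_comm (σ v), ← add_assoc, CharTwo.add_self_eq_zero, zero_add]
    have h2 : (σ ∘ σ) v = v := by
      simp [h1, add_assoc, CharTwo.add_self_eq_zero]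
    have h3 : ∀ n x, σ^[n] x = x ^ (2 ^ i) ^ n := by
      intro n x
      induction n with
      | zero => simp
      | succ n ih => rw [Function.iterate_succ_apply', ih, hσ, iterateFrobenius_def]; ring
    obtain ⟨k, rfl⟩ := hm
    have h4 : σ^[2 * k + 1] v = v := by
      rw [h3, ← pow_mul, mul_comm i, pow_mul, ← hF, FiniteField.pow_card_pow]
    rw [Function.iterate_succ_apply', Function.iterate_mul] at h4
    have h5 : (σ^[2])^[k] v = v := Function.iterate_fixed h2 k
    rw [h5, h1] at h4
    simp at h4
  · rw [or_iff_not_imp_left]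
    intro h0
    refine eq_one_of_pow_eq_one_of_coprime hsub h0 (mul_right_cancel₀ h0 ?_)
    rwa [← pow_succ, hq', one_mul]
  · obtain ⟨x, h0, hx⟩ := exists_pow_eq_of_coprime hsub hc
    exact ⟨x, h0, by rw [iterateFrobenius_def, ← hx, ← pow_succ, hq']⟩
  · have hcop : Nat.Coprime (2 * i) m := Nat.Coprime.mul_left hm.coprime_two_left hgcd
    obtain ⟨x, h0, hx⟩ := exists_pow_eq_of_coprime (hF ▸ coprime_two_pow_sub_one hcop) hc
    have hq2 : 1 ≤ 2 ^ (2 * i) := Nat.one_le_two_pow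
    refine ⟨x, h0, ?_⟩
    rw [iterateFrobenius_def, iterateFrobenius_def, ← hx, ← pow_succ, Nat.sub_add_cancel hq2,
      ← pow_mul, ← pow_add, two_mul]
  · have h0 : x ≠ 0 := by rintro rfl; simp at hx
    exact eq_one_of_pow_eq_one_of_coprime (hF ▸ coprime_two_pow_add_one hm hi) h0
      (by rw [pow_succ, mul_comm]; exact hx)
  · exact Finite.surjective_of_injective (RingHom.injective _)

/-! ### Fixed lines and invariant planes of a semilinear companion map -/

section Semilinear

variable {F : Type*} [Field F] {σ : F →+* F} {a : F}

theorem eq_zero_of_linearized (ha : ∀ t, t ≠ 0 → t * σ t * σ (σ t) + a * t + 1 ≠ 0) {x : F}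
    (hx : σ (σ (σ x)) + a * σ x + x = 0) : x = 0 := by
  by_contra h0
  refine ha (σ x / x) (div_ne_zero ((map_ne_zero σ).2 h0) h0) ?_
  have h1 : σ x ≠ 0 := (map_ne_zero σ).2 h0
  have h2 : σ (σ x) ≠ 0 := (map_ne_zero σ).2 h1
  simp only [map_div₀]
  field_simp
  linear_combination hx

/-- The `σ`-semilinear map attached to the companion matrix of `T ^ 3 + a * T + 1`. -/
def companionMap (σ : F →+* F) (a : F) (v : Fin 3 → F) : Fin 3 → F :=
  ![σ (v 2) + a * σ (v 1), σ (v 0), σ (v 1)]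

theorem companionMap_add (v w : Fin 3 → F) :
    companionMap σ a (v + w) = companionMap σ a v + companionMap σ a w := by
  ext j
  fin_cases j <;> simp [companionMap]; ring

theorem companionMap_smul (c : F) (v : Fin 3 → F) :
    companionMap σ a (c • v) = σ c • companionMap σ a v := by
  ext j
  fin_cases j <;> simp [companionMap]; ring

theorem companionMap_ne_zero {v : Fin 3 → F} (hv : v ≠ 0) : companionMap σ a v ≠ 0 := by
  intro h
  have e0 := congrFun h 0
  have e1 := congrFun h 1
  have e2 := congrFun h 2
  simp [companionMap] at e0 e1 e2
  refine hv (funext fun j => ?_)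
  fin_cases j <;> simp_all

/-- A vector whose cross product with `v ≠ 0` vanishes is a multiple of `v`. -/
theorem exists_smul_eq_of_cross_eq_zero {v w : Fin 3 → F} (hv : v ≠ 0)
    (h : v ⨯₃ w = 0) : ∃ c : F, w = c • v := by
  by_contra hne
  refine (crossProduct_ne_zero_iff_linearIndependent (v := v) (w := w)).2 ?_ h
  rw [LinearIndependent.pair_iff' hv]
  exact fun c hc => hne ⟨c, hc.symm⟩

/-- A vector orthogonal to two independent vectors is a multiple of their cross product. -/
theorem exists_smul_cross_eq {v w n : Fin 3 → F} (h : v ⨯₃ w ≠ 0) (hv : n ⬝ᵥ v = 0)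
    (hw : n ⬝ᵥ w = 0) : ∃ c : F, n = c • (v ⨯₃ w) := by
  refine exists_smul_eq_of_cross_eq_zero h ?_
  rw [← cross_anticomm, cross_cross_eq_smul_sub_smul', hw, dotProduct_comm, hv]
  simp

variable [CharP F 2]

theorem IsOddGenerator.eq_zero_of_adjoint [Finite F] (hσ : IsOddGenerator σ)
    (ha : ∀ t, t ≠ 0 → t * σ t * σ (σ t) + a * t + 1 ≠ 0) {y : F}
    (hy : σ (σ (σ y)) + a * σ (σ y) + y = 0) : y = 0 := by
  by_contra h0
  let L : F →+ F :=
    { toFun := fun x => σ (σ (σ x)) + a * σ x + x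
      map_zero' := by simp
      map_add' := fun x x' => by simp only [map_add]; ring }
  have hL : Function.Surjective L := Finite.surjective_of_injective
    ((injective_iff_map_eq_zero L).2 fun x hx => eq_zero_of_linearized ha hx)
  have hw : σ (σ y) ≠ 0 := by simpa using h0
  obtain ⟨x, hx⟩ := hL (σ (σ y))⁻¹
  have hx' : σ (σ y) * (σ (σ (σ x)) + a * σ x + x) = 1 := by
    rw [show σ (σ (σ x)) + a * σ x + x = (σ (σ y))⁻¹ from hx, mul_inv_cancel₀ hw]
  refine hσ.add_self_ne_one (σ y * σ (σ x) + y * σ x + σ (σ y) * x) ?_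
  have h2 : (2 : F) = 0 := CharTwo.two_eq_zero
  simp only [map_add, map_mul]
  linear_combination hx' + σ x * hy + (σ y * σ (σ x) - a * σ x * σ (σ y)) * h2

theorem IsOddGenerator.companionMap_fixed [Finite F] (hσ : IsOddGenerator σ)
    (ha : ∀ t, t ≠ 0 → t * σ t * σ (σ t) + a * t + 1 ≠ 0) {v : Fin 3 → F}
    (hv : companionMap σ a v = v) : v = 0 := by
  have e0 := congrFun hv 0
  have e1 := congrFun hv 1
  have e2 := congrFun hv 2
  simp [companionMap] at e0 e1 e2
  have h0 : v 0 = 0 := by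
    refine hσ.eq_zero_of_adjoint ha ?_
    have h2 : (2 : F) = 0 := CharTwo.two_eq_zero
    rw [e1, e2]
    linear_combination e0 - a * e2 + v 0 * h2
  have h1 : v 1 = 0 := by rw [← e1, h0, map_zero]
  have h2 : v 2 = 0 := by rw [← e2, h1, map_zero]
  ext j
  fin_cases j <;> assumption

theorem IsOddGenerator.cross_companionMap_ne_zero [Finite F] (hσ : IsOddGenerator σ)
    (ha : ∀ t, t ≠ 0 → t * σ t * σ (σ t) + a * t + 1 ≠ 0) {v : Fin 3 → F} (hv : v ≠ 0) :
    v ⨯₃ companionMap σ a v ≠ 0 := by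
  intro h
  obtain ⟨c, hc⟩ := exists_smul_eq_of_cross_eq_zero hv h
  have hc0 : c ≠ 0 := by
    rintro rfl
    exact companionMap_ne_zero hv (by rw [hc, zero_smul])
  obtain ⟨x, hx0, hx⟩ := hσ.exists_eigenvector c⁻¹ (inv_ne_zero hc0)
  refine smul_ne_zero hx0 hv (hσ.companionMap_fixed ha ?_)
  rw [companionMap_smul, hc, smul_smul, hx]
  congr 1
  field_simp

theorem IsOddGenerator.companionMap_companionMap_ne_smul [Finite F] (hσ : IsOddGenerator σ)
    (ha : ∀ t, t ≠ 0 → t * σ t * σ (σ t) + a * t + 1 ≠ 0) {v : Fin 3 → F} (hv : v ≠ 0) (c : F) :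
    companionMap σ a (companionMap σ a v) ≠ c • v := by
  intro hc
  have hc0 : c ≠ 0 := by
    rintro rfl
    exact companionMap_ne_zero (companionMap_ne_zero hv) (by rw [hc, zero_smul])
  obtain ⟨x, hx0, hx⟩ := hσ.exists_eigenvector_sq c⁻¹ (inv_ne_zero hc0)
  set w := x • v with hw
  have hw0 : w ≠ 0 := smul_ne_zero hx0 hv
  have hww : companionMap σ a (companionMap σ a w) = w := by
    rw [hw, companionMap_smul, companionMap_smul, hc, smul_smul, hx]
    congr 1
    field_simp
  have hsum : w + companionMap σ a w = 0 := by
    refine hσ.companionMap_fixed ha ?_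
    rw [companionMap_add, hww, add_comm]
  refine hw0 (hσ.companionMap_fixed ha ?_)
  have h2 : (2 : F) = 0 := CharTwo.two_eq_zero
  ext j
  have := congrFun hsum j
  simp only [Pi.add_apply, Pi.zero_apply] at this
  linear_combination this - w j * h2

/-- No plane is invariant: if `v, w` are independent, a vector orthogonal to them and to their
images vanishes. -/
theorem IsOddGenerator.eq_zero_of_orthogonal (hσ : IsOddGenerator σ)
    (ha : ∀ t, t ≠ 0 → t * σ t * σ (σ t) + a * t + 1 ≠ 0) {v w n : Fin 3 → F}
    (hvw : v ⨯₃ w ≠ 0) (hv : n ⬝ᵥ v = 0) (hw : n ⬝ᵥ w = 0)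
    (hv' : n ⬝ᵥ companionMap σ a v = 0) (hw' : n ⬝ᵥ companionMap σ a w = 0) : n = 0 := by
  by_contra hn
  obtain ⟨k, hk⟩ := exists_smul_cross_eq hvw hv hw
  have hk0 : k ≠ 0 := by
    rintro rfl
    exact hn (by rw [hk, zero_smul])
  have hcross : (σ ∘ v) ⨯₃ (σ ∘ w) = σ ∘ (v ⨯₃ w) := by
    ext j
    fin_cases j <;> simp [cross_apply]
  have hcross0 : (σ ∘ v) ⨯₃ (σ ∘ w) ≠ 0 := by
    rw [hcross]
    intro h
    exact hvw (funext fun j => (map_eq_zero σ).1 (congrFun h j))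
  obtain ⟨c, hc⟩ := exists_smul_cross_eq (n := ![n 1, a * n 0 + n 2, n 0]) hcross0
    (by
      simp only [companionMap, dotProduct, Fin.sum_univ_three] at hv' ⊢
      simp at hv' ⊢
      linear_combination hv')
    (by
      simp only [companionMap, dotProduct, Fin.sum_univ_three] at hw' ⊢
      simp at hw' ⊢
      linear_combination hw')
  have hσk : σ k ≠ 0 := (map_ne_zero σ).2 hk0
  have key : ![n 1, a * n 0 + n 2, n 0] = (c / σ k) • (σ ∘ n) := by
    rw [hc, hcross]
    ext j
    have : n j = k * (v ⨯₃ w) j := congrFun hk j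
    simp only [Pi.smul_apply, Function.comp_apply, smul_eq_mul, this, map_mul]
    field_simp
  set e := c / σ k
  have e0 : n 1 = e * σ (n 0) := by simpa using congrFun key 0
  have e1 : a * n 0 + n 2 = e * σ (n 1) := by simpa using congrFun key 1
  have e2 : n 0 = e * σ (n 2) := by simpa using congrFun key 2
  have he : e ≠ 0 := by
    intro h
    rw [h, zero_mul] at e0 e1 e2
    rw [e2, mul_zero, zero_add] at e1
    refine hn (funext fun j => ?_)
    fin_cases j <;> assumption
  obtain ⟨x, hx0, hx⟩ := hσ.exists_eigenvector e he
  have hx' : σ x ≠ 0 := (map_ne_zero σ).2 hx0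
  have h2 : (2 : F) = 0 := CharTwo.two_eq_zero
  have f0 : x * n 1 = σ (x * n 0) := by rw [map_mul, hx, e0]; ring
  have f1 : a * (x * n 0) + x * n 2 = σ (x * n 1) := by
    rw [map_mul, hx]; linear_combination x * e1
  have f2 : x * n 0 = σ (x * n 2) := by rw [map_mul, hx]; linear_combination x * e2
  have g2 : x * n 2 = 0 := by
    refine eq_zero_of_linearized ha ?_
    rw [← f2, ← f0, ← f1]
    linear_combination (a * (x * n 0) + x * n 2) * h2
  have g0 : x * n 0 = 0 := by rw [f2, g2, map_zero]
  have g1 : x * n 1 = 0 := by rw [f0, g0, map_zero]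
  refine hn (funext fun j => ?_)
  fin_cases j
  · exact (mul_eq_zero.1 g0).resolve_left hx0
  · exact (mul_eq_zero.1 g1).resolve_left hx0
  · exact (mul_eq_zero.1 g2).resolve_left hx0

end Semilinear

/-! ### The map `v ↦ v ⨯₃ φ v` -/

section CrossMap

variable {F : Type*} [Field F] {σ : F →+* F} {a : F}

/-- The coordinates of a triple as a vector. -/
def toVec {F : Type*} (p : F × F × F) : Fin 3 → F := ![p.1, p.2.1, p.2.2]

theorem toVec_injective {F : Type*} : Function.Injective (toVec (F := F)) := fun _ _ h =>
  Prod.ext (congrFun h 0) (Prod.ext (congrFun h 1) (congrFun h 2))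

theorem toVec_add (p p' : F × F × F) : toVec (p + p') = toVec p + toVec p' := by
  simp [toVec]

/-- The linear change of coordinates from `v ⨯₃ φ v` to `Gmap`. -/
def ofCross (a : F) (c : Fin 3 → F) : F × F × F := (c 2 + a * c 0, c 0, c 1)

theorem ofCross_injective : Function.Injective (ofCross a) := by
  intro c c' h
  simp only [ofCross, Prod.mk.injEq] at h
  obtain ⟨h2, h0, h1⟩ := h
  rw [h0] at h2
  ext j
  fin_cases j
  · exact h0
  · exact h1
  · exact add_right_cancel h2

theorem ofCross_add (c c' : Fin 3 → F) : ofCross a (c + c') = ofCross a c + ofCross a c' := by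
  simp only [ofCross, Pi.add_apply, Prod.mk_add_mk, Prod.mk.injEq, and_true]
  ring

variable [CharP F 2]

theorem cross_companionMap_add (u v : Fin 3 → F) :
    (v + u) ⨯₃ companionMap σ a (v + u) + v ⨯₃ companionMap σ a v =
      v ⨯₃ companionMap σ a u + u ⨯₃ companionMap σ a v + u ⨯₃ companionMap σ a u := by
  have h2 : (2 : Fin 3 → F) = 0 := CharTwo.two_eq_zero
  simp only [companionMap_add, map_add, LinearMap.add_apply]
  linear_combination (v ⨯₃ companionMap σ a v) * h2

theorem Gmap_eq_ofCross {q : ℕ} (hq : ∀ x, σ x = x ^ q) (p : F × F × F) :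
    Gmap q a p = ofCross a (toVec p ⨯₃ companionMap σ a (toVec p)) := by
  obtain ⟨x, y, z⟩ := p
  have h2 : (2 : F) = 0 := CharTwo.two_eq_zero
  simp only [Gmap, ofCross, toVec, cross_apply, companionMap, hq, Prod.mk.injEq]
  simp only [Matrix.cons_val]
  refine ⟨?_, ?_, ?_⟩
  · linear_combination (a * x ^ q * z + y * z ^ q) * h2
  · linear_combination x ^ q * z * h2
  · linear_combination x * y ^ q * h2

variable [Finite F]

theorem IsOddGenerator.cross_companionMap_injective (hσ : IsOddGenerator σ)
    (ha : ∀ t, t ≠ 0 → t * σ t * σ (σ t) + a * t + 1 ≠ 0) :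
    Function.Injective fun v : Fin 3 → F => v ⨯₃ companionMap σ a v := by
  intro v w h
  change v ⨯₃ companionMap σ a v = w ⨯₃ companionMap σ a w at h
  by_cases hv : v = 0
  · by_contra hne
    refine hσ.cross_companionMap_ne_zero ha (v := w) (fun hw => hne (hv.trans hw.symm)) ?_
    rw [← h, hv]
    simp
  by_cases hvw : v ⨯₃ w = 0
  · obtain ⟨c, rfl⟩ := exists_smul_eq_of_cross_eq_zero hv hvw
    rw [companionMap_smul, map_smul, map_smul, LinearMap.smul_apply, smul_smul] at h
    have hc : (1 - σ c * c) • (v ⨯₃ companionMap σ a v) = 0 := by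
      rw [sub_smul, one_smul, ← h, sub_self]
    have hc1 := (smul_eq_zero.1 hc).resolve_right (hσ.cross_companionMap_ne_zero ha hv)
    rw [hσ.eq_one_of_norm c (by linear_combination -hc1), one_smul]
  · refine absurd (hσ.eq_zero_of_orthogonal ha (n := v ⨯₃ companionMap σ a v) hvw ?_ ?_ ?_ ?_)
      (hσ.cross_companionMap_ne_zero ha hv)
    · rw [dotProduct_comm, dot_self_cross]
    · rw [h, dotProduct_comm, dot_self_cross]
    · rw [dotProduct_comm, dot_cross_self]
    · rw [h, dotProduct_comm, dot_cross_self]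

theorem IsOddGenerator.eq_zero_or_eq_of_cross_companionMap_eq (hσ : IsOddGenerator σ)
    (ha : ∀ t, t ≠ 0 → t * σ t * σ (σ t) + a * t + 1 ≠ 0) {u v : Fin 3 → F} (hu : u ≠ 0)
    (h : v ⨯₃ companionMap σ a u = u ⨯₃ companionMap σ a v) : v = 0 ∨ v = u := by
  by_cases huv : u ⨯₃ v = 0
  · obtain ⟨c, rfl⟩ := exists_smul_eq_of_cross_eq_zero hu huv
    rw [companionMap_smul, map_smul, map_smul, LinearMap.smul_apply] at h
    have hc : (c - σ c) • (u ⨯₃ companionMap σ a u) = 0 := by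
      rw [sub_smul, h, sub_self]
    have hc1 := (smul_eq_zero.1 hc).resolve_right (hσ.cross_companionMap_ne_zero ha hu)
    rcases hσ.eq_of_fixed c (sub_eq_zero.1 hc1).symm with rfl | rfl
    · exact Or.inl (zero_smul _ _)
    · exact Or.inr (one_smul _ _)
  · exfalso
    have hn : u ⨯₃ companionMap σ a v = 0 := by
      refine hσ.eq_zero_of_orthogonal ha huv ?_ ?_ ?_ ?_
      · rw [dotProduct_comm, dot_self_cross]
      · rw [← h, dotProduct_comm, dot_self_cross]
      · rw [← h, dotProduct_comm, dot_cross_self]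
      · rw [dotProduct_comm, dot_cross_self]
    rw [hn, ← cross_anticomm, neg_eq_zero] at h
    obtain ⟨c, rfl⟩ := exists_smul_eq_of_cross_eq_zero (companionMap_ne_zero hu) h
    obtain ⟨e, he⟩ := exists_smul_eq_of_cross_eq_zero hu hn
    rw [companionMap_smul] at he
    have hc : σ c ≠ 0 := by
      rw [map_ne_zero]
      rintro rfl
      exact huv (by simp)
    refine hσ.companionMap_companionMap_ne_smul ha hu ((σ c)⁻¹ * e) ?_
    rw [mul_smul, ← he, inv_smul_smul₀ hc]

theorem IsOddGenerator.bijective_Gmap (hσ : IsOddGenerator σ) {q : ℕ} (hq : ∀ x, σ x = x ^ q)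
    (ha : ∀ t, t ≠ 0 → t * σ t * σ (σ t) + a * t + 1 ≠ 0) : Function.Bijective (Gmap q a) := by
  refine Finite.injective_iff_bijective.1 fun p p' h => ?_
  rw [Gmap_eq_ofCross hq, Gmap_eq_ofCross hq] at h
  exact toVec_injective (hσ.cross_companionMap_injective ha (ofCross_injective h))

theorem IsOddGenerator.isAPN_Gmap (hσ : IsOddGenerator σ) {q : ℕ} (hq : ∀ x, σ x = x ^ q)
    (ha : ∀ t, t ≠ 0 → t * σ t * σ (σ t) + a * t + 1 ≠ 0) : IsAPN (Gmap q a) := by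
  have h2 : (2 : Fin 3 → F) = 0 := CharTwo.two_eq_zero
  intro u hu b
  rcases Set.eq_empty_or_nonempty {x : F × F × F | Gmap q a (x + u) + Gmap q a x = b} with
    he | ⟨x, hx⟩
  · simp [he]
  refine (Set.ncard_le_ncard (t := {x, x + u}) (fun y hy => ?_) (Set.toFinite _)).trans
    ((Set.ncard_insert_le _ _).trans (by rw [Set.ncard_singleton]))
  have hxy : Gmap q a (y + u) + Gmap q a y = Gmap q a (x + u) + Gmap q a x :=
    (show _ = b from hy).trans (show _ = b from hx).symm
  simp only [Gmap_eq_ofCross hq, ← ofCross_add, toVec_add] at hxy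
  have h := ofCross_injective hxy
  rw [cross_companionMap_add, cross_companionMap_add] at h
  have hu' : toVec u ≠ 0 := fun h0 => hu (toVec_injective (h0.trans (by ext j; fin_cases j <;> rfl)))
  have hsum : ∀ s t : Fin 3 → F, s + t = 0 → s = t := fun s t hst => by
    linear_combination hst - t * h2
  rcases hσ.eq_zero_or_eq_of_cross_companionMap_eq ha (v := toVec y + toVec x) hu' (by
      simp only [companionMap_add, map_add, LinearMap.add_apply]
      linear_combination h + (toVec x ⨯₃ companionMap σ a (toVec u) -
        toVec u ⨯₃ companionMap σ a (toVec y)) * h2) with h | h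
  · exact Or.inl (toVec_injective (hsum _ _ h))
  · refine Or.inr (toVec_injective ?_)
    rw [toVec_add]
    linear_combination h - toVec x * h2

end CrossMap

/-! ### Counting the parameters without roots -/

section Counting

variable {F : Type*} [Field F] [CharP F 2] [DecidableEq F] {σ : F →+* F}

theorem IsOddGenerator.card_le_two_mul (hσ : IsOddGenerator σ) {S S' : Finset F} {x₀ : F}
    (hx₀ : x₀ ≠ 0) (h : ∀ x ∈ S, σ (x / x₀) + x / x₀ ∈ S') : #S ≤ 2 * #S' := by
  have h2 : (2 : F) = 0 := CharTwo.two_eq_zero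
  refine card_le_mul_card_image_of_maps_to (f := fun x => σ (x / x₀) + x / x₀) h 2 fun z _ => ?_
  rcases Finset.eq_empty_or_nonempty {x ∈ S | σ (x / x₀) + x / x₀ = z} with he | ⟨x, hx⟩
  · rw [he]
    simp
  refine (card_le_card (t := {x, x + x₀}) fun y hy => ?_).trans card_le_two
  rw [mem_filter] at hx hy
  have hfix : σ ((y - x) / x₀) = (y - x) / x₀ := by
    rw [sub_div, map_sub]
    linear_combination hy.2 - hx.2 - (y / x₀ - x / x₀) * h2
  rw [mem_insert, mem_singleton]
  rcases hσ.eq_of_fixed _ hfix with h0 | h1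
  · left
    exact sub_eq_zero.1 ((div_eq_zero_iff.1 h0).resolve_right hx₀)
  · right
    linear_combination (div_eq_one_iff_eq hx₀).1 h1

variable [Fintype F]

theorem IsOddGenerator.card_linearized_one (hσ : IsOddGenerator σ) {a b : F} (ha : a ≠ 0) :
    #{x | a * σ x + b * x = 0} ≤ 2 := by
  by_cases hex : ∃ x₀, x₀ ≠ 0 ∧ a * σ x₀ + b * x₀ = 0
  · obtain ⟨x₀, h0, hx₀⟩ := hex
    have hσ0 : σ x₀ ≠ 0 := (map_ne_zero σ).2 h0
    refine hσ.card_le_two_mul (S' := {0}) h0 fun x hx => ?_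
    have h2 : (2 : F) = 0 := CharTwo.two_eq_zero
    replace hx := (mem_filter.1 hx).2
    obtain ⟨y, rfl⟩ : ∃ y, x = x₀ * y := ⟨x / x₀, by field_simp⟩
    rw [mul_div_cancel_left₀ _ h0, mem_singleton]
    refine (mul_eq_zero.1 (?_ : a * σ x₀ * (σ y + y) = 0)).resolve_left (mul_ne_zero ha hσ0)
    rw [map_mul] at hx
    linear_combination hx + y * hx₀ - b * x₀ * y * h2
  · push Not at hex
    refine (card_le_card (t := {0}) fun x hx => ?_).trans (by simp)
    by_contra hne
    exact hex x (by simpa using hne) (mem_filter.1 hx).2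

theorem IsOddGenerator.card_linearized_two (hσ : IsOddGenerator σ) {a b c : F} (ha : a ≠ 0) :
    #{x | a * σ (σ x) + b * σ x + c * x = 0} ≤ 4 := by
  by_cases hex : ∃ x₀, x₀ ≠ 0 ∧ a * σ (σ x₀) + b * σ x₀ + c * x₀ = 0
  · obtain ⟨x₀, h0, hx₀⟩ := hex
    have hσ0 : a * σ (σ x₀) ≠ 0 := mul_ne_zero ha (by simpa using h0)
    refine (hσ.card_le_two_mul h0 (S' := {z | a * σ (σ x₀) * σ z + (c * x₀) * z = 0})
      fun x hx => ?_).trans (Nat.mul_le_mul_left 2 (hσ.card_linearized_one hσ0))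
    have h2 : (2 : F) = 0 := CharTwo.two_eq_zero
    replace hx := (mem_filter.1 hx).2
    obtain ⟨y, rfl⟩ : ∃ y, x = x₀ * y := ⟨x / x₀, by field_simp⟩
    rw [mul_div_cancel_left₀ _ h0, mem_filter]
    refine ⟨mem_univ _, ?_⟩
    simp only [map_mul, map_add] at hx ⊢
    linear_combination hx + σ y * hx₀ - b * σ x₀ * σ y * h2
  · push Not at hex
    refine (card_le_card (t := {0}) fun x hx => ?_).trans (by simp)
    by_contra hne
    exact hex x (by simpa using hne) (mem_filter.1 hx).2

theorem IsOddGenerator.card_linearized_three (hσ : IsOddGenerator σ) (a : F) :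
    #{x | σ (σ (σ x)) + a * σ x + x = 0} ≤ 8 := by
  by_cases hex : ∃ x₀, x₀ ≠ 0 ∧ σ (σ (σ x₀)) + a * σ x₀ + x₀ = 0
  · obtain ⟨x₀, h0, hx₀⟩ := hex
    have hσ0 : σ (σ (σ x₀)) ≠ 0 := by simpa using h0
    refine (hσ.card_le_two_mul h0
      (S' := {z | σ (σ (σ x₀)) * σ (σ z) + σ (σ (σ x₀)) * σ z + x₀ * z = 0})
      fun x hx => ?_).trans (Nat.mul_le_mul_left 2 (hσ.card_linearized_two hσ0))
    have h2 : (2 : F) = 0 := CharTwo.two_eq_zero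
    replace hx := (mem_filter.1 hx).2
    obtain ⟨y, rfl⟩ : ∃ y, x = x₀ * y := ⟨x / x₀, by field_simp⟩
    rw [mul_div_cancel_left₀ _ h0, mem_filter]
    refine ⟨mem_univ _, ?_⟩
    simp only [map_mul, map_add] at hx ⊢
    linear_combination hx + σ y * hx₀ +
      (σ (σ (σ x₀)) * σ (σ y) - a * σ x₀ * σ y) * h2
  · push Not at hex
    refine (card_le_card (t := {0}) fun x hx => ?_).trans (by simp)
    by_contra hne
    exact hex x (by simpa using hne) (mem_filter.1 hx).2

/-- The nonzero roots of `T * σ T * σ² T + a * T + 1`. -/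
def companionRoots (σ : F →+* F) (a : F) : Finset F :=
  {t | t ≠ 0 ∧ t * σ t * σ (σ t) + a * t + 1 = 0}

theorem IsOddGenerator.card_companionRoots_le (hσ : IsOddGenerator σ) (a : F) :
    #(companionRoots σ a) ≤ 7 := by
  choose! g hg0 hg using hσ.exists_eigenvector
  have hmaps : ∀ t ∈ companionRoots σ a,
      g t ∈ ({x | σ (σ (σ x)) + a * σ x + x = 0} : Finset F).erase 0 := by
    intro t ht
    obtain ⟨ht0, ht⟩ := (mem_filter.1 ht).2
    rw [mem_erase, mem_filter]
    refine ⟨hg0 t ht0, mem_univ _, ?_⟩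
    simp only [hg t ht0, map_mul]
    linear_combination g t * ht
  have hinj : Set.InjOn g (companionRoots σ a) := by
    intro t ht t' ht' h
    have ht0 := (mem_filter.1 ht).2.1
    have ht0' := (mem_filter.1 ht').2.1
    refine mul_right_cancel₀ (hg0 t ht0) ?_
    rw [← hg t ht0, h, hg t' ht0']
  have h1 := card_le_card_of_injOn g hmaps hinj
  rw [card_erase_of_mem (by simp)] at h1
  have h8 := hσ.card_linearized_three a
  omega

theorem IsOddGenerator.exists_root_pair (hσ : IsOddGenerator σ)
    (hN : ∀ c, c ≠ 0 → ∃ t, t ≠ 0 ∧ t * σ t * σ (σ t) = c) {w : F} (h0 : w ≠ 0)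
    (h1 : w ≠ 1) : ∃ a t, t ∈ companionRoots σ a ∧ w * t ∈ companionRoots σ a := by
  have h2 : (2 : F) = 0 := CharTwo.two_eq_zero
  have hw1 : w + 1 ≠ 0 := fun h => h1 (by linear_combination h - h2)
  have hw2 : σ w * σ (σ w) + 1 ≠ 0 := by
    intro h
    refine h1 (hσ.eq_one_of_norm w (σ.injective ?_))
    rw [map_mul, map_one]
    linear_combination h - h2
  obtain ⟨t, ht0, ht⟩ := hN ((w + 1) / (w * (σ w * σ (σ w) + 1)))
    (div_ne_zero hw1 (mul_ne_zero h0 hw2))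
  rw [eq_div_iff (mul_ne_zero h0 hw2)] at ht
  have ha : (t * σ t * σ (σ t) + 1) / t * t = t * σ t * σ (σ t) + 1 := div_mul_cancel₀ _ ht0
  refine ⟨(t * σ t * σ (σ t) + 1) / t, t, mem_filter.2 ⟨mem_univ _, ht0, ?_⟩,
    mem_filter.2 ⟨mem_univ _, mul_ne_zero h0 ht0, ?_⟩⟩
  · rw [ha]
    linear_combination (t * σ t * σ (σ t) + 1) * h2
  · simp only [map_mul]
    linear_combination w * ha + ht + (w + 1) * h2

theorem sum_card_companionRoots_add_one_le :
    ∑ a, #(companionRoots σ a) + 1 ≤ Fintype.card F := by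
  have hle : #(univ.sigma (companionRoots σ)) ≤ #(univ.erase (0 : F)) := by
    refine card_le_card_of_injOn Sigma.snd (fun p hp => ?_) ?_
    · have hp2 := (mem_filter.1 (mem_sigma.1 hp).2).2.1
      simpa using hp2
    · rintro ⟨a, t⟩ hp ⟨a', t'⟩ hp' (rfl : t = t')
      obtain ⟨ht0, ht⟩ := (mem_filter.1 (mem_sigma.1 hp).2).2
      have ht' := (mem_filter.1 (mem_sigma.1 hp').2).2.2
      have haa : a = a' := mul_right_cancel₀ ht0 (by linear_combination ht - ht')
      rw [haa]
  rw [card_sigma, card_erase_of_mem (mem_univ _), card_univ] at hle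
  have := Fintype.card_pos (α := F)
  omega

theorem IsOddGenerator.card_le_seven_mul (hσ : IsOddGenerator σ)
    (hN : ∀ c, c ≠ 0 → ∃ t, t ≠ 0 ∧ t * σ t * σ (σ t) = c) :
    Fintype.card F + 5 ≤ 7 * #{a | companionRoots σ a = ∅} := by
  have hsum := sum_card_companionRoots_add_one_le (σ := σ)
  have hpairs : Fintype.card F ≤ ∑ a, #(companionRoots σ a).offDiag + 2 := by
    have hex : ∀ w : F, w ≠ 0 ∧ w ≠ 1 → ∃ a t, t ∈ companionRoots σ a ∧
        w * t ∈ companionRoots σ a := fun w hw => hσ.exists_root_pair hN hw.1 hw.2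
    choose! A T hT hT' using hex
    have hT0 : ∀ w, w ≠ 0 ∧ w ≠ 1 → T w ≠ 0 := fun w hw => (mem_filter.1 (hT w hw)).2.1
    have hle : #((univ.erase (0 : F)).erase 1) ≤
        #(univ.sigma fun a => (companionRoots σ a).offDiag) := by
      refine card_le_card_of_injOn (fun w => ⟨A w, (T w, w * T w)⟩) (fun w hw => ?_) ?_
      · have hw' : w ≠ 0 ∧ w ≠ 1 := by simpa [and_comm] using hw
        refine mem_sigma.2 ⟨mem_univ _, mem_offDiag.2 ⟨hT w hw', hT' w hw', fun h => hw'.2 ?_⟩⟩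
        exact mul_right_cancel₀ (hT0 w hw') (h.symm.trans (one_mul _).symm)
      · intro v hv w hw h
        have hv' : v ≠ 0 ∧ v ≠ 1 := by simpa [and_comm] using hv
        simp only [Sigma.mk.injEq, heq_eq_eq, Prod.mk.injEq] at h
        obtain ⟨-, h1, h2⟩ := h
        rw [← h1] at h2
        exact mul_right_cancel₀ (hT0 v hv') h2
    rw [card_sigma, card_erase_of_mem (by simp), card_erase_of_mem (mem_univ _), card_univ] at hle
    omega
  have hpoint : ∀ a, #(companionRoots σ a).offDiag + 7 ≤
      7 * #(companionRoots σ a) + 7 * (if companionRoots σ a = ∅ then 1 else 0) := by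
    intro a
    have h7 := hσ.card_companionRoots_le a
    split_ifs with h
    · simp [h]
    · have hpos := card_pos.2 (nonempty_iff_ne_empty.2 h)
      rw [offDiag_card]
      generalize #(companionRoots σ a) = r at *
      interval_cases r <;> simp
  have htotal := sum_le_sum fun a (_ : a ∈ (univ : Finset F)) => hpoint a
  rw [sum_add_distrib, sum_add_distrib, ← mul_sum, ← mul_sum, ← card_filter, sum_const, card_univ,
    smul_eq_mul] at htotal
  omega

theorem IsOddGenerator.exists_add_self_eq (hσ : IsOddGenerator σ) (y : F) :
    (∃ z, σ z + z = y) ∨ ∃ z, σ z + z = y + 1 := by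
  have h2 : (2 : F) = 0 := CharTwo.two_eq_zero
  set A : Finset F := univ.image fun z => σ z + z with hA
  have hcard : Fintype.card F ≤ 2 * #A := by
    refine (hσ.card_le_two_mul (S := univ) one_ne_zero fun x _ => ?_)
    rw [div_one]
    exact mem_image_of_mem _ (mem_univ x)
  have hdisj : Disjoint A (A.image (· + 1)) := by
    rw [disjoint_left]
    rintro _ hx hx'
    obtain ⟨z, -, rfl⟩ := mem_image.1 hx
    obtain ⟨_, hz', h⟩ := mem_image.1 hx'
    obtain ⟨z', -, rfl⟩ := mem_image.1 hz'
    refine hσ.add_self_ne_one (z + z') ?_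
    rw [map_add]
    linear_combination -h + (σ z' + z') * h2
  have huniv : A ∪ A.image (· + 1) = univ := by
    refine eq_univ_of_card _ (le_antisymm (card_le_univ _) ?_)
    rw [card_union_of_disjoint hdisj, card_image_of_injective _ (add_left_injective 1)]
    omega
  have hy : y ∈ A ∪ A.image (· + 1) := huniv ▸ mem_univ y
  rcases mem_union.1 hy with h | h
  · obtain ⟨z, -, hz⟩ := mem_image.1 h
    exact Or.inl ⟨z, hz⟩
  · obtain ⟨_, hz', rfl⟩ := mem_image.1 h
    obtain ⟨z, -, rfl⟩ := mem_image.1 hz'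
    exact Or.inr ⟨z, by linear_combination -h2⟩

theorem linearized_mul {a x : F} (hx : σ (σ (σ x)) + a * σ x + x = 0) (z : F) :
    σ (σ (σ (x * z))) + a * σ (x * z) + x * z =
      σ (σ (σ x)) * (σ (σ (σ z + z)) + σ (σ z + z)) + x * (σ z + z) := by
  have h2 : (2 : F) = 0 := CharTwo.two_eq_zero
  simp only [map_mul, map_add]
  linear_combination σ z * hx - (σ (σ (σ x)) * σ z + σ (σ (σ x)) * σ (σ z) + x * σ z) * h2

/-- Two independent solutions of the linearized equation do not both lie in the image of the
linearized polynomial. -/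
theorem IsOddGenerator.not_both_image (hσ : IsOddGenerator σ) {a x₁ x₂ u₁ u₂ : F} (h0 : x₁ ≠ 0)
    (h0' : x₂ ≠ 0) (hne : x₁ ≠ x₂) (hx₁ : σ (σ (σ x₁)) + a * σ x₁ + x₁ = 0)
    (hx₂ : σ (σ (σ x₂)) + a * σ x₂ + x₂ = 0) (hu₁ : σ (σ (σ u₁)) + a * σ u₁ + u₁ = x₁)
    (hu₂ : σ (σ (σ u₂)) + a * σ u₂ + u₂ = x₂) : False := by
  have h2 : (2 : F) = 0 := CharTwo.two_eq_zero
  obtain ⟨g, rfl⟩ : ∃ g, x₂ = x₁ * g := ⟨x₂ / x₁, by field_simp⟩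
  obtain ⟨z₁, rfl⟩ : ∃ z, u₁ = x₁ * z := ⟨u₁ / x₁, by field_simp⟩
  obtain ⟨z₂, rfl⟩ : ∃ z, u₂ = x₁ * z := ⟨u₂ / x₁, by field_simp⟩
  rw [linearized_mul hx₁] at hx₂ hu₁ hu₂
  have hy0 : σ g + g ≠ 0 := by
    intro h
    rcases hσ.eq_of_fixed g (by linear_combination h - g * h2) with rfl | rfl
    · simp at h0'
    · simp at hne
  set y := σ g + g with hy
  have hσy0 : σ (σ y) ≠ 0 := by simpa using hy0
  have hc0 : σ (σ (σ x₁)) ≠ 0 := by simpa using h0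
  have hred : ∀ h, σ (σ (σ x₁)) * (σ (σ (y * h)) + σ (y * h)) + x₁ * (y * h) =
      σ (σ (σ x₁)) * (σ (σ y) * σ (σ h + h) + (σ (σ y) + σ y) * (σ h + h)) := by
    intro h
    simp only [map_mul, map_add]
    linear_combination h * hx₂ - σ (σ (σ x₁)) *
      (σ (σ y) * h + σ y * h + σ (σ y) * σ h) * h2
  obtain ⟨p, hp⟩ : ∃ p, σ z₁ + z₁ + 1 = y * p := ⟨(σ z₁ + z₁ + 1) / y, by field_simp⟩
  obtain ⟨r, hr⟩ : ∃ r, σ z₂ + z₂ = y * r := ⟨(σ z₂ + z₂) / y, by field_simp⟩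
  have hp1 : σ (σ y) * σ (σ p + p) + (σ (σ y) + σ y) * (σ p + p) = 0 := by
    refine (mul_eq_zero.1 (?_ : σ (σ (σ x₁)) * _ = 0)).resolve_left hc0
    rw [← hred, ← hp]
    simp only [map_add, map_one]
    simp only [map_add] at hu₁
    linear_combination hu₁ + (σ (σ (σ x₁)) + x₁) * h2
  obtain ⟨f, hf⟩ : ∃ f, σ g = y * f := ⟨σ g / y, by field_simp⟩
  have hr1 : σ (σ y) * σ (σ (r + f) + (r + f) + 1) +
      (σ (σ y) + σ y) * (σ (r + f) + (r + f) + 1) = 0 := by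
    refine (mul_eq_zero.1 (?_ : σ (σ (σ x₁)) * _ = 0)).resolve_left hc0
    have e1 := hred r
    have e2 := hred f
    rw [← hr, hu₂] at e1
    rw [← hf] at e2
    have e3 : σ y = σ (σ g) + σ g := by rw [hy, map_add]
    have e4 : σ (σ y) = σ (σ (σ g)) + σ (σ g) := by rw [e3, map_add]
    simp only [map_add, map_one] at e1 e2 ⊢
    linear_combination -e1 - e2 + hx₂ - x₁ * hy +
      σ (σ (σ x₁)) * e4 + (σ (σ (σ x₁)) * (σ (σ (σ g)) + σ (σ g)) +
      x₁ * (y - g - σ g)) * h2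
  by_cases hp0 : σ p + p = 0
  · rcases hσ.eq_of_fixed p (by linear_combination hp0 - p * h2) with rfl | rfl
    · exact hσ.add_self_ne_one z₁ (by linear_combination hp - h2)
    · refine hσ.add_self_ne_one (z₁ + g) ?_
      rw [map_add]
      linear_combination hp + hy + (g + σ g - 1) * h2
  · have hfix : σ ((σ (r + f) + (r + f) + 1) / (σ p + p)) =
        (σ (r + f) + (r + f) + 1) / (σ p + p) := by
      rw [map_div₀, div_eq_div_iff ((map_ne_zero σ).2 hp0) hp0]
      refine mul_left_cancel₀ hσy0 ?_
      linear_combination (σ p + p) * hr1 - (σ (r + f) + (r + f) + 1) * hp1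
    rcases hσ.eq_of_fixed _ hfix with h | h
    · rw [div_eq_zero_iff, or_iff_left hp0] at h
      exact hσ.add_self_ne_one (r + f) (by linear_combination h - h2)
    · rw [div_eq_one_iff_eq hp0] at h
      refine hσ.add_self_ne_one (r + f + p) ?_
      rw [map_add]
      linear_combination h + (σ p + p - 1) * h2


/-- The nonzero `t` for which `z * (σ z + 1) * N(t) = 1`, with `N(t) = t * σ t * σ² t`, has
several solutions. -/
def multipleRoots (σ : F →+* F) : Finset F :=
  {t | ∃ z₁ z₂, z₁ ≠ z₂ ∧ z₁ * (σ z₁ + 1) * (t * σ t * σ (σ t)) = 1 ∧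
    z₂ * (σ z₂ + 1) * (t * σ t * σ (σ t)) = 1}

theorem IsOddGenerator.card_linearized_le (hσ : IsOddGenerator σ) (a : F) :
    #{x | σ (σ (σ x)) + a * σ x + x = 0} ≤ #(companionRoots σ a) + 1 := by
  have h0 : (0 : F) ∈ ({x | σ (σ (σ x)) + a * σ x + x = 0} : Finset F) := by simp
  rw [← card_erase_add_one h0, Nat.add_le_add_iff_right]
  refine card_le_card_of_injOn (fun x => σ x / x) (fun x hx => ?_) fun x hx y hy hxy => ?_
  · rw [mem_coe, mem_erase, mem_filter] at hx
    obtain ⟨hx0, -, hx⟩ := hx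
    have h1 : σ x ≠ 0 := (map_ne_zero σ).2 hx0
    have h2 : σ (σ x) ≠ 0 := (map_ne_zero σ).2 h1
    refine mem_filter.2 ⟨mem_univ _, div_ne_zero h1 hx0, ?_⟩
    simp only [map_div₀]
    field_simp
    linear_combination hx
  · rw [mem_coe, mem_erase] at hx hy
    have hxy' : σ (x / y) = x / y := by
      have := (map_ne_zero σ).2 hy.1
      rw [map_div₀, div_eq_div_iff this hy.1]
      linear_combination (div_eq_div_iff hx.1 hy.1).1 hxy
    rcases hσ.eq_of_fixed _ hxy' with h | h
    · exact absurd h (div_ne_zero hx.1 hy.1)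
    · exact (div_eq_one_iff_eq hy.1).1 h

/-- A root of multiplicity type yields further roots of the same polynomial: at least three in
total, and at least seven unless the associated solution lies in the image of the linearized
polynomial. -/
theorem IsOddGenerator.companionRoots_of_mem_multipleRoots (hσ : IsOddGenerator σ) {a t x : F}
    (hx0 : x ≠ 0) (hxt : σ x = t * x)
    (ht : t ∈ companionRoots σ a) (ht' : t ∈ multipleRoots σ) :
    3 ≤ #(companionRoots σ a) ∧
      (7 ≤ #(companionRoots σ a) ∨ ∃ u, σ (σ (σ u)) + a * σ u + u = x) := by
  have h2 : (2 : F) = 0 := CharTwo.two_eq_zero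
  obtain ⟨ht0, htr⟩ := (mem_filter.1 ht).2
  obtain ⟨z₁, z₂, hz, hz₁, hz₂⟩ := (mem_filter.1 ht').2
  have hx : σ (σ (σ x)) + a * σ x + x = 0 := by
    simp only [hxt, map_mul]
    linear_combination x * htr
  have hσx : σ (σ (σ x)) = t * σ t * σ (σ t) * x := by
    simp only [hxt, map_mul]
    ring
  have hker : ∀ z, z * (σ z + 1) * (t * σ t * σ (σ t)) = 1 → ∃ y, y ≠ 0 ∧ σ y = z * y ∧
      σ (σ (σ x)) * (σ (σ y) + σ y) + x * y = 0 := by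
    intro z hz
    have hz0 : z ≠ 0 := by rintro rfl; simp at hz
    obtain ⟨y, hy0, hy⟩ := hσ.exists_eigenvector z hz0
    refine ⟨y, hy0, hy, ?_⟩
    simp only [hσx, hy, map_mul]
    linear_combination x * y * hz + x * y * h2
  have hlift : ∀ z, σ (σ (σ x)) * (σ (σ (σ z + z)) + σ (σ z + z)) + x * (σ z + z) = 0 →
      σ (σ (σ (x * z))) + a * σ (x * z) + x * z = 0 := fun z hz => by rw [linearized_mul hx, hz]
  obtain ⟨y₁, hy₁0, hy₁, hy₁k⟩ := hker z₁ hz₁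
  obtain ⟨y₂, hy₂0, hy₂, hy₂k⟩ := hker z₂ hz₂
  have hy12 : y₁ ≠ y₂ := by
    rintro rfl
    exact hz (mul_right_cancel₀ hy₁0 (hy₁.symm.trans hy₂))
  have hcard := hσ.card_linearized_le a
  have hdouble : ∀ Y : Finset F, (∀ y ∈ Y, σ (σ (σ x)) * (σ (σ y) + σ y) + x * y = 0 ∧
      ∃ w, σ w + w = y) → 2 * #Y ≤ #(companionRoots σ a) + 1 := by
    intro Y hY
    choose! w hw using fun y hy => (hY y hy).2
    have hfixc : ∀ c : F, c = 0 ∨ c = 1 → σ c = c := by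
      rintro c (rfl | rfl)
      · exact map_zero σ
      · exact map_one σ
    refine le_trans ?_ hcard
    rw [mul_comm, ← card_pair (zero_ne_one (α := F)), ← card_product]
    refine card_le_card_of_injOn (fun p => x * (w p.1 + p.2)) ?_ ?_
    · rintro ⟨y, c⟩ hp
      rw [mem_coe, mem_product, mem_insert, mem_singleton] at hp
      have hc : σ (w y + c) + (w y + c) = y := by
        rw [map_add]
        linear_combination hw y hp.1 + hfixc c hp.2 + c * h2
      refine mem_filter.2 ⟨mem_univ _, hlift _ ?_⟩
      rw [hc]
      exact (hY y hp.1).1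
    · rintro ⟨y, c⟩ hp ⟨y', c'⟩ hp' h
      rw [mem_coe, mem_product, mem_insert, mem_singleton] at hp hp'
      have h' : w y + c = w y' + c' := mul_left_cancel₀ hx0 h
      have hyy : y = y' := by
        have h3 := congrArg σ h'
        rw [map_add, map_add, hfixc c hp.2, hfixc c' hp'.2] at h3
        rw [← hw y hp.1, ← hw y' hp'.1]
        linear_combination h3 + h' + (c' - c) * h2
      subst hyy
      rw [add_left_cancel h']
  have hthree : ∀ y, y ≠ 0 → σ (σ (σ x)) * (σ (σ y) + σ y) + x * y = 0 →
      (∃ w, σ w + w = y) → 3 ≤ #(companionRoots σ a) := by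
    intro y hy0 hy hw
    have h4 := hdouble {0, y} (by
      intro v hv
      rw [mem_insert, mem_singleton] at hv
      rcases hv with rfl | rfl
      · exact ⟨by simp, 0, by simp⟩
      · exact ⟨hy, hw⟩)
    rw [card_pair hy0.symm] at h4
    omega
  have himage : ∀ y, σ (σ (σ x)) * (σ (σ y) + σ y) + x * y = 0 →
      (∃ w, σ w + w = y + 1) → ∃ u, σ (σ (σ u)) + a * σ u + u = x := by
    rintro y hy ⟨w, hw⟩
    refine ⟨x * w, ?_⟩
    rw [linearized_mul hx, hw]
    simp only [map_add, map_one]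
    linear_combination hy + σ (σ (σ x)) * h2
  rcases hσ.exists_add_self_eq y₁ with hw₁ | hw₁
  · refine ⟨hthree y₁ hy₁0 hy₁k hw₁, ?_⟩
    rcases hσ.exists_add_self_eq y₂ with ⟨w₂, hw₂⟩ | hw₂
    · left
      obtain ⟨w₁, hw₁⟩ := hw₁
      have h8 := hdouble {0, y₁, y₂, y₁ + y₂} (by
        intro v hv
        simp only [mem_insert, mem_singleton] at hv
        rcases hv with rfl | rfl | rfl | rfl
        · exact ⟨by simp, 0, by simp⟩
        · exact ⟨hy₁k, w₁, hw₁⟩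
        · exact ⟨hy₂k, w₂, hw₂⟩
        · refine ⟨?_, w₁ + w₂, ?_⟩
          · simp only [map_add]
            linear_combination hy₁k + hy₂k
          · rw [map_add]
            linear_combination hw₁ + hw₂)
      have hy3 : y₁ + y₂ ≠ 0 := fun h => hy12 (by linear_combination h - y₂ * h2)
      rw [card_insert_of_notMem (by simp [hy₁0.symm, hy₂0.symm, hy3.symm]),
        card_insert_of_notMem (by simp [hy12, hy₂0]), card_pair (by simpa using hy₁0)] at h8
      omega
    · exact Or.inr (himage y₂ hy₂k hw₂)
  · refine ⟨?_, Or.inr (himage y₁ hy₁k hw₁)⟩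
    rcases hσ.exists_add_self_eq y₂ with hw₂ | hw₂
    · exact hthree y₂ hy₂0 hy₂k hw₂
    · obtain ⟨w₁, hw₁⟩ := hw₁
      obtain ⟨w₂, hw₂⟩ := hw₂
      refine hthree (y₁ + y₂) (fun h => hy12 (by linear_combination h - y₂ * h2)) ?_
        ⟨w₁ + w₂, ?_⟩
      · simp only [map_add]
        linear_combination hy₁k + hy₂k
      · rw [map_add]
        linear_combination hw₁ + hw₂ + h2

theorem IsOddGenerator.card_multipleRoots_le (hσ : IsOddGenerator σ) :
    6 * #(multipleRoots σ) + 7 ≤ 7 * #{a | companionRoots σ a = ∅} := by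
  have hmem : ∀ t : F, t ≠ 0 → t ∈ companionRoots σ ((t * σ t * σ (σ t) + 1) / t) := by
    intro t ht
    refine mem_filter.2 ⟨mem_univ _, ht, ?_⟩
    rw [div_mul_cancel₀ _ ht]
    linear_combination (t * σ t * σ (σ t) + 1) * (CharTwo.two_eq_zero : (2 : F) = 0)
  have hsum := sum_card_companionRoots_add_one_le (σ := σ)
  have hcover : #(multipleRoots σ) ≤ ∑ a, #(companionRoots σ a ∩ multipleRoots σ) := by
    refine (card_le_card fun t ht => ?_).trans card_biUnion_le
    have ht0 : t ≠ 0 := by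
      rintro rfl
      obtain ⟨z₁, z₂, -, h, -⟩ := (mem_filter.1 ht).2
      simp at h
    exact mem_biUnion.2 ⟨_, mem_univ _, mem_inter.2 ⟨hmem t ht0, ht⟩⟩
  have hpoint : ∀ a, 6 * #(companionRoots σ a ∩ multipleRoots σ) + 7 ≤
      7 * #(companionRoots σ a) + 7 * (if companionRoots σ a = ∅ then 1 else 0) := by
    intro a
    split_ifs with h
    · simp [h]
    have hpos := card_pos.2 (nonempty_iff_ne_empty.2 h)
    have hle : #(companionRoots σ a ∩ multipleRoots σ) ≤ #(companionRoots σ a) :=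
      card_le_card inter_subset_left
    by_cases h7 : 7 ≤ #(companionRoots σ a)
    · omega
    rcases Nat.lt_or_ge #(companionRoots σ a ∩ multipleRoots σ) 2 with hs | hs
    · rcases Nat.eq_zero_or_pos #(companionRoots σ a ∩ multipleRoots σ) with hs0 | hs0
      · omega
      · obtain ⟨t, ht⟩ := card_pos.1 hs0
        rw [mem_inter] at ht
        obtain ⟨x, hx0, hx⟩ := hσ.exists_eigenvector t (mem_filter.1 ht.1).2.1
        have := (hσ.companionRoots_of_mem_multipleRoots hx0 hx ht.1 ht.2).1
        omega
    · exfalso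
      obtain ⟨t, ht, t', ht', hne⟩ := one_lt_card.1 hs
      rw [mem_inter] at ht ht'
      have hker : ∀ t x, t ∈ companionRoots σ a → σ x = t * x →
          σ (σ (σ x)) + a * σ x + x = 0 := by
        intro t x ht hx
        simp only [hx, map_mul]
        linear_combination x * (mem_filter.1 ht).2.2
      obtain ⟨x, hx0, hx⟩ := hσ.exists_eigenvector t (mem_filter.1 ht.1).2.1
      obtain ⟨x', hx0', hx'⟩ := hσ.exists_eigenvector t' (mem_filter.1 ht'.1).2.1
      obtain ⟨u, hu⟩ :=
        (hσ.companionRoots_of_mem_multipleRoots hx0 hx ht.1 ht.2).2.resolve_left h7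
      obtain ⟨u', hu'⟩ :=
        (hσ.companionRoots_of_mem_multipleRoots hx0' hx' ht'.1 ht'.2).2.resolve_left h7
      refine hσ.not_both_image hx0 hx0' ?_ (hker t x ht.1 hx) (hker t' x' ht'.1 hx') hu hu'
      rintro rfl
      exact hne (mul_right_cancel₀ hx0 (hx.symm.trans hx'))
  have htotal := sum_le_sum fun a (_ : a ∈ (univ : Finset F)) => hpoint a
  rw [sum_add_distrib, sum_add_distrib, ← mul_sum, ← mul_sum, ← mul_sum, ← card_filter, sum_const,
    card_univ, smul_eq_mul] at htotal
  omega

end Counting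

/-! ### Binary expansions and power sums -/

section Binary

theorem land_eq_zero_iff_mod_div (m a b : ℕ) :
    a &&& b = 0 ↔ a % 2 ^ m &&& b % 2 ^ m = 0 ∧ a / 2 ^ m &&& b / 2 ^ m = 0 := by
  constructor
  · intro h
    rw [← Nat.and_mod_two_pow, ← Nat.and_div_two_pow, h]
    simp
  · intro h
    rw [← Nat.and_mod_two_pow, ← Nat.and_div_two_pow] at h
    rw [← Nat.div_add_mod (a &&& b) (2 ^ m), h.1, h.2]
    simp

theorem land_two_mul_add {a b c d : ℕ} (hc : c < 2) (hd : d < 2) :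
    (2 * a + c) &&& (2 * b + d) = 0 ↔ a &&& b = 0 ∧ ¬(c = 1 ∧ d = 1) := by
  rw [land_eq_zero_iff_mod_div 1, pow_one, show (2 * a + c) / 2 = a by omega,
    show (2 * b + d) / 2 = b by omega, show (2 * a + c) % 2 = c by omega,
    show (2 * b + d) % 2 = d by omega, and_comm]
  refine and_congr_right fun _ => ?_
  interval_cases c <;> interval_cases d <;> simp

theorem odd_choose_iff (n k : ℕ) :
    Odd (n.choose k) ↔ Odd ((n % 2).choose (k % 2)) ∧ Odd ((n / 2).choose (k / 2)) := by
  have : Fact (Nat.Prime 2) := ⟨Nat.prime_two⟩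
  have h : n.choose k ≡ (n % 2).choose (k % 2) * (n / 2).choose (k / 2) [MOD 2] :=
    Choose.choose_modEq_choose_mod_mul_choose_div_nat
  rw [← Nat.odd_mul, Nat.odd_iff, Nat.odd_iff, h]

theorem land_eq_zero_of_odd_choose_add (a b : ℕ) (h : Odd ((a + b).choose a)) : a &&& b = 0 := by
  induction a using Nat.strong_induction_on generalizing b with
  | _ a ih =>
    rcases Nat.eq_zero_or_pos a with rfl | ha
    · simp
    rw [odd_choose_iff] at h
    rw [← Nat.div_add_mod a 2, ← Nat.div_add_mod b 2,
      land_two_mul_add (Nat.mod_lt _ two_pos) (Nat.mod_lt _ two_pos)]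
    have hne : ¬(a % 2 = 1 ∧ b % 2 = 1) := by
      rintro ⟨h1, h2⟩
      rw [h1, show (a + b) % 2 = 0 by omega] at h
      simp at h
    refine ⟨ih _ (by omega) _ ?_, hne⟩
    rw [show (a + b) / 2 = a / 2 + b / 2 by omega] at h
    exact h.2

theorem odd_choose_compl_iff {m a s : ℕ} (ha : a < 2 ^ m) (hs : s < 2 ^ m) :
    Odd ((2 ^ m - 1 - a).choose s) ↔ s &&& a = 0 := by
  induction m generalizing a s with
  | zero =>
    obtain rfl : a = 0 := by simpa using ha
    obtain rfl : s = 0 := by simpa using hs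
    simp
  | succ m ih =>
    rw [pow_succ] at ha hs
    have h1 : (2 ^ (m + 1) - 1 - a) / 2 = 2 ^ m - 1 - a / 2 := by rw [pow_succ]; omega
    have h2 : (2 ^ (m + 1) - 1 - a) % 2 = 1 - a % 2 := by rw [pow_succ]; omega
    rw [odd_choose_iff, h1, h2, ih (by omega) (by omega)]
    conv_rhs => rw [← Nat.div_add_mod a 2, ← Nat.div_add_mod s 2]
    rw [land_two_mul_add (Nat.mod_lt _ two_pos) (Nat.mod_lt _ two_pos), and_comm]
    refine and_congr_right fun _ => ?_
    rcases Nat.mod_two_eq_zero_or_one a with h | h <;>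
      rcases Nat.mod_two_eq_zero_or_one s with h' | h' <;> simp [h, h']

theorem two_mul_mod_two_pow_sub_one {m a : ℕ} (ha : a < 2 ^ (m + 1) - 1) :
    2 * a % (2 ^ (m + 1) - 1) = 2 * (a % 2 ^ m) + a / 2 ^ m := by
  have hlt : a / 2 ^ m < 2 := by
    rw [Nat.div_lt_iff_lt_mul (by positivity)]
    rw [pow_succ] at ha
    omega
  have hdm := Nat.div_add_mod a (2 ^ m)
  have hmod := Nat.mod_lt a (show 0 < 2 ^ m by positivity)
  rw [pow_succ] at ha ⊢
  generalize a / 2 ^ m = c at *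
  generalize a % 2 ^ m = r at *
  generalize 2 ^ m = P at *
  interval_cases c
  · rw [Nat.mod_eq_of_lt] <;> omega
  · rw [Nat.mod_eq_sub_mod (by omega), Nat.mod_eq_of_lt] <;> omega

theorem land_rotate {m a b : ℕ} (ha : a < 2 ^ (m + 1) - 1) (hb : b < 2 ^ (m + 1) - 1)
    (h : a &&& b = 0) :
    2 * a % (2 ^ (m + 1) - 1) &&& 2 * b % (2 ^ (m + 1) - 1) = 0 := by
  have hlt : ∀ c < 2 ^ (m + 1) - 1, c / 2 ^ m < 2 := fun c hc => by
    rw [Nat.div_lt_iff_lt_mul (by positivity)]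
    rw [pow_succ] at hc
    omega
  rw [two_mul_mod_two_pow_sub_one ha, two_mul_mod_two_pow_sub_one hb,
    land_two_mul_add (hlt a ha) (hlt b hb)]
  obtain ⟨h1, h2⟩ := (land_eq_zero_iff_mod_div m a b).1 h
  refine ⟨h1, ?_⟩
  rintro ⟨h3, h4⟩
  rw [h3, h4] at h2
  simp at h2

/-- Disjoint binary expansions of length `m + 1` stay disjoint under rotation, so their leading
digits never agree. -/
theorem not_both_le_of_land_eq_zero {m a b : ℕ} (ha : a < 2 ^ (m + 1) - 1)
    (hb : b < 2 ^ (m + 1) - 1) (h : a &&& b = 0) (n : ℕ) :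
    ¬(2 ^ m ≤ 2 ^ n * a % (2 ^ (m + 1) - 1) ∧ 2 ^ m ≤ 2 ^ n * b % (2 ^ (m + 1) - 1)) := by
  have hpos : 0 < 2 ^ (m + 1) - 1 := by omega
  have hrot : 2 ^ n * a % (2 ^ (m + 1) - 1) &&& 2 ^ n * b % (2 ^ (m + 1) - 1) = 0 := by
    induction n with
    | zero => simpa [Nat.mod_eq_of_lt ha, Nat.mod_eq_of_lt hb] using h
    | succ n ih =>
      have := land_rotate (Nat.mod_lt _ hpos) (Nat.mod_lt _ hpos) ih
      simpa only [Nat.mul_mod_mod, pow_succ', mul_assoc] using this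
  generalize hA : 2 ^ n * a % (2 ^ (m + 1) - 1) = A at *
  generalize hB : 2 ^ n * b % (2 ^ (m + 1) - 1) = B at *
  rintro ⟨h1, h2⟩
  have hone : ∀ c, 2 ^ m ≤ c → c < 2 ^ (m + 1) - 1 → c / 2 ^ m = 1 := fun c hc hc' => by
    rw [Nat.div_eq_iff (by positivity)]
    rw [pow_succ] at hc'
    omega
  have := ((land_eq_zero_iff_mod_div m A B).1 hrot).2
  rw [hone A h1 (hA ▸ Nat.mod_lt _ hpos), hone B h2 (hB ▸ Nat.mod_lt _ hpos)] at this
  simp at this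

end Binary

section PowerSum

variable {F : Type*} [Field F] [Fintype F] [DecidableEq F]

/-- A nonempty set of nonzero elements has more members than any run of vanishing power sums. -/
theorem card_gt_of_powerSum_eq_zero {S : Finset F} (h0 : (0 : F) ∉ S) (hS : S.Nonempty) {k L : ℕ}
    (h : ∀ j < L, ∑ x ∈ S, x ^ (k + j) = 0) : L < #S := by
  by_contra! hle
  obtain ⟨b, hb⟩ := hS
  set p : Polynomial F := ∏ x ∈ S.erase b, (Polynomial.X - Polynomial.C x) with hp
  have hdeg : p.natDegree + 1 ≤ #S := by
    rw [hp, Polynomial.natDegree_prod_of_monic _ _ fun x _ => Polynomial.monic_X_sub_C x]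
    simp only [Polynomial.natDegree_X_sub_C, sum_const, smul_eq_mul, mul_one]
    rw [card_erase_add_one hb]
  have h1 : ∑ x ∈ S, x ^ k * p.eval x = 0 := by
    simp_rw [Polynomial.eval_eq_sum_range, mul_sum]
    rw [sum_comm]
    refine sum_eq_zero fun j hj => ?_
    have hj' := h j (by have := mem_range.1 hj; omega)
    calc ∑ x ∈ S, x ^ k * (p.coeff j * x ^ j) = p.coeff j * ∑ x ∈ S, x ^ (k + j) := by
          rw [mul_sum]
          exact sum_congr rfl fun x _ => by ring
      _ = 0 := by rw [hj', mul_zero]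
  rw [sum_eq_single_of_mem b hb] at h1
  · rcases mul_eq_zero.1 h1 with h2 | h2
    · exact h0 (eq_zero_of_pow_eq_zero h2 ▸ hb)
    · rw [hp, Polynomial.eval_prod, prod_eq_zero_iff] at h2
      obtain ⟨x, hx, hxb⟩ := h2
      simp only [Polynomial.eval_sub, Polynomial.eval_X, Polynomial.eval_C, sub_eq_zero] at hxb
      exact (mem_erase.1 hx).1 hxb.symm
  · intro x hx hxb
    rw [hp, Polynomial.eval_prod, prod_eq_zero (mem_erase.2 ⟨hxb, hx⟩) (by simp), mul_zero]

theorem sum_pow_eq_ite {n : ℕ} (hn : n ≠ 0) :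
    ∑ x : F, x ^ n = if Fintype.card F - 1 ∣ n then -1 else 0 := by
  rw [← FiniteField.sum_pow_units F n, ← Fintype.sum_subtype_add_sum_subtype (fun x : F => x ≠ 0)]
  have hz : ∑ x : {x : F // ¬x ≠ 0}, (x : F) ^ n = 0 :=
    sum_eq_zero fun x _ => by rw [not_not.1 x.2, zero_pow hn]
  rw [hz, add_zero]
  exact (Fintype.sum_equiv unitsEquivNeZero _ _ fun x => rfl).symm

theorem sum_pow_mul_pow_add_one [CharP F 2] {a b n : ℕ} (ha : a ≠ 0) :
    ∑ t : F, t ^ a * (t ^ b + 1) ^ n =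
      ∑ s ∈ range (n + 1) with Fintype.card F - 1 ∣ a + b * s, (n.choose s : F) := by
  simp_rw [add_pow, one_pow, mul_one, mul_sum]
  rw [sum_comm, sum_filter]
  refine sum_congr rfl fun s _ => ?_
  have : ∀ t : F, t ^ a * ((t ^ b) ^ s * (n.choose s : F)) =
      (n.choose s : F) * t ^ (a + b * s) := fun t => by ring
  simp_rw [this]
  rw [← mul_sum, sum_pow_eq_ite (by omega)]
  split_ifs <;> simp [CharTwo.neg_eq]

end PowerSum

/-! ### Reduction to the fibres of `t ↦ t * (σ t + 1)` -/

section Fibres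

variable {F : Type*} [Field F] [Fintype F] [CharP F 2] [DecidableEq F] {σ : F →+* F}

theorem even_card_of_add_mem {S : Finset F} {x : F} (hx : x ≠ 0) (h : ∀ y ∈ S, y + x ∈ S) :
    Even #S := by
  have h0 : ∑ _y ∈ S, (1 : ZMod 2) = 0 :=
    sum_involution (fun y _ => y + x) (fun _ _ => by decide) (fun y _ _ => by simpa using hx)
      (fun y hy => h y hy) fun y _ => by
        rw [add_assoc, CharTwo.add_self_eq_zero, add_zero]
  rw [sum_const, nsmul_eq_mul, mul_one] at h0
  exact (ZMod.natCast_eq_zero_iff_even).1 h0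

/-- The fibre of `t ↦ t * (σ t + 1)` over `e`. -/
def quadFibre (σ : F →+* F) (e : F) : Finset F := {t | t * (σ t + 1) = e}

theorem IsOddGenerator.card_quadFibre_add_one (hσ : IsOddGenerator σ) {e : F} (he : e ≠ 0) :
    #(quadFibre σ e) + 1 = #{y | 1 * σ (σ y) + 1 * σ y + e * y = 0} := by
  have h2 : (2 : F) = 0 := CharTwo.two_eq_zero
  have h0 : (0 : F) ∈ ({y | 1 * σ (σ y) + 1 * σ y + e * y = 0} : Finset F) := by simp
  rw [← card_erase_add_one h0, Nat.add_right_cancel_iff, eq_comm]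
  refine card_bij (fun y _ => σ y / y) (fun y hy => ?_) (fun x hx y hy hxy => ?_) fun t ht => ?_
  · rw [mem_erase, mem_filter] at hy
    obtain ⟨hy0, -, hy⟩ := hy
    have h1 : σ y ≠ 0 := (map_ne_zero σ).2 hy0
    refine mem_filter.2 ⟨mem_univ _, ?_⟩
    rw [map_div₀]
    field_simp
    linear_combination hy - e * y * h2
  · rw [mem_erase] at hx hy
    have hxy' : σ (x / y) = x / y := by
      have := (map_ne_zero σ).2 hy.1
      rw [map_div₀, div_eq_div_iff this hy.1]
      linear_combination (div_eq_div_iff hx.1 hy.1).1 hxy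
    rcases hσ.eq_of_fixed _ hxy' with h | h
    · exact absurd h (div_ne_zero hx.1 hy.1)
    · exact (div_eq_one_iff_eq hy.1).1 h
  · replace ht := (mem_filter.1 ht).2
    have ht0 : t ≠ 0 := by
      rintro rfl
      rw [zero_mul] at ht
      exact he ht.symm
    obtain ⟨y, hy0, hy⟩ := hσ.exists_eigenvector t ht0
    refine ⟨y, mem_erase.2 ⟨hy0, mem_filter.2 ⟨mem_univ _, ?_⟩⟩, by rw [hy]; field_simp⟩
    simp only [hy, map_mul]
    linear_combination y * ht + e * y * h2

theorem IsOddGenerator.card_quadFibre_le (hσ : IsOddGenerator σ) {e : F} (he : e ≠ 0) :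
    #(quadFibre σ e) ≤ 3 := by
  have := hσ.card_quadFibre_add_one he
  have := hσ.card_linearized_two (b := 1) (c := e) (one_ne_zero (α := F))
  omega

theorem IsOddGenerator.natCast_card_quadFibre (hσ : IsOddGenerator σ) {e : F} (he : e ≠ 0) :
    (#(quadFibre σ e) : F) = if quadFibre σ e = ∅ then 0 else 1 := by
  split_ifs with h
  · simp [h]
  · obtain ⟨t, ht⟩ := nonempty_iff_ne_empty.2 h
    have hcard := hσ.card_quadFibre_add_one he
    have hpos := card_pos.2 ⟨t, ht⟩
    obtain ⟨x, hx, hx0⟩ : ∃ x ∈ ({y | 1 * σ (σ y) + 1 * σ y + e * y = 0} : Finset F), x ≠ 0 :=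
      exists_mem_ne (by omega) 0
    have heven : Even #{y | 1 * σ (σ y) + 1 * σ y + e * y = 0} := by
      refine even_card_of_add_mem hx0 fun y hy => mem_filter.2 ⟨mem_univ _, ?_⟩
      simp only [map_add]
      linear_combination (mem_filter.1 hy).2 + (mem_filter.1 hx).2
    rw [← hcard] at heven
    have hzero : ((#(quadFibre σ e) + 1 : ℕ) : F) = 0 := by
      rw [CharP.cast_eq_zero_iff F 2]
      exact heven.two_dvd
    push_cast at hzero
    linear_combination hzero - (CharTwo.two_eq_zero : (2 : F) = 0)

/-- The elements whose `M`-th power is one. -/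
def powKernel (F : Type*) [Field F] [Fintype F] [DecidableEq F] (M : ℕ) : Finset F :=
  {e | e ^ M = 1}

theorem mem_powKernel {M : ℕ} {e : F} : e ∈ powKernel F M ↔ e ^ M = 1 := by
  simp [powKernel]

theorem ne_zero_of_mem_powKernel {M : ℕ} (hM : 0 < M) {e : F} (he : e ∈ powKernel F M) :
    e ≠ 0 := by
  rintro rfl
  simp [mem_powKernel, hM.ne'] at he

theorem card_powKernel_le {M : ℕ} (hM : 0 < M) : #(powKernel F M) ≤ M := by
  refine le_trans (card_le_card fun e he => ?_)
    ((Multiset.toFinset_card_le _).trans (Polynomial.card_nthRoots M (1 : F)))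
  rw [Multiset.mem_toFinset, Polynomial.mem_nthRoots hM]
  exact mem_powKernel.1 he

/-- The elements of the kernel over which the fibre has several points. -/
def multipleFibres (σ : F →+* F) (M : ℕ) : Finset F :=
  {e ∈ powKernel F M | 2 ≤ #(quadFibre σ e)}

/-- The elements of the kernel over which the fibre is a single point. -/
def singleFibres (σ : F →+* F) (M : ℕ) : Finset F :=
  {e ∈ powKernel F M | #(quadFibre σ e) = 1}

/-- The elements of the kernel over which the fibre is empty. -/
def emptyFibres (σ : F →+* F) (M : ℕ) : Finset F :=
  {e ∈ powKernel F M | quadFibre σ e = ∅}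

/-- The elements mapped into the kernel. -/
def kernelPreimage (σ : F →+* F) (M : ℕ) : Finset F := {t | (t * (σ t + 1)) ^ M = 1}

theorem card_kernelPreimage (M : ℕ) :
    #(kernelPreimage σ M) = ∑ e ∈ powKernel F M, #(quadFibre σ e) := by
  rw [card_eq_sum_card_fiberwise (f := fun t => t * (σ t + 1)) (t := powKernel F M)]
  · refine sum_congr rfl fun e he => congrArg card ?_
    ext t
    simp only [kernelPreimage, quadFibre, mem_filter, mem_univ, true_and, and_iff_right_iff_imp]
    rintro rfl
    exact mem_powKernel.1 he
  · intro t ht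
    exact mem_powKernel.2 (mem_filter.1 ht).2

theorem IsOddGenerator.card_kernelPreimage_le (hσ : IsOddGenerator σ) {M : ℕ} (hM : 0 < M) :
    #(kernelPreimage σ M) ≤ #(singleFibres σ M) + 3 * #(multipleFibres σ M) := by
  rw [card_kernelPreimage, singleFibres, multipleFibres, card_filter, card_filter, mul_sum,
    ← sum_add_distrib]
  refine sum_le_sum fun e he => ?_
  have := hσ.card_quadFibre_le (ne_zero_of_mem_powKernel hM he)
  generalize #(quadFibre σ e) = r at *
  interval_cases r <;> simp

theorem IsOddGenerator.card_kernelPreimage_add_le (hσ : IsOddGenerator σ) {M : ℕ} (hM : 0 < M) :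
    #(kernelPreimage σ M) + #(emptyFibres σ M) ≤ M + 2 * #(multipleFibres σ M) := by
  refine le_trans ?_ (Nat.add_le_add_right (card_powKernel_le (F := F) hM) _)
  rw [card_kernelPreimage, emptyFibres, multipleFibres, card_filter, card_filter, card_eq_sum_ones,
    mul_sum, ← sum_add_distrib, ← sum_add_distrib]
  refine sum_le_sum fun e he => ?_
  have := hσ.card_quadFibre_le (ne_zero_of_mem_powKernel hM he)
  simp only [← card_eq_zero (s := quadFibre σ e)]
  generalize #(quadFibre σ e) = r at *
  interval_cases r <;> simp

theorem exists_isPrimitiveRoot_of_card {n M : ℕ} (hF : Fintype.card F = n * M + 1) :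
    ∃ g : F, IsPrimitiveRoot g (n * M) ∧ ∀ x : F, x ≠ 0 → ∃ k : ℕ, x = g ^ k := by
  obtain ⟨g, hg⟩ := IsCyclic.exists_generator (α := Fˣ)
  have hord : orderOf g = n * M := by
    rw [orderOf_eq_card_of_forall_mem_zpowers hg, Nat.card_eq_fintype_card, Fintype.card_units, hF]
    rfl
  refine ⟨g, ?_, fun x hx => ?_⟩
  · rw [IsPrimitiveRoot.coe_units_iff, ← hord]
    exact IsPrimitiveRoot.orderOf g
  · obtain ⟨k, hk⟩ := mem_powers_iff_mem_zpowers.2 (hg (Units.mk0 x hx))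
    exact ⟨k, by simpa using (congrArg Units.val hk).symm⟩

theorem exists_pow_eq_of_mem_powKernel {n M d : ℕ} (hF : Fintype.card F = n * M + 1) (hM : 0 < M)
    (hn : 0 < n) (hd : Nat.Coprime d M) {e : F} (he : e ∈ powKernel F M) :
    ∃ t, t ^ (n * d) = e := by
  obtain ⟨g, hg, hgen⟩ := exists_isPrimitiveRoot_of_card hF
  rw [mem_powKernel] at he
  obtain ⟨k, hk⟩ : ∃ k, (e ^ k) ^ d = e := by
    obtain ⟨k, hk⟩ := (Nat.exists_mul_mod_eq_of_coprime 1 hd hM.ne')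
    refine ⟨k, ?_⟩
    rw [← pow_mul, mul_comm k d, ← Nat.div_add_mod (d * k) M, hk.2, pow_add, pow_mul, he, one_pow,
      one_mul]
    rcases Nat.lt_or_ge 1 M with h | h
    · rw [Nat.mod_eq_of_lt h, pow_one]
    · obtain rfl : M = 1 := by omega
      simpa using he.symm
  have he0 : e ≠ 0 := by
    rintro rfl
    simp [hM.ne'] at he
  obtain ⟨l, rfl⟩ := hgen e he0
  rw [← pow_mul, hg.pow_eq_one_iff_dvd] at he
  obtain ⟨r, rfl⟩ := Nat.dvd_of_mul_dvd_mul_right hM he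
  refine ⟨(g ^ r) ^ k, ?_⟩
  rw [← hk]
  simp only [← pow_mul]
  ring_nf

theorem seven_mul_card_multipleFibres_le {M d : ℕ} (hF : Fintype.card F = 7 * M + 1) (hM : 0 < M)
    (hd0 : 0 < d) (hd : Nat.Coprime d M) (hN : ∀ t : F, t * σ t * σ (σ t) = t ^ (7 * d)) :
    7 * #(multipleFibres σ M) ≤ #(multipleRoots σ) := by
  obtain ⟨g, hg, -⟩ := exists_isPrimitiveRoot_of_card hF
  have hζ : IsPrimitiveRoot (g ^ M) 7 := hg.pow (by positivity) (mul_comm 7 M)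
  have hne : ∀ e ∈ multipleFibres σ M, e ≠ 0 := fun e he =>
    ne_zero_of_mem_powKernel hM (mem_filter.1 he).1
  have hroot : ∀ e ∈ multipleFibres σ M, ∃ t, t ≠ 0 ∧ e * t ^ (7 * d) = 1 := by
    intro e he
    obtain ⟨t, ht⟩ := exists_pow_eq_of_mem_powKernel hF hM (by norm_num) hd (mem_filter.1 he).1
    have ht0 : t ≠ 0 := by
      rintro rfl
      rw [zero_pow (by positivity)] at ht
      exact hne e he ht.symm
    exact ⟨t⁻¹, inv_ne_zero ht0, by rw [inv_pow, ht, mul_inv_cancel₀ (hne e he)]⟩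
  choose! T hT0 hT using hroot
  have hζd : ∀ k : ℕ, ((g ^ M) ^ k) ^ (7 * d) = 1 := fun k => by
    rw [← pow_mul, mul_comm, mul_assoc, pow_mul, hζ.pow_eq_one, one_pow]
  rw [← card_range 7, mul_comm, ← card_product]
  refine card_le_card_of_injOn (fun p => T p.1 * (g ^ M) ^ p.2) ?_ ?_
  · rintro ⟨e, k⟩ hp
    have he := (mem_product.1 hp).1
    obtain ⟨t₁, ht₁, t₂, ht₂, h12⟩ := one_lt_card.1 (mem_filter.1 he).2
    refine mem_filter.2 ⟨mem_univ _, t₁, t₂, h12, ?_, ?_⟩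
    · rw [(mem_filter.1 ht₁).2, hN, mul_pow, hζd, mul_one, hT e he]
    · rw [(mem_filter.1 ht₂).2, hN, mul_pow, hζd, mul_one, hT e he]
  · rintro ⟨e, k⟩ hp ⟨e', k'⟩ hp' h
    obtain ⟨he, hk⟩ := mem_product.1 hp
    obtain ⟨he', hk'⟩ := mem_product.1 hp'
    simp only at h he hk he' hk'
    have hpow := congrArg (· ^ (7 * d)) h
    simp only [mul_pow (T _), hζd, mul_one] at hpow
    obtain rfl : e = e' := by
      have h1 := hT e he
      have h2 := hT e' he'
      rw [← hpow] at h2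
      exact mul_right_cancel₀ (right_ne_zero_of_mul_eq_one h1) (h1.trans h2.symm)
    have hkk := mul_left_cancel₀ (hT0 e he) h
    rw [hζ.pow_inj (mem_range.1 hk) (mem_range.1 hk') hkk]

end Fibres

/-! ### Equidistribution of the preimage of the kernel -/

section Jacobi

variable {F : Type*} [Field F] [Fintype F] [CharP F 2] [DecidableEq F] {σ : F →+* F}

theorem norm_jacobiSum_eq {χ φ : MulChar F ℂ} (hχ : χ ≠ 1) (hφ : φ ≠ 1) (hχφ : χ * φ ≠ 1) :
    ‖jacobiSum χ φ‖ = Real.sqrt (Fintype.card F) := by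
  have hstar : (starRingEnd ℂ) (jacobiSum χ φ) = jacobiSum χ⁻¹ φ⁻¹ := by
    simp only [jacobiSum, map_sum, map_mul]
    exact sum_congr rfl fun x _ => by
      rw [← MulChar.star_apply', ← MulChar.star_apply']
      rfl
  have hchar : ringChar ℂ ≠ ringChar F := by
    rw [ringChar.eq F 2, ringChar.eq_zero]
    norm_num
  have hmul := jacobiSum_mul_jacobiSum_inv hchar hχ hφ hχφ
  rw [← hstar, Complex.mul_conj, Complex.normSq_eq_norm_sq] at hmul
  rw [← Real.sqrt_sq (norm_nonneg (jacobiSum χ φ))]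
  congr 1
  exact_mod_cast hmul

theorem exists_mulChar_eq_one_iff {M : ℕ} (hF : Fintype.card F = 7 * M + 1) (hM : 0 < M) :
    ∃ χ : MulChar F ℂ, orderOf χ = 7 ∧ ∀ x : F, χ x = 1 → x ^ M = 1 := by
  obtain ⟨χ, hχ⟩ := MulChar.exists_mulChar_orderOf F (n := 7) ⟨M, by omega⟩
    (Complex.isPrimitiveRoot_exp 7 (by norm_num))
  refine ⟨χ, hχ, fun x hx => ?_⟩
  obtain ⟨g, hg, hgen⟩ := exists_isPrimitiveRoot_of_card hF
  have hg0 : g ≠ 0 := hg.ne_zero (by positivity)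
  have hχ7 : χ g ^ 7 = 1 := by
    rw [← MulChar.pow_apply' _ (by norm_num), ← hχ, pow_orderOf_eq_one,
      MulChar.one_apply hg0.isUnit]
  have hχ1 : χ g ≠ 1 := by
    intro h
    have : χ = 1 := by
      ext u
      obtain ⟨k, hk⟩ := hgen u u.ne_zero
      rw [hk, map_pow, h, one_pow, ← hk, MulChar.one_apply u.isUnit]
    rw [this, orderOf_one] at hχ
    norm_num at hχ
  have hord : orderOf (χ g) = 7 := by
    have : Fact (Nat.Prime 7) := ⟨by norm_num⟩
    exact orderOf_eq_prime hχ7 hχ1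
  have hx0 : x ≠ 0 := by
    rintro rfl
    rw [MulChar.map_zero] at hx
    exact zero_ne_one hx
  obtain ⟨k, rfl⟩ := hgen x hx0
  rw [map_pow, ← orderOf_dvd_iff_pow_eq_one, hord] at hx
  obtain ⟨l, rfl⟩ := hx
  rw [← pow_mul, hg.pow_eq_one_iff_dvd]
  exact ⟨l, by ring⟩

/-- The preimage of the subgroup of seventh powers has at least the expected size up to a Jacobi
sum error. -/
theorem card_le_card_kernelPreimage {M q : ℕ} (hF : Fintype.card F = 7 * M + 1) (hM : 0 < M)
    (hq : ∀ x, σ x = x ^ q) (hq0 : ¬7 ∣ q) (hq1 : ¬7 ∣ q + 1) :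
    (Fintype.card F : ℝ) - 2 - 6 * Real.sqrt (Fintype.card F) ≤ 7 * #(kernelPreimage σ M) := by
  obtain ⟨χ, hχ, hker⟩ := exists_mulChar_eq_one_iff hF hM
  have h2 : (2 : F) = 0 := CharTwo.two_eq_zero
  set T : Finset F := (univ.erase 0).erase 1 with hT
  have hTcard : (#T : ℂ) = Fintype.card F - 2 := by
    rw [hT, card_erase_of_mem (by simp), card_erase_of_mem (mem_univ _), card_univ]
    have := Fintype.one_lt_card (α := F)
    rw [Nat.sub_sub, Nat.cast_sub (by omega)]
    norm_num
  have hval : ∀ t, χ (t * (σ t + 1)) = χ t * χ (1 - t) ^ q := by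
    intro t
    have : σ t + 1 = (1 - t) ^ q := by
      rw [← hq, map_sub, map_one]
      linear_combination σ t * h2
    rw [this, map_mul, map_pow]
  have hne : ∀ t ∈ T, t * (σ t + 1) ≠ 0 := by
    intro t ht
    simp only [hT, mem_erase, mem_univ, and_true] at ht
    refine mul_ne_zero ht.2 fun h => ht.1 (σ.injective ?_)
    rw [map_one]
    linear_combination h - h2
  have hsum : ∀ t ∈ T, ∑ k ∈ range 7, χ (t * (σ t + 1)) ^ k =
      if χ (t * (σ t + 1)) = 1 then 7 else 0 := by
    intro t ht
    have h7 : χ (t * (σ t + 1)) ^ 7 = 1 := by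
      rw [← MulChar.pow_apply' _ (by norm_num), ← hχ, pow_orderOf_eq_one,
        MulChar.one_apply (hne t ht).isUnit]
    split_ifs with h
    · simp [h]
    · rw [geom_sum_eq h, h7, sub_self, zero_div]
  have hjac : ∀ k ∈ (range 7).erase 0, ‖∑ t ∈ T, χ (t * (σ t + 1)) ^ k‖ =
      Real.sqrt (Fintype.card F) := by
    intro k hk
    rw [mem_erase, mem_range] at hk
    have hk7 : ¬7 ∣ k := fun h => by have := Nat.le_of_dvd (by omega) h; omega
    have hpow : ∀ n, χ ^ n = 1 → 7 ∣ n := fun n hn => hχ ▸ orderOf_dvd_of_pow_eq_one hn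
    have h7 : Nat.Prime 7 := by norm_num
    have hq0' : q ≠ 0 := fun h => hq0 (h ▸ dvd_zero _)
    rw [← norm_jacobiSum_eq (χ := χ ^ k) (φ := χ ^ (q * k)) (fun h => hk7 (hpow _ h))
      (fun h => (h7.dvd_mul.1 (hpow _ h)).elim hq0 hk7) (fun h => ?_)]
    · congr 1
      rw [jacobiSum]
      refine (sum_subset (subset_univ T) fun t _ ht => ?_).trans
        (sum_congr rfl fun t _ => ?_)
      · have : t = 0 ∨ t = 1 := by
          simp only [hT, mem_erase, mem_univ, and_true, not_and_or, not_not] at ht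
          exact ht.symm
        rcases this with rfl | rfl
        · rw [zero_mul, MulChar.map_zero, zero_pow hk.1]
        · rw [map_one, one_add_one_eq_two, h2, mul_zero, MulChar.map_zero, zero_pow hk.1]
      · rw [hval, MulChar.pow_apply' _ hk.1, MulChar.pow_apply' _ (mul_ne_zero hq0' hk.1), mul_pow,
          ← pow_mul]
    · rw [← pow_add] at h
      refine (h7.dvd_mul.1 (?_ : 7 ∣ (q + 1) * k)).elim hq1 hk7
      have := hpow _ h
      rwa [show (q + 1) * k = k + q * k by ring]
  have htotal : (7 * #{t ∈ T | χ (t * (σ t + 1)) = 1} : ℂ) =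
      (Fintype.card F - 2) + ∑ k ∈ (range 7).erase 0, ∑ t ∈ T, χ (t * (σ t + 1)) ^ k := by
    have h1 : ∑ t ∈ T, ∑ k ∈ range 7, χ (t * (σ t + 1)) ^ k =
        7 * #{t ∈ T | χ (t * (σ t + 1)) = 1} := by
      rw [sum_congr rfl hsum, ← sum_filter, sum_const, nsmul_eq_mul, mul_comm]
    rw [← h1, sum_comm, ← add_sum_erase _ _ (show 0 ∈ range 7 by simp)]
    simp [hTcard]
  have hle : #{t ∈ T | χ (t * (σ t + 1)) = 1} ≤ #(kernelPreimage σ M) :=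
    card_le_card fun t ht => mem_filter.2 ⟨mem_univ _, hker _ (mem_filter.1 ht).2⟩
  have hnorm : ‖∑ k ∈ (range 7).erase 0, ∑ t ∈ T, χ (t * (σ t + 1)) ^ k‖ ≤
      6 * Real.sqrt (Fintype.card F) := by
    refine (norm_sum_le _ _).trans ?_
    rw [sum_congr rfl hjac, sum_const, card_erase_of_mem (by simp), card_range, nsmul_eq_mul]
    norm_num
  have hre := congrArg Complex.re htotal
  have hre2 := (abs_le.1 ((Complex.abs_re_le_norm _).trans hnorm)).1
  have hlhs : ((7 * #{t ∈ T | χ (t * (σ t + 1)) = 1} : ℂ)).re =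
      7 * #{t ∈ T | χ (t * (σ t + 1)) = 1} := by
    simp
  have hrhs : ((Fintype.card F : ℂ) - 2).re = Fintype.card F - 2 := by simp
  rw [Complex.add_re, hlhs, hrhs] at hre
  have hle' : (#{t ∈ T | χ (t * (σ t + 1)) = 1} : ℝ) ≤ #(kernelPreimage σ M) := by
    exact_mod_cast hle
  linarith

end Jacobi

/-! ### The case of squaring -/

section Squaring

variable {F : Type*} [Field F] [Fintype F] [CharP F 2] [DecidableEq F] {σ : F →+* F}

/-- The quadratic character of the additive group whose kernel is the image of `z ↦ σ z + z`. -/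
noncomputable def traceSign (σ : F →+* F) (y : F) : ℝ :=
  open Classical in if ∃ z, σ z + z = y then 1 else -1

theorem traceSign_eq_one (z : F) : traceSign σ (σ z + z) = 1 := if_pos ⟨z, rfl⟩

theorem IsOddGenerator.traceSign_one (hσ : IsOddGenerator σ) : traceSign σ 1 = -1 :=
  if_neg fun ⟨z, hz⟩ => hσ.add_self_ne_one z hz

theorem traceSign_sq (y : F) : traceSign σ y ^ 2 = 1 := by
  unfold traceSign
  split_ifs <;> norm_num

theorem IsOddGenerator.traceSign_add (hσ : IsOddGenerator σ) (x y : F) :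
    traceSign σ (x + y) = traceSign σ x * traceSign σ y := by
  have h2 : (2 : F) = 0 := CharTwo.two_eq_zero
  have hdich : ∀ y, (∃ z, σ z + z = y) ∧ traceSign σ y = 1 ∨
      (∃ z, σ z + z = y + 1) ∧ traceSign σ y = -1 := by
    intro y
    by_cases h : ∃ z, σ z + z = y
    · exact Or.inl ⟨h, if_pos h⟩
    · exact Or.inr ⟨(hσ.exists_add_self_eq y).resolve_left h, if_neg h⟩
  have hneg : ∀ y, (∃ z, σ z + z = y + 1) → traceSign σ y = -1 := by
    rintro y ⟨z, hz⟩
    refine if_neg ?_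
    rintro ⟨z', hz'⟩
    refine hσ.add_self_ne_one (z + z') ?_
    rw [map_add]
    linear_combination hz + hz' + y * h2
  rcases hdich x with ⟨⟨z, hz⟩, hx⟩ | ⟨⟨z, hz⟩, hx⟩ <;>
    rcases hdich y with ⟨⟨w, hw⟩, hy⟩ | ⟨⟨w, hw⟩, hy⟩ <;> rw [hx, hy]
  · rw [mul_one]
    exact if_pos ⟨z + w, by rw [map_add]; linear_combination hz + hw⟩
  · rw [one_mul]
    exact hneg _ ⟨z + w, by rw [map_add]; linear_combination hz + hw⟩
  · rw [mul_one]
    exact hneg _ ⟨z + w, by rw [map_add]; linear_combination hz + hw⟩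
  · rw [neg_mul_neg, one_mul]
    exact if_pos ⟨z + w, by rw [map_add]; linear_combination hz + hw + h2⟩

theorem IsOddGenerator.sum_traceSign_mul (hσ : IsOddGenerator σ) {y : F} (hy : y ≠ 0) :
    ∑ c, traceSign σ (c * y) = 0 := by
  have h : ∑ c, traceSign σ (c * y) = ∑ c, -traceSign σ (c * y) := by
    refine Fintype.sum_equiv (Equiv.addRight y⁻¹) _ _ fun c => ?_
    rw [Equiv.coe_addRight, add_mul, inv_mul_cancel₀ hy, hσ.traceSign_add, hσ.traceSign_one]
    ring
  rw [sum_neg_distrib] at h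
  linarith

theorem IsOddGenerator.sum_sq_sum_traceSign (hσ : IsOddGenerator σ) (S : Finset F) :
    ∑ c, (∑ x ∈ S, traceSign σ (c * x)) ^ 2 = Fintype.card F * #S := by
  have h2 : (2 : F) = 0 := CharTwo.two_eq_zero
  simp_rw [sq, sum_mul_sum, ← hσ.traceSign_add, ← mul_add]
  rw [sum_comm]
  have hinner : ∀ x ∈ S, ∑ c, ∑ y ∈ S, traceSign σ (c * (x + y)) = Fintype.card F := by
    intro x hx
    rw [sum_comm, sum_eq_single_of_mem x hx]
    · have : ∀ c : F, traceSign σ (c * (x + x)) = 1 := fun c => by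
        have h0 : c * (x + x) = σ 0 + 0 := by
          rw [map_zero, add_zero]
          linear_combination c * x * h2
        rw [h0, traceSign_eq_one]
      simp [this]
    · intro y _ hyx
      refine hσ.sum_traceSign_mul fun h => hyx ?_
      linear_combination h - x * h2
  rw [sum_congr rfl hinner, sum_const, nsmul_eq_mul, mul_comm]

theorem IsOddGenerator.sq_sum_traceSign_powKernel_le (hσ : IsOddGenerator σ) {M : ℕ} (hM : 0 < M) :
    (∑ x ∈ powKernel F M, traceSign σ x) ^ 2 ≤ Fintype.card F := by
  have hpos : (0 : ℝ) < #(powKernel F M) := by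
    have : 0 < #(powKernel F M) := card_pos.2 ⟨1, mem_powKernel.2 (one_pow M)⟩
    exact_mod_cast this
  have hconst : ∀ c ∈ powKernel F M, ∑ x ∈ powKernel F M, traceSign σ (c * x) =
      ∑ x ∈ powKernel F M, traceSign σ x := by
    intro c hc
    have hc0 := ne_zero_of_mem_powKernel hM hc
    rw [mem_powKernel] at hc
    refine sum_bij (fun x _ => c * x) (fun x hx => ?_) (fun x _ y _ h => mul_left_cancel₀ hc0 h)
      (fun y hy => ⟨y / c, ?_, by field_simp⟩) fun x _ => rfl
    · rw [mem_powKernel] at hx ⊢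
      rw [mul_pow, hc, hx, one_mul]
    · rw [mem_powKernel] at hy ⊢
      rw [div_pow, hc, hy, div_one]
  have hle : ∑ c ∈ powKernel F M, (∑ x ∈ powKernel F M, traceSign σ (c * x)) ^ 2 ≤
      ∑ c, (∑ x ∈ powKernel F M, traceSign σ (c * x)) ^ 2 :=
    sum_le_sum_of_subset_of_nonneg (subset_univ _) fun c _ _ => sq_nonneg _
  rw [hσ.sum_sq_sum_traceSign, sum_congr rfl fun c hc => by rw [hconst c hc], sum_const,
    nsmul_eq_mul, mul_comm] at hle
  exact le_of_mul_le_mul_right hle hpos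

theorem IsOddGenerator.traceSign_inv_of_card_quadFibre_eq_one (hσ : IsOddGenerator σ)
    (hq : ∀ x, σ x = x ^ 2) {e : F} (he0 : e ≠ 0) (he : #(quadFibre σ e) = 1) :
    traceSign σ e⁻¹ = 1 := by
  have h2 : (2 : F) = 0 := CharTwo.two_eq_zero
  obtain ⟨t, ht⟩ := card_eq_one.1 he
  have hmem : t * (σ t + 1) = e := by
    have : t ∈ quadFibre σ e := ht ▸ mem_singleton_self t
    exact (mem_filter.1 this).2
  have huniq : ∀ t', t' * (σ t' + 1) = e → t' = t := fun t' ht' => by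
    have : t' ∈ quadFibre σ e := mem_filter.2 ⟨mem_univ _, ht'⟩
    rwa [ht, mem_singleton] at this
  have ht0 : t ≠ 0 := by
    rintro rfl
    rw [zero_mul] at hmem
    exact he0 hmem.symm
  have ht1 : t + 1 ≠ 0 := by
    intro h
    rw [hq] at hmem
    refine he0 ?_
    rw [← hmem]
    linear_combination t * (t + 1) * h - t ^ 2 * h2
  have hunsolv : ¬∃ z, σ z + z = (t⁻¹ + 1) ^ 2 := by
    rintro ⟨z, hz⟩
    have hz1 : z ≠ 1 := by
      rintro rfl
      rw [map_one, one_add_one_eq_two, h2] at hz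
      have : t⁻¹ + 1 = 0 := eq_zero_of_pow_eq_zero hz.symm
      refine ht1 ?_
      field_simp at this
      linear_combination this
    refine hz1 (mul_left_cancel₀ ht0 ((huniq (t * z) ?_).trans (mul_one t).symm))
    rw [hq] at hz hmem ⊢
    field_simp at hz
    rw [← hmem]
    linear_combination (t * z + t) * hz - (t ^ 3 * z ^ 2 - t ^ 2 * z - t ^ 2 - t * z) * h2
  have hsq : ∀ y, traceSign σ (y ^ 2) = traceSign σ y := by
    intro y
    have : y ^ 2 = (σ y + y) + y := by rw [hq]; linear_combination -y * h2
    rw [this, hσ.traceSign_add, traceSign_eq_one, one_mul]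
  have hinv : traceSign σ t⁻¹ = 1 := by
    have h1 : traceSign σ ((t⁻¹ + 1) ^ 2) = -1 := if_neg hunsolv
    rw [hsq, hσ.traceSign_add, hσ.traceSign_one] at h1
    linarith
  have hdecomp : e⁻¹ = t⁻¹ + (σ (t + 1)⁻¹ + (t + 1)⁻¹) := by
    have hsq1 : σ t + 1 = (t + 1) ^ 2 := by
      rw [hq]
      linear_combination -t * h2
    rw [← hmem, hsq1, hq]
    field_simp
    linear_combination -(t ^ 2 + 2 * t) * h2
  rw [hdecomp, hσ.traceSign_add, hinv, traceSign_eq_one, one_mul]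

theorem IsOddGenerator.two_mul_card_singleFibres_le (hσ : IsOddGenerator σ)
    (hq : ∀ x, σ x = x ^ 2) {M : ℕ} (hM : 0 < M) :
    2 * (#(singleFibres σ M) : ℝ) ≤ M + Real.sqrt (Fintype.card F) := by
  classical
  have hle : #(singleFibres σ M) ≤ #{x ∈ powKernel F M | traceSign σ x = 1} := by
    refine card_le_card_of_injOn (·⁻¹) (fun e he => ?_) fun x _ y _ h => inv_injective h
    obtain ⟨he, he1⟩ := mem_filter.1 he
    refine mem_filter.2 ⟨?_, hσ.traceSign_inv_of_card_quadFibre_eq_one hq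
      (ne_zero_of_mem_powKernel hM he) he1⟩
    rw [mem_powKernel] at he ⊢
    rw [inv_pow, he, inv_one]
  have hcount : (2 * #{x ∈ powKernel F M | traceSign σ x = 1} : ℝ) =
      #(powKernel F M) + ∑ x ∈ powKernel F M, traceSign σ x := by
    rw [card_filter, card_eq_sum_ones]
    push_cast
    rw [mul_sum, ← sum_add_distrib]
    refine sum_congr rfl fun x _ => ?_
    rcases mul_self_eq_one_iff.1 ((sq _).symm.trans (traceSign_sq (σ := σ) x)) with h | h <;>
      rw [h] <;> norm_num
  have hS := Real.le_sqrt_of_sq_le (hσ.sq_sum_traceSign_powKernel_le hM)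
  have hM' : (#(powKernel F M) : ℝ) ≤ M := by exact_mod_cast card_powKernel_le hM
  have hle' : (#(singleFibres σ M) : ℝ) ≤ #{x ∈ powKernel F M | traceSign σ x = 1} := by
    exact_mod_cast hle
  linarith

end Squaring

/-! ### Fibres of `t ↦ t (σ t + 1)` over the kernel: empty fibres -/

/-- After a common doubling modulo `D`, both residues exceed `D / 2`. -/
def LeadingClash (D a b : ℕ) : Prop :=
  ∃ n A B, 2 * (D * A) + D < 2 * (2 ^ n * a) ∧ 2 ^ n * a < D * A + D ∧
    2 * (D * B) + D < 2 * (2 ^ n * b) ∧ 2 ^ n * b < D * B + D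

theorem LeadingClash.exists_le_mod {m a b : ℕ} (h : LeadingClash (2 ^ (m + 1) - 1) a b) :
    ∃ n, 2 ^ m ≤ 2 ^ n * a % (2 ^ (m + 1) - 1) ∧ 2 ^ m ≤ 2 ^ n * b % (2 ^ (m + 1) - 1) := by
  obtain ⟨n, A, B, hA, hA', hB, hB'⟩ := h
  have key : ∀ {x C : ℕ}, 2 * ((2 ^ (m + 1) - 1) * C) + (2 ^ (m + 1) - 1) < 2 * x →
      x < (2 ^ (m + 1) - 1) * C + (2 ^ (m + 1) - 1) → 2 ^ m ≤ x % (2 ^ (m + 1) - 1) := by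
    intro x C h1 h2
    obtain ⟨y, rfl⟩ : ∃ y, x = (2 ^ (m + 1) - 1) * C + y := ⟨x - (2 ^ (m + 1) - 1) * C, by omega⟩
    rw [Nat.mul_add_mod, Nat.mod_eq_of_lt (by omega)]
    have : 2 ^ (m + 1) = 2 * 2 ^ m := by ring
    omega
  exact ⟨n, key hA hA', key hB hB'⟩

section EmptyFibres

variable {F : Type*} [Field F] [Fintype F] [CharP F 2] [DecidableEq F]

theorem sum_pow_eq_zero_of_leadingClash {m i a y U : ℕ} (hF : Fintype.card F = 2 ^ (m + 1))
    (ha0 : 0 < a) (ha : a < 2 ^ (m + 1) - 1) (hy : 2 ^ i * a = (2 ^ (m + 1) - 1) * U + y)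
    (hc : LeadingClash (2 ^ (m + 1) - 1) a y) :
    ∑ t : F, (t * (t ^ 2 ^ i + 1)) ^ (2 ^ (m + 1) - 1 - a) = 0 := by
  simp_rw [mul_pow]
  rw [sum_pow_mul_pow_add_one (by omega)]
  refine sum_eq_zero fun s hs => ?_
  rw [mem_filter, mem_range, hF] at hs
  obtain ⟨hsle, hdvd⟩ := hs
  rw [CharP.cast_eq_zero_iff F 2, ← even_iff_two_dvd, ← Nat.not_odd_iff_even,
    odd_choose_compl_iff (by omega) (by omega)]
  intro hland
  obtain ⟨n, h1, h2⟩ := hc.exists_le_mod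
  have hs : 2 ^ i * s ≡ a [MOD 2 ^ (m + 1) - 1] := by
    obtain ⟨c, hc⟩ := hdvd
    have h3 : 2 ^ i * s + (2 ^ (m + 1) - 1) = a + (2 ^ (m + 1) - 1) * c := by omega
    have h4 : 2 ^ i * s + (2 ^ (m + 1) - 1) ≡ a + (2 ^ (m + 1) - 1) * c [MOD 2 ^ (m + 1) - 1] := by
      rw [h3]
    simpa [Nat.ModEq, Nat.add_mod_right, Nat.add_mul_mod_self_left] using h4
  have hy' : 2 ^ i * a ≡ y [MOD 2 ^ (m + 1) - 1] := by
    rw [hy, Nat.ModEq, Nat.mul_add_mod]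
  refine not_both_le_of_land_eq_zero (by omega) ha hland (n + i) ⟨?_, ?_⟩
  · rw [pow_add, mul_assoc, hs.mul_left (2 ^ n)]
    exact h1
  · rw [pow_add, mul_assoc, hy'.mul_left (2 ^ n)]
    exact h2

theorem pow_mul_geom_sum_eq_ite {M l : ℕ} (hF : Fintype.card F = 7 * M + 1)
    (hl : l ≠ 0) (e : F) :
    e ^ l * ∑ j ∈ range 7, (e ^ M) ^ j = if e ∈ powKernel F M then e ^ l else 0 := by
  split_ifs with h
  · rw [mem_powKernel] at h
    have h7 : (7 : F) = 1 := by
      linear_combination 3 * (CharTwo.two_eq_zero : (2 : F) = 0)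
    simp [h, h7]
  · rcases eq_or_ne e 0 with rfl | he
    · simp [hl]
    have h1 := FiniteField.pow_card_sub_one_eq_one e he
    rw [mem_powKernel] at h
    rw [hF, Nat.add_sub_cancel, mul_comm 7 M, pow_mul] at h1
    rw [geom_sum_eq h, h1, sub_self, zero_div, mul_zero]

variable {σ : F →+* F}

theorem IsOddGenerator.sum_emptyFibres_pow (hσ : IsOddGenerator σ) {M l : ℕ}
    (hF : Fintype.card F = 7 * M + 1) (hl0 : 0 < l) (hl : l < M) :
    ∑ e ∈ emptyFibres σ M, e ^ l = ∑ j ∈ range 7, ∑ t : F, (t * (σ t + 1)) ^ (l + j * M) := by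
  have hw := pow_mul_geom_sum_eq_ite (F := F) hF hl0.ne'
  have hpow : ∀ e : F, ∑ j ∈ range 7, e ^ (l + j * M) =
      if e ∈ powKernel F M then e ^ l else 0 := by
    intro e
    rw [← hw e, mul_sum]
    refine sum_congr rfl fun j _ => ?_
    rw [pow_add, mul_comm j M, pow_mul]
  have htot : ∑ e : F, (if e ∈ powKernel F M then e ^ l else 0) = 0 := by
    simp_rw [← hpow]
    rw [sum_comm]
    refine sum_eq_zero fun j hj => ?_
    rw [mem_range] at hj
    have : j * M ≤ 6 * M := Nat.mul_le_mul_right _ (by omega)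
    rw [sum_pow_eq_ite (by omega), if_neg]
    rw [hF]
    intro h
    have := Nat.le_of_dvd (by omega) h
    omega
  rw [sum_comm]
  simp_rw [hpow]
  rw [← sum_fiberwise (s := univ) (g := fun t : F => t * (σ t + 1))]
  have hfib : ∀ e : F, (∑ t with t * (σ t + 1) = e,
      if t * (σ t + 1) ∈ powKernel F M then (t * (σ t + 1)) ^ l else 0) =
      (if e ∈ powKernel F M then e ^ l else 0) - if e ∈ emptyFibres σ M then e ^ l else 0 := by
    intro e
    rw [sum_congr rfl (g := fun _ => if e ∈ powKernel F M then e ^ l else 0)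
      fun t ht => by rw [(mem_filter.1 ht).2], sum_const, nsmul_eq_mul]
    have hmem : e ∈ emptyFibres σ M ↔ e ∈ powKernel F M ∧ quadFibre σ e = ∅ := mem_filter
    by_cases he : e ∈ powKernel F M
    · have h0 := ne_zero_of_mem_powKernel (by omega) he
      change (#(quadFibre σ e) : F) * _ = _
      rw [hσ.natCast_card_quadFibre h0]
      by_cases hem : quadFibre σ e = ∅
      · rw [if_pos hem, if_pos he, if_pos (hmem.2 ⟨he, hem⟩)]
        ring
      · rw [if_neg hem, if_pos he, if_neg fun h => hem (hmem.1 h).2]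
        ring
    · rw [if_neg he, if_neg fun h => he (hmem.1 h).1]
      ring
  rw [sum_congr rfl fun e _ => hfib e, sum_sub_distrib, htot, zero_sub, CharTwo.neg_eq]
  simp [sum_ite_mem]

theorem IsOddGenerator.sum_emptyFibres_pow_sub (hσ : IsOddGenerator σ) {M κ i : ℕ}
    (hF : Fintype.card F = 7 * M + 1) (hq : ∀ x, σ x = x ^ 2 ^ i) (h0 : 0 < κ) (hκ : κ < M) :
    ∑ e ∈ emptyFibres σ M, e ^ (M - κ) =
      ∑ j ∈ range 7, ∑ t : F, (t * (t ^ 2 ^ i + 1)) ^ (7 * M - (κ + j * M)) := by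
  rw [hσ.sum_emptyFibres_pow hF (by omega) (by omega), ← sum_range_reflect]
  refine sum_congr rfl fun j hj => ?_
  rw [mem_range] at hj
  simp_rw [hq]
  rw [show M - κ + (7 - 1 - j) * M = 7 * M - (κ + j * M) by interval_cases j <;> omega]

theorem IsOddGenerator.sum_emptyFibres_pow_sub_eq_zero (hσ : IsOddGenerator σ) {m M κ i h V ρ u : ℕ}
    (hF : Fintype.card F = 7 * M + 1) (hm : 7 * M + 1 = 2 ^ (m + 1)) (hq : ∀ x, σ x = x ^ 2 ^ i)
    (hu : 2 ^ i = 7 * u + ρ) (h0 : 0 < κ) (hκ : κ < M) (hV : 2 ^ i * κ = 7 * M * h + V)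
    (hc : ∀ j < 7, LeadingClash (7 * M) (κ + j * M) (V + ρ * (j * M))) :
    ∑ e ∈ emptyFibres σ M, e ^ (M - κ) = 0 := by
  rw [hσ.sum_emptyFibres_pow_sub hF hq h0 hκ]
  refine sum_eq_zero fun j hj => ?_
  rw [mem_range] at hj
  have hD : 7 * M = 2 ^ (m + 1) - 1 := by omega
  have hj' : j * M ≤ 6 * M := Nat.mul_le_mul_right _ (by omega)
  have hcl := hc j hj
  rw [hD] at hcl ⊢
  refine sum_pow_eq_zero_of_leadingClash (hF.trans hm) (by omega) (by omega) (U := h + u * j) ?_ hcl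
  rw [← hD, mul_add, hV, hu]
  ring

end EmptyFibres

section EmptyFibresCount

variable {F : Type*} [Field F] [Fintype F] [DecidableEq F]

theorem le_add_mul_card_of_powerSum_eq_zero {S : Finset F} (h0 : (0 : F) ∉ S) (hS : S.Nonempty)
    {c lo hi : ℕ} (hc : 0 < c) (h : ∀ k, lo < c * k → c * k < hi → ∑ x ∈ S, x ^ k = 0) :
    hi ≤ lo + c * #S := by
  by_contra! hlt
  refine lt_irrefl #S (card_gt_of_powerSum_eq_zero h0 hS (k := lo / c + 1) fun j hj => ?_)
  have h1 := Nat.lt_mul_div_succ lo hc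
  have h2 := Nat.mul_div_le lo c
  have h3 : c * (j + 1) ≤ c * #S := Nat.mul_le_mul_left c hj
  apply h
  · rw [mul_add]
    omega
  · rw [show c * (lo / c + 1 + j) = c * (lo / c) + c * (j + 1) by ring]
    omega

theorem le_add_mul_card_of_powerSum_sub_eq_zero {S : Finset F} (h0 : (0 : F) ∉ S)
    (hS : S.Nonempty) {M c lo hi : ℕ} (hc : 0 < c) (hlo : lo ≤ c * M) (hhi : hi ≤ c * M)
    (h : ∀ k, lo < c * k → c * k < hi → ∑ x ∈ S, x ^ (M - k) = 0) :
    hi ≤ lo + c * #S := by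
  have key := le_add_mul_card_of_powerSum_eq_zero h0 hS hc (lo := c * M - hi) (hi := c * M - lo)
    fun k hk hk' => by
      have hkM : k ≤ M := by
        by_contra! hlt
        have := Nat.mul_le_mul_left c hlt.le
        omega
      obtain ⟨l, rfl⟩ := Nat.exists_eq_add_of_le hkM
      rw [mul_add] at hk hk' hlo hhi
      simpa using h l (by omega) (by omega)
  omega

variable [CharP F 2]

theorem sum_pow_eq_one_of_land_eq_zero {m i a s : ℕ} (hF : Fintype.card F = 2 ^ (m + 1))
    (hs : 2 ^ i * s = a) (hland : s &&& a = 0) (hsa : s + a ≤ 2 ^ (m + 1) - 1)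
    (ha0 : 0 < a) (ha : a < 2 ^ (m + 1) - 1) :
    ∑ t : F, (t * (t ^ 2 ^ i + 1)) ^ (2 ^ (m + 1) - 1 - a) = 1 := by
  simp_rw [mul_pow]
  rw [sum_pow_mul_pow_add_one (by omega)]
  have hfilter : (range (2 ^ (m + 1) - 1 - a + 1)).filter
      (fun r => Fintype.card F - 1 ∣ 2 ^ (m + 1) - 1 - a + 2 ^ i * r) = {s} := by
    ext r
    rw [mem_filter, mem_range, mem_singleton, hF]
    constructor
    · rintro ⟨hr, hdvd⟩
      have hmod : 2 ^ i * r ≡ 2 ^ i * s [MOD 2 ^ (m + 1) - 1] := by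
        refine Nat.ModEq.add_left_cancel' (2 ^ (m + 1) - 1 - a) ?_
        rw [hs, Nat.sub_add_cancel ha.le, Nat.ModEq, Nat.mod_self, Nat.mod_eq_zero_of_dvd hdvd]
      have hcop : Nat.gcd (2 ^ (m + 1) - 1) (2 ^ i) = 1 := by
        refine Nat.Coprime.pow_right i (Nat.coprime_two_right.2 ?_)
        exact Nat.Even.sub_odd Nat.one_le_two_pow (Nat.even_pow.2 ⟨even_two, m.succ_ne_zero⟩) odd_one
      exact (hmod.cancel_left_of_coprime hcop).eq_of_lt_of_lt (by omega)
        (by have := Nat.le_mul_of_pos_left s (Nat.two_pow_pos i); omega)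
    · rintro rfl
      refine ⟨by omega, ?_⟩
      rw [hs, Nat.sub_add_cancel ha.le]
  rw [hfilter, sum_singleton]
  have hodd := (odd_choose_compl_iff (m := m + 1) (a := a) (s := s) (by omega) (by omega)).2 hland
  obtain ⟨k, hk⟩ := hodd
  rw [hk]
  push_cast
  rw [CharTwo.two_eq_zero, zero_mul, zero_add]

variable {σ : F →+* F}

theorem zero_notMem_emptyFibres {M : ℕ} (hM : 0 < M) : (0 : F) ∉ emptyFibres σ M := fun h =>
  ne_zero_of_mem_powKernel hM (mem_filter.1 h).1 rfl

theorem IsOddGenerator.emptyFibres_nonempty (hσ : IsOddGenerator σ) {m M κ i h V ρ u s j₀ : ℕ}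
    (hF : Fintype.card F = 7 * M + 1) (hm : 7 * M + 1 = 2 ^ (m + 1)) (hq : ∀ x, σ x = x ^ 2 ^ i)
    (hu : 2 ^ i = 7 * u + ρ) (h0 : 0 < κ) (hκ : κ < M) (hV : 2 ^ i * κ = 7 * M * h + V)
    (hj₀ : j₀ < 7) (hs : 2 ^ i * s = κ + j₀ * M) (hland : s &&& (κ + j₀ * M) = 0)
    (hsa : s + (κ + j₀ * M) ≤ 7 * M)
    (hc : ∀ j < 7, j ≠ j₀ → LeadingClash (7 * M) (κ + j * M) (V + ρ * (j * M))) :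
    (emptyFibres σ M).Nonempty := by
  have hsum : ∑ e ∈ emptyFibres σ M, e ^ (M - κ) = 1 := by
    rw [hσ.sum_emptyFibres_pow_sub hF hq h0 hκ]
    have hD : 7 * M = 2 ^ (m + 1) - 1 := by omega
    have hlt : ∀ j < 7, κ + j * M < 7 * M := fun j hj => by
      have hj' : j * M ≤ 6 * M := Nat.mul_le_mul_right _ (by omega)
      omega
    rw [sum_eq_single_of_mem j₀ (mem_range.2 hj₀) fun j hj hne => ?_]
    · have hlt₀ := hlt j₀ hj₀
      rw [hD] at hsa hlt₀ ⊢
      exact sum_pow_eq_one_of_land_eq_zero (hF.trans hm) hs hland hsa (by omega) hlt₀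
    · rw [mem_range] at hj
      have hltj := hlt j hj
      have hcl := hc j hj hne
      rw [hD] at hcl hltj ⊢
      refine sum_pow_eq_zero_of_leadingClash (hF.trans hm) (by omega) hltj (U := h + u * j) ?_ hcl
      rw [← hD, mul_add, hV, hu]
      ring
  rw [nonempty_iff_ne_empty]
  rintro hem
  simp [hem] at hsum

theorem exists_mul_eq_two_pow {m M i : ℕ} (hm : 7 * M + 1 = 2 ^ (m + 1)) (hbig : 10000 * 2 ^ i ≤ M) :
    ∃ P t, 7 * M + 1 = 8 * P ∧ 2 ^ i * t = P ∧ ∀ p < 2 ^ i, p * t &&& p * P = 0 := by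
  have him : i ≤ m - 2 := by
    by_contra! hlt
    have h1 : 2 ^ (m + 1) ≤ 2 ^ (i + 2) := Nat.pow_le_pow_right (by norm_num) (by omega)
    rw [pow_add 2 i 2] at h1
    have h2 : 1 ≤ 2 ^ i := Nat.one_le_two_pow
    omega
  have hm2 : 2 ≤ m := by
    by_contra! hlt
    have h1 : 2 ^ (m + 1) ≤ 2 ^ 2 := Nat.pow_le_pow_right (by norm_num) (by omega)
    have h2 : 1 ≤ 2 ^ i := Nat.one_le_two_pow
    omega
  have hit : 2 ^ i * 2 ^ (m - 2 - i) = 2 ^ (m - 2) := by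
    rw [← pow_add, Nat.add_sub_cancel' him]
  refine ⟨2 ^ (m - 2), 2 ^ (m - 2 - i), ?_, hit, fun p hp => ?_⟩
  · rw [hm, show m + 1 = 3 + (m - 2) by omega, pow_add]
    norm_num
  · rw [land_eq_zero_iff_mod_div (m - 2), Nat.mul_mod_left, Nat.and_zero, Nat.div_eq_of_lt]
    · simp
    · rw [← hit]
      exact Nat.mul_lt_mul_of_pos_right hp (Nat.two_pow_pos _)

theorem IsOddGenerator.emptyFibres_nonempty_of_two (hσ : IsOddGenerator σ) {m M i v : ℕ}
    (hF : Fintype.card F = 7 * M + 1) (hm : 7 * M + 1 = 2 ^ (m + 1)) (hq : ∀ x, σ x = x ^ 2 ^ i)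
    (hv : 2 ^ i = 56 * v + 16) (hbig : 10000 * 2 ^ i ≤ M) : (emptyFibres σ M).Nonempty := by
  obtain ⟨P, t, hP, ht, hland⟩ := exists_mul_eq_two_pow hm hbig
  have hκ : 5 * P - 4 * M + 4 * M = 5 * P := by omega
  have htP : 5 * t ≤ P := by
    rw [← ht]
    exact Nat.mul_le_mul_right _ (by omega)
  refine hσ.emptyFibres_nonempty (κ := 5 * P - 4 * M) (h := 3 * v) (V := 35 * v + 10 + 6 * M)
    (ρ := 2) (u := 8 * v + 2) (s := 5 * t) (j₀ := 4) hF hm hq (by omega) (by omega) (by omega) ?_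
    (by norm_num) ?_ ?_ (by omega) ?_
  · have h8 : 8 * (5 * P - 4 * M) = 3 * M + 5 := by omega
    have : 2 ^ i * (5 * P - 4 * M) = (7 * v + 2) * (8 * (5 * P - 4 * M)) := by rw [hv]; ring
    rw [this, h8]
    ring
  · rw [hκ, ← ht]
    ring
  · rw [hκ]
    exact hland 5 (by omega)
  · intro j hj hne
    interval_cases j
    · exact ⟨4, 0, 13, by omega, by omega, by omega, by omega⟩
    · exact ⟨2, 0, 4, by omega, by omega, by omega, by omega⟩
    · exact ⟨1, 0, 2, by omega, by omega, by omega, by omega⟩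
    · exact ⟨2, 1, 6, by omega, by omega, by omega, by omega⟩
    · exact absurd rfl hne
    · exact ⟨1, 1, 4, by omega, by omega, by omega, by omega⟩
    · exact ⟨0, 0, 2, by omega, by omega, by omega, by omega⟩

theorem IsOddGenerator.emptyFibres_nonempty_of_four (hσ : IsOddGenerator σ) {m M i v : ℕ}
    (hF : Fintype.card F = 7 * M + 1) (hm : 7 * M + 1 = 2 ^ (m + 1)) (hq : ∀ x, σ x = x ^ 2 ^ i)
    (hv : 2 ^ i = 56 * v + 32) (hbig : 10000 * 2 ^ i ≤ M) : (emptyFibres σ M).Nonempty := by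
  obtain ⟨P, t, hP, ht, hland⟩ := exists_mul_eq_two_pow hm hbig
  have hκ : 3 * P - 2 * M + 2 * M = 3 * P := by omega
  have htP : 3 * t ≤ P := by
    rw [← ht]
    exact Nat.mul_le_mul_right _ (by omega)
  refine hσ.emptyFibres_nonempty (κ := 3 * P - 2 * M) (h := 5 * v) (V := 21 * v + 12 + 20 * M)
    (ρ := 4) (u := 8 * v + 4) (s := 3 * t) (j₀ := 2) hF hm hq (by omega) (by omega) (by omega) ?_
    (by norm_num) ?_ ?_ (by omega) ?_
  · have h8 : 8 * (3 * P - 2 * M) = 5 * M + 3 := by omega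
    have : 2 ^ i * (3 * P - 2 * M) = (7 * v + 4) * (8 * (3 * P - 2 * M)) := by rw [hv]; ring
    rw [this, h8]
    ring
  · rw [hκ, ← ht]
    ring
  · rw [hκ]
    exact hland 3 (by omega)
  · intro j hj hne
    interval_cases j
    · exact ⟨3, 0, 22, by omega, by omega, by omega, by omega⟩
    · exact ⟨2, 0, 13, by omega, by omega, by omega, by omega⟩
    · exact absurd rfl hne
    · exact ⟨0, 0, 4, by omega, by omega, by omega, by omega⟩
    · exact ⟨2, 2, 20, by omega, by omega, by omega, by omega⟩
    · exact ⟨0, 0, 5, by omega, by omega, by omega, by omega⟩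
    · exact ⟨1, 1, 12, by omega, by omega, by omega, by omega⟩

theorem IsOddGenerator.le_card_emptyFibres_of_two (hσ : IsOddGenerator σ) {m M i v : ℕ}
    (hF : Fintype.card F = 7 * M + 1) (hm : 7 * M + 1 = 2 ^ (m + 1)) (hq : ∀ x, σ x = x ^ 2 ^ i)
    (hv : 2 ^ i = 56 * v + 16) (hv0 : v ≠ 0) (hbig : 10000 * 2 ^ i ≤ M) :
    M ≤ 4 * 2 ^ i * #(emptyFibres σ M) := by
  obtain ⟨h, hh1, hh2⟩ : ∃ h, 3 * 2 ^ i ≤ 28 * h + 2 ∧ 56 * h + 6 ≤ 7 * 2 ^ i :=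
    ⟨(3 * 2 ^ i + 25) / 28, by omega, by omega⟩
  have hM1 := Nat.mul_le_mul_right M hh1
  have hM2 := Nat.mul_le_mul_right M hh2
  have hpos : 0 < 2 ^ i := Nat.two_pow_pos i
  have key := le_add_mul_card_of_powerSum_sub_eq_zero (c := 4 * 2 ^ i) (M := M)
    (lo := (28 * h + 2) * M) (hi := (28 * h + 3) * M) (zero_notMem_emptyFibres (by omega))
    (hσ.emptyFibres_nonempty_of_two hF hm hq hv hbig) (by omega)
    (Nat.mul_le_mul_right M (by omega)) (Nat.mul_le_mul_right M (by omega)) fun k hk1 hk2 => ?_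
  · linarith
  obtain ⟨V, hV⟩ : ∃ V, 2 ^ i * k = 7 * M * h + V :=
    Nat.exists_eq_add_of_le (by linarith)
  have hk3 : 3 * M < 4 * k := lt_of_mul_lt_mul_left (a := 2 ^ i) (by linarith) hpos.le
  have hk4 : 8 * k < 7 * M := lt_of_mul_lt_mul_left (a := 2 ^ i) (by linarith) hpos.le
  have hV1 : M < 2 * V := by linarith
  have hV2 : 4 * V < 3 * M := by linarith
  refine hσ.sum_emptyFibres_pow_sub_eq_zero (ρ := 2) (u := 8 * v + 2) hF hm hq (by omega)
    (by omega) (by omega) hV fun j hj => ?_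
  interval_cases j
  · exact ⟨3, 0, 0, by omega, by omega, by omega, by omega⟩
  · exact ⟨1, 0, 0, by omega, by omega, by omega, by omega⟩
  · exact ⟨2, 1, 2, by omega, by omega, by omega, by omega⟩
  · exact ⟨0, 0, 0, by omega, by omega, by omega, by omega⟩
  · exact ⟨2, 2, 4, by omega, by omega, by omega, by omega⟩
  · exact ⟨0, 0, 1, by omega, by omega, by omega, by omega⟩
  · exact ⟨0, 0, 1, by omega, by omega, by omega, by omega⟩

theorem IsOddGenerator.le_card_emptyFibres_of_four (hσ : IsOddGenerator σ) {m M i v : ℕ}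
    (hF : Fintype.card F = 7 * M + 1) (hm : 7 * M + 1 = 2 ^ (m + 1)) (hq : ∀ x, σ x = x ^ 2 ^ i)
    (hv : 2 ^ i = 56 * v + 32) (hbig : 10000 * 2 ^ i ≤ M) :
    M ≤ 4 * 2 ^ i * #(emptyFibres σ M) := by
  obtain ⟨h, hh1, hh2⟩ : ∃ h, 7 * 2 ^ i ≤ 56 * h + 12 ∧ 28 * h + 7 ≤ 4 * 2 ^ i :=
    ⟨(7 * 2 ^ i + 43) / 56, by omega, by omega⟩
  have hM1 := Nat.mul_le_mul_right M hh1
  have hM2 := Nat.mul_le_mul_right M hh2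
  have hpos : 0 < 2 ^ i := Nat.two_pow_pos i
  have key := le_add_mul_card_of_powerSum_sub_eq_zero (c := 4 * 2 ^ i) (M := M)
    (lo := (28 * h + 6) * M) (hi := (28 * h + 7) * M) (zero_notMem_emptyFibres (by omega))
    (hσ.emptyFibres_nonempty_of_four hF hm hq hv hbig) (by omega)
    (Nat.mul_le_mul_right M (by omega)) (Nat.mul_le_mul_right M (by omega)) fun k hk1 hk2 => ?_
  · linarith
  obtain ⟨V, hV⟩ : ∃ V, 2 ^ i * k = 7 * M * h + V :=
    Nat.exists_eq_add_of_le (by linarith)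
  have hk3 : 7 * M < 8 * k := lt_of_mul_lt_mul_left (a := 2 ^ i) (by linarith) hpos.le
  have hk4 : k < M := lt_of_mul_lt_mul_left (a := 2 ^ i) (by linarith) hpos.le
  have hV1 : 3 * M < 2 * V := by linarith
  have hV2 : 4 * V < 7 * M := by linarith
  refine hσ.sum_emptyFibres_pow_sub_eq_zero (ρ := 4) (u := 8 * v + 4) hF hm hq (by omega)
    (by omega) (by omega) hV fun j hj => ?_
  interval_cases j
  · exact ⟨2, 0, 0, by omega, by omega, by omega, by omega⟩
  · exact ⟨1, 0, 1, by omega, by omega, by omega, by omega⟩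
  · exact ⟨1, 0, 2, by omega, by omega, by omega, by omega⟩
  · exact ⟨0, 0, 1, by omega, by omega, by omega, by omega⟩
  · exact ⟨0, 0, 2, by omega, by omega, by omega, by omega⟩
  · exact ⟨3, 6, 24, by omega, by omega, by omega, by omega⟩
  · exact ⟨0, 0, 3, by omega, by omega, by omega, by omega⟩

theorem IsOddGenerator.le_card_emptyFibres_of_sixteen (hσ : IsOddGenerator σ) {m M : ℕ}
    (hF : Fintype.card F = 7 * M + 1) (hm : 7 * M + 1 = 2 ^ (m + 1)) (hq : ∀ x, σ x = x ^ 2 ^ 4)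
    (hbig : 10000 * 2 ^ 4 ≤ M) : 5 * M ≤ 512 * #(emptyFibres σ M) := by
  have key := le_add_mul_card_of_powerSum_sub_eq_zero (c := 512) (M := M)
    (lo := 371 * M) (hi := 376 * M) (zero_notMem_emptyFibres (by omega))
    (hσ.emptyFibres_nonempty_of_two hF hm hq (v := 0) (by norm_num) hbig) (by omega)
    (by omega) (by omega) fun k hk1 hk2 => ?_
  · omega
  obtain ⟨V, hV⟩ : ∃ V, 2 ^ 4 * k = 7 * M * 1 + V := Nat.exists_eq_add_of_le (by omega)
  refine hσ.sum_emptyFibres_pow_sub_eq_zero (ρ := 2) (u := 2) hF hm hq (by norm_num)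
    (by omega) (by omega) hV fun j hj => ?_
  interval_cases j
  · exact ⟨4, 1, 10, by omega, by omega, by omega, by omega⟩
  · exact ⟨2, 0, 3, by omega, by omega, by omega, by omega⟩
  · exact ⟨2, 1, 4, by omega, by omega, by omega, by omega⟩
  · exact ⟨0, 0, 1, by omega, by omega, by omega, by omega⟩
  · exact ⟨0, 0, 1, by omega, by omega, by omega, by omega⟩
  · exact ⟨3, 6, 16, by omega, by omega, by omega, by omega⟩
  · exact ⟨1, 1, 4, by omega, by omega, by omega, by omega⟩

end EmptyFibresCount

/-! ### Power sums over the parameters without roots, for `σ x = x ^ 4` -/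

/-- A set of residues, closed under those doublings modulo `D` that avoid a clash with the
twentyfold. -/
def InDoublingSet (D z : ℕ) : Prop :=
  (D ≤ 5 * z ∧ 4 * z < D) ∨ (2 * D ≤ 5 * z ∧ 16 * z < 7 * D) ∨ (9 * D ≤ 20 * z ∧ 2 * z < D) ∨
  (3 * D ≤ 5 * z ∧ 8 * z < 5 * D) ∨ (7 * D ≤ 10 * z ∧ 4 * z < 3 * D) ∨
  (4 * D ≤ 5 * z ∧ 16 * z < 13 * D) ∨ (17 * D ≤ 20 * z ∧ 8 * z < 7 * D) ∨
  (9 * D ≤ 10 * z ∧ 16 * z < 15 * D) ∨ (19 * D ≤ 20 * z ∧ z < D)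

theorem inDoublingSet_of_not_leadingClash {D l n C z : ℕ} (hD : Odd D)
    (h : ¬LeadingClash D l (20 * l)) (hz : 2 ^ n * l = D * C + z)
    (hz' : (2 * D ≤ 5 * z ∧ 2 * z < D) ∨ (4 * D ≤ 5 * z ∧ 8 * z < 7 * D) ∨
      (9 * D ≤ 10 * z ∧ z < D)) : InDoublingSet D z := by
  obtain ⟨E, hE⟩ := hD
  have h1 : ¬(7 * D < 16 * z ∧ 20 * z < 9 * D) := fun hw =>
    h ⟨n + 1, 2 * C, 40 * C + 17, by rw [pow_succ]; linarith, by rw [pow_succ]; linarith,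
      by rw [pow_succ]; linarith, by rw [pow_succ]; linarith⟩
  have h2 : ¬(33 * D < 40 * z ∧ 20 * z < 17 * D) := fun hw =>
    h ⟨n, C, 20 * C + 16, by linarith, by linarith, by linarith, by linarith⟩
  have h3 : ¬(13 * D < 16 * z ∧ 40 * z < 33 * D) := fun hw =>
    h ⟨n + 1, 2 * C + 1, 40 * C + 32, by rw [pow_succ]; linarith, by rw [pow_succ]; linarith,
      by rw [pow_succ]; linarith, by rw [pow_succ]; linarith⟩
  have h4 : ¬(15 * D < 16 * z ∧ 20 * z < 19 * D) := fun hw =>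
    h ⟨n, C, 20 * C + 18, by linarith, by linarith, by linarith, by linarith⟩
  unfold InDoublingSet
  omega

theorem leadingClash_of_lt_of_lt {m l : ℕ} (hl : 2 ^ (m + 1) - 1 < 10 * l)
    (hl' : 8 * l < 2 ^ (m + 1) - 1) : LeadingClash (2 ^ (m + 1) - 1) l (20 * l) := by
  by_contra h
  have hodd : Odd (2 ^ (m + 1) - 1) :=
    Nat.Even.sub_odd Nat.one_le_two_pow (Nat.even_pow.2 ⟨even_two, m.succ_ne_zero⟩) odd_one
  have hpow : 2 ^ (m + 1) = (2 ^ (m + 1) - 1) + 1 := (Nat.sub_add_cancel Nat.one_le_two_pow).symm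
  set D := 2 ^ (m + 1) - 1 with hD
  have hchain : ∀ n, ∃ C z, 2 ^ (n + 1) * l = D * C + z ∧ InDoublingSet D z := by
    intro n
    induction n with
    | zero => exact ⟨0, 2 * l, by ring, Or.inl (by omega)⟩
    | succ n ih =>
      obtain ⟨C, z, hz, hW⟩ := ih
      obtain ⟨C', z', hz', hW'⟩ : ∃ C' z', 2 ^ (n + 1 + 1) * l = D * C' + z' ∧
          (InDoublingSet D z' ∨ (2 * D ≤ 5 * z' ∧ 2 * z' < D) ∨ (4 * D ≤ 5 * z' ∧ 8 * z' < 7 * D) ∨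
            (9 * D ≤ 10 * z' ∧ z' < D)) := by
        unfold InDoublingSet at hW ⊢
        rcases lt_or_ge (2 * z) D with hlt | hge
        · exact ⟨2 * C, 2 * z, by rw [pow_succ]; linarith, by omega⟩
        · obtain ⟨z', hz'⟩ := Nat.exists_eq_add_of_le hge
          exact ⟨2 * C + 1, z', by rw [pow_succ]; linarith, by omega⟩
      rcases hW' with hW' | hW'
      · exact ⟨C', z', hz', hW'⟩
      · exact ⟨C', z', hz', inDoublingSet_of_not_leadingClash hodd h hz' hW'⟩
  obtain ⟨C, z, hz, hW⟩ := hchain m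
  have hzlt : z < D ∧ D ≤ 5 * z := by
    unfold InDoublingSet at hW
    omega
  rw [hpow] at hz
  have hmod : l % D = z % D := by
    rw [← Nat.mul_add_mod D l l, ← Nat.mul_add_mod D C z, ← hz]
    congr 1
    ring
  rw [Nat.mod_eq_of_lt (by omega), Nat.mod_eq_of_lt hzlt.1] at hmod
  omega

theorem leadingClash_of_seven_mul_eq {m κ l j : ℕ} (hκ : 7 * (2 ^ (m + 1) - 1) < 10 * κ)
    (hκ' : 4 * κ < 3 * (2 ^ (m + 1) - 1)) (hj : j < 7) (hl : 7 * l = κ + (2 ^ (m + 1) - 1) * j) :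
    LeadingClash (2 ^ (m + 1) - 1) l (20 * l) := by
  have hodd : Odd (2 ^ (m + 1) - 1) :=
    Nat.Even.sub_odd Nat.one_le_two_pow (Nat.even_pow.2 ⟨even_two, m.succ_ne_zero⟩) odd_one
  rcases Nat.eq_zero_or_pos j with rfl | hj0
  · exact leadingClash_of_lt_of_lt (by omega) (by omega)
  generalize 2 ^ (m + 1) - 1 = D at *
  obtain ⟨E, hE⟩ := hodd
  interval_cases j
  · rcases lt_or_ge (160 * κ) (113 * D) with h | h
    · exact ⟨3, 1, 38, by omega, by omega, by omega, by omega⟩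
    · exact ⟨2, 0, 19, by omega, by omega, by omega, by omega⟩
  · rcases lt_or_ge (80 * κ) (57 * D) with h | h
    · exact ⟨2, 1, 30, by omega, by omega, by omega, by omega⟩
    · exact ⟨1, 0, 15, by omega, by omega, by omega, by omega⟩
  · exact ⟨0, 0, 10, by omega, by omega, by omega, by omega⟩
  · rcases lt_or_ge (40 * κ) (29 * D) with h | h
    · exact ⟨2, 2, 53, by omega, by omega, by omega, by omega⟩
    · exact ⟨0, 0, 13, by omega, by omega, by omega, by omega⟩
  · exact ⟨1, 1, 32, by omega, by omega, by omega, by omega⟩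
  · rcases lt_or_ge (80 * κ) (59 * D) with h | h
    · exact ⟨2, 3, 76, by omega, by omega, by omega, by omega⟩
    · exact ⟨1, 1, 38, by omega, by omega, by omega, by omega⟩

section RootlessParameters

variable {F : Type*} [Field F] [Fintype F] [CharP F 2] [DecidableEq F] {σ : F →+* F}

theorem IsOddGenerator.card_companionRoots_add_one (hσ : IsOddGenerator σ) (a : F) :
    #(companionRoots σ a) + 1 = #{x | σ (σ (σ x)) + a * σ x + x = 0} := by
  refine le_antisymm ?_ (hσ.card_linearized_le a)
  have h0 : (0 : F) ∈ ({x | σ (σ (σ x)) + a * σ x + x = 0} : Finset F) := by simp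
  rw [← card_erase_add_one h0, Nat.add_le_add_iff_right]
  refine card_le_card_of_surjOn (fun x => σ x / x) fun t ht => ?_
  obtain ⟨ht0, ht⟩ := (mem_filter.1 (mem_coe.1 ht)).2
  obtain ⟨x, hx0, hx⟩ := hσ.exists_eigenvector t ht0
  refine ⟨x, mem_coe.2 (mem_erase.2 ⟨hx0, mem_filter.2 ⟨mem_univ _, ?_⟩⟩), ?_⟩
  · simp only [hx, map_mul]
    linear_combination x * ht
  · simp only [hx]
    field_simp

theorem IsOddGenerator.natCast_card_companionRoots (hσ : IsOddGenerator σ) (a : F) :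
    (#(companionRoots σ a) : F) = if companionRoots σ a = ∅ then 0 else 1 := by
  split_ifs with h
  · simp [h]
  · obtain ⟨t, ht⟩ := nonempty_iff_ne_empty.2 h
    have hcard := hσ.card_companionRoots_add_one a
    have hpos := card_pos.2 ⟨t, ht⟩
    obtain ⟨x, hx, hx0⟩ : ∃ x ∈ ({x | σ (σ (σ x)) + a * σ x + x = 0} : Finset F), x ≠ 0 :=
      exists_mem_ne (by omega) 0
    have heven : Even #{x | σ (σ (σ x)) + a * σ x + x = 0} := by
      refine even_card_of_add_mem hx0 fun y hy => mem_filter.2 ⟨mem_univ _, ?_⟩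
      simp only [map_add]
      linear_combination (mem_filter.1 hy).2 + (mem_filter.1 hx).2
    rw [← hcard] at heven
    have hzero : ((#(companionRoots σ a) + 1 : ℕ) : F) = 0 := by
      rw [CharP.cast_eq_zero_iff F 2]
      exact heven.two_dvd
    push_cast at hzero
    linear_combination hzero - (CharTwo.two_eq_zero : (2 : F) = 0)

theorem IsOddGenerator.sum_rootless_pow (hσ : IsOddGenerator σ) {d k : ℕ}
    (hd : ∀ t : F, t * σ t * σ (σ t) = t ^ d) (hk0 : 0 < k) (hk : k < Fintype.card F - 1) :
    ∑ a with companionRoots σ a = ∅, a ^ k =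
      ∑ t : F, t ^ (Fintype.card F - 1 - k) * (t ^ d + 1) ^ k := by
  have htot : ∑ a : F, a ^ k = 0 := by
    rw [sum_pow_eq_ite (by omega), if_neg fun h => ?_]
    have := Nat.le_of_dvd hk0 h
    omega
  have hterm : ∀ t : F, t ^ (Fintype.card F - 1 - k) * (t ^ d + 1) ^ k =
      if t ≠ 0 then ((t ^ d + 1) / t) ^ k else 0 := by
    intro t
    split_ifs with ht
    · rw [div_pow, mul_comm, eq_div_iff (pow_ne_zero k ht), mul_assoc, ← pow_add,
        Nat.sub_add_cancel hk.le, FiniteField.pow_card_sub_one_eq_one t ht, mul_one]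
    · rw [not_not.1 ht, zero_pow (by omega), zero_mul]
  have hroots : ∀ a : F, companionRoots σ a =
      {t ∈ ({t | t ≠ 0} : Finset F) | (t ^ d + 1) / t = a} := by
    intro a
    ext t
    simp only [companionRoots, mem_filter, mem_univ, true_and, hd]
    refine and_congr_right fun ht => ?_
    rw [div_eq_iff ht]
    constructor <;> intro h
    · linear_combination h - a * t * (CharTwo.two_eq_zero : (2 : F) = 0)
    · linear_combination h + a * t * (CharTwo.two_eq_zero : (2 : F) = 0)
  rw [sum_congr rfl fun t _ => hterm t, ← sum_filter,
    ← sum_fiberwise (s := ({t | t ≠ 0} : Finset F)) (g := fun t : F => (t ^ d + 1) / t)]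
  have hfib : ∀ a : F, (∑ t ∈ ({t | t ≠ 0} : Finset F) with (t ^ d + 1) / t = a,
      ((t ^ d + 1) / t) ^ k) = a ^ k - if companionRoots σ a = ∅ then a ^ k else 0 := by
    intro a
    rw [sum_congr rfl (g := fun _ => a ^ k) fun t ht => by rw [(mem_filter.1 ht).2], sum_const,
      nsmul_eq_mul, ← hroots, hσ.natCast_card_companionRoots]
    split_ifs <;> ring
  rw [sum_congr rfl fun a _ => hfib a, sum_sub_distrib, htot, zero_sub, CharTwo.neg_eq, sum_filter]

theorem IsOddGenerator.sum_rootless_pow_eq_zero (hσ : IsOddGenerator σ) {m κ : ℕ}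
    (hm : Odd (m + 1)) (hF : Fintype.card F = 2 ^ (m + 1)) (hq : ∀ x, σ x = x ^ 4)
    (hκ : 7 * (2 ^ (m + 1) - 1) < 10 * κ) (hκ' : 4 * κ < 3 * (2 ^ (m + 1) - 1)) :
    ∑ a with companionRoots σ a = ∅, a ^ (3 * κ - 2 * (2 ^ (m + 1) - 1)) = 0 := by
  have hd : ∀ t : F, t * σ t * σ (σ t) = t ^ 21 := fun t => by
    rw [hq, hq]
    ring
  have hcop : Nat.Coprime (2 ^ (m + 1) - 1) 3 := by
    simpa using coprime_two_pow_add_one hm one_pos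
  rw [hσ.sum_rootless_pow hd (by omega) (by omega), sum_pow_mul_pow_add_one (by omega)]
  refine sum_eq_zero fun l hl => ?_
  rw [mem_filter, mem_range, hF] at hl
  obtain ⟨hlk, hdvd⟩ := hl
  rw [CharP.cast_eq_zero_iff F 2, ← even_iff_two_dvd, ← Nat.not_odd_iff_even]
  intro hoddc
  obtain ⟨b, hb⟩ := Nat.exists_eq_add_of_le (Nat.lt_succ_iff.1 hlk)
  rw [hb] at hoddc
  have hland := land_eq_zero_of_odd_choose_add l b hoddc
  have hdvd' : 2 ^ (m + 1) - 1 ∣ 3 * (2 ^ (m + 1) - 1 - κ + 7 * l) := by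
    convert hdvd using 1
    omega
  obtain ⟨j, hj⟩ := hcop.dvd_of_dvd_mul_left hdvd'
  have hclash : LeadingClash (2 ^ (m + 1) - 1) l (20 * l) := by
    have hj1 : 1 ≤ j := by
      by_contra! hlt
      rw [Nat.lt_one_iff.1 hlt] at hj
      omega
    have hj8 : j < 8 := by
      refine lt_of_mul_lt_mul_left (a := 2 ^ (m + 1) - 1) ?_ (Nat.zero_le _)
      omega
    obtain ⟨j, rfl⟩ := Nat.exists_eq_add_of_le hj1
    rw [mul_add] at hj
    exact leadingClash_of_seven_mul_eq (j := j) hκ hκ' (by omega) (by omega)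
  obtain ⟨n, h1, h2⟩ := hclash.exists_le_mod
  refine not_both_le_of_land_eq_zero (by omega) (by omega) hland n ⟨h1, ?_⟩
  have hmod : 20 * l ≡ b [MOD 2 ^ (m + 1) - 1] := by
    obtain ⟨c, hc⟩ := hdvd
    have h3 : 20 * l + (2 ^ (m + 1) - 1) = b + (2 ^ (m + 1) - 1) * c := by omega
    have h4 : 20 * l + (2 ^ (m + 1) - 1) ≡ b + (2 ^ (m + 1) - 1) * c [MOD 2 ^ (m + 1) - 1] := by
      rw [h3]
    simpa [Nat.ModEq, Nat.add_mod_right, Nat.add_mul_mod_self_left] using h4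
  rw [← hmod.mul_left (2 ^ n)]
  exact h2

theorem IsOddGenerator.card_le_of_four (hσ : IsOddGenerator σ) {m : ℕ} (hm : Odd (m + 1))
    (hF : Fintype.card F = 2 ^ (m + 1)) (hq : ∀ x, σ x = x ^ 4) :
    2 ^ (m + 1) - 1 ≤ 20 * #{a | companionRoots σ a = ∅} := by
  have hcop : Nat.Coprime (Fintype.card F - 1) 3 := by
    rw [hF]
    simpa using coprime_two_pow_add_one hm one_pos
  have hne0 : ∀ a ∈ ({a | companionRoots σ a = ∅} : Finset F), a ≠ 0 := by
    rintro a ha rfl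
    have h1 : (1 : F) ∈ companionRoots σ 0 :=
      mem_filter.2 ⟨mem_univ _, one_ne_zero, by simp [CharTwo.add_self_eq_zero]⟩
    rw [(mem_filter.1 ha).2] at h1
    exact absurd h1 (notMem_empty _)
  have hinj : Set.InjOn (fun a : F => a ^ 3) ({a | companionRoots σ a = ∅} : Finset F) := by
    intro a ha b hb hab
    have hb0 := hne0 b (mem_coe.1 hb)
    refine (div_eq_one_iff_eq hb0).1 (eq_one_of_pow_eq_one_of_coprime hcop
      (div_ne_zero (hne0 a (mem_coe.1 ha)) hb0) ?_)
    rw [div_pow]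
    exact (div_eq_one_iff_eq (pow_ne_zero 3 hb0)).2 hab
  have hnonempty : ({a | companionRoots σ a = ∅} : Finset F).Nonempty := by
    rw [← card_pos]
    have := hσ.card_multipleRoots_le
    omega
  have key := le_add_mul_card_of_powerSum_eq_zero (c := 20) (lo := 14 * (2 ^ (m + 1) - 1))
    (hi := 15 * (2 ^ (m + 1) - 1))
    (S := ({a | companionRoots σ a = ∅} : Finset F).image fun a => a ^ 3) ?_
    (hnonempty.image _) (by norm_num) fun κ h1 h2 => ?_
  · rw [card_image_of_injOn hinj] at key
    omega
  · rw [mem_image]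
    rintro ⟨a, ha, ha3⟩
    exact pow_ne_zero 3 (hne0 a ha) ha3
  · rw [sum_image hinj, ← hσ.sum_rootless_pow_eq_zero hm hF hq (κ := κ) (by omega) (by omega)]
    refine sum_congr rfl fun a ha => ?_
    have h3 := FiniteField.pow_card_sub_one_eq_one a (hne0 a ha)
    rw [hF] at h3
    rw [← pow_mul]
    conv_lhs => rw [show 3 * κ = (3 * κ - 2 * (2 ^ (m + 1) - 1)) + (2 ^ (m + 1) - 1) * 2 by omega]
    rw [pow_add, pow_mul, h3, one_pow, mul_one]

end RootlessParameters

/-! ### Lower bounds for the number of parameters without roots -/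

section LowerBound

variable {F : Type*} [Field F] [Fintype F] [CharP F 2] [DecidableEq F] {σ : F →+* F}

theorem IsOddGenerator.six_mul_card_multipleFibres_lt (hσ : IsOddGenerator σ) {M d : ℕ}
    (hF : Fintype.card F = 7 * M + 1) (hM : 0 < M) (hd0 : 0 < d) (hd : Nat.Coprime d M)
    (hN : ∀ t : F, t * σ t * σ (σ t) = t ^ (7 * d)) :
    6 * #(multipleFibres σ M) + 1 ≤ #{a | companionRoots σ a = ∅} := by
  have h1 := seven_mul_card_multipleFibres_le hF hM hd0 hd hN
  have h2 := hσ.card_multipleRoots_le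
  omega

theorem IsOddGenerator.le_card_rootless_of_square (hσ : IsOddGenerator σ) {M : ℕ}
    (hF : Fintype.card F = 7 * M + 1) (hM : 0 < M) (hq : ∀ x, σ x = x ^ 2) :
    (Fintype.card F : ℝ) + 4 - 19 * √(Fintype.card F) ≤
      7 * #{a | companionRoots σ a = ∅} := by
  have h1 : (6 * #(multipleFibres σ M) + 1 : ℝ) ≤ #{a | companionRoots σ a = ∅} := by
    exact_mod_cast hσ.six_mul_card_multipleFibres_lt hF hM one_pos (Nat.coprime_one_left M)
      fun t => by rw [hq, hq]; ring
  have h2 : (#(kernelPreimage σ M) : ℝ) ≤ #(singleFibres σ M) + 3 * #(multipleFibres σ M) := by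
    exact_mod_cast hσ.card_kernelPreimage_le hM
  have h3 := card_le_card_kernelPreimage hF hM hq (by norm_num) (by norm_num)
  have h4 := hσ.two_mul_card_singleFibres_le hq hM
  have h5 : (Fintype.card F : ℝ) = 7 * M + 1 := by exact_mod_cast hF
  linarith

theorem IsOddGenerator.le_card_rootless_of_emptyFibres (hσ : IsOddGenerator σ) {M q d : ℕ}
    (hF : Fintype.card F = 7 * M + 1) (hM : 0 < M) (hq : ∀ x, σ x = x ^ q) (hq0 : ¬7 ∣ q)
    (hq1 : ¬7 ∣ q + 1) (hd0 : 0 < d) (hd : Nat.Coprime d M) (hqd : q ^ 2 + q + 1 = 7 * d) :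
    21 * (#(emptyFibres σ M) : ℝ) + 4 - 18 * √(Fintype.card F) ≤
      7 * #{a | companionRoots σ a = ∅} := by
  have h1 : (6 * #(multipleFibres σ M) + 1 : ℝ) ≤ #{a | companionRoots σ a = ∅} := by
    exact_mod_cast hσ.six_mul_card_multipleFibres_lt hF hM hd0 hd
      fun t => by rw [hq, hq, ← hqd]; ring
  have h2 : (#(kernelPreimage σ M) + #(emptyFibres σ M) : ℝ) ≤ M + 2 * #(multipleFibres σ M) := by
    exact_mod_cast hσ.card_kernelPreimage_add_le hM
  have h3 := card_le_card_kernelPreimage hF hM hq hq0 hq1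
  have h5 : (Fintype.card F : ℝ) = 7 * M + 1 := by exact_mod_cast hF
  linarith

end LowerBound

theorem eight_pow_eq (k : ℕ) : ∃ w, 8 ^ k = 7 * w + 1 := by
  have : 8 ^ k % 7 = 1 := by rw [Nat.pow_mod]; simp
  exact ⟨8 ^ k / 7, by omega⟩

theorem two_pow_mul_self_sub_one (i : ℕ) :
    ((2 ^ i) ^ 2 + 2 ^ i + 1) * (2 ^ i - 1) = 2 ^ (3 * i) - 1 := by
  obtain ⟨c, hc⟩ := Nat.exists_eq_add_of_le (Nat.one_le_two_pow (n := i))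
  rw [mul_comm 3 i, pow_mul, hc, Nat.add_sub_cancel_left]
  refine (Nat.sub_eq_of_eq_add ?_).symm
  ring

theorem coprime_of_seven_mul_eq {m i M d : ℕ} (hgcd : Nat.gcd i m = 1) (h3 : 3 ∣ m)
    (hM : 7 * M + 1 = 2 ^ m) (hd : (2 ^ i) ^ 2 + 2 ^ i + 1 = 7 * d) : Nat.Coprime d M := by
  have hg : Nat.gcd (3 * i) m = 3 := by
    obtain ⟨k, rfl⟩ := h3
    rw [Nat.gcd_mul_left, Nat.Coprime.coprime_mul_left_right hgcd]
  have h7 : Nat.gcd (7 * d) (7 * M) ∣ 7 := by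
    have h1 : Nat.gcd (2 ^ (3 * i) - 1) (2 ^ m - 1) = 7 := by
      rw [Nat.pow_sub_one_gcd_pow_sub_one, hg]
      norm_num
    rw [← two_pow_mul_self_sub_one, hd, ← hM, Nat.add_sub_cancel] at h1
    exact (Nat.gcd_dvd_gcd_of_dvd_left _ (Nat.dvd_mul_right _ _)).trans h1.dvd
  rw [Nat.gcd_mul_left] at h7
  exact Nat.dvd_one.1 (Nat.dvd_of_mul_dvd_mul_left (by norm_num : 0 < 7) (by simpa using h7))

theorem mul_le_of_bound_pos {N q : ℕ} (hq : 16 ≤ q)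
    (h : 0 < (N : ℝ) + 1 - (((q ^ 2 + q + 1 : ℕ) : ℝ) - 1) * (((q ^ 2 + q + 1 : ℕ) : ℝ) - 2) * √N
      - ((q ^ 2 + q + 1 : ℕ) : ℝ)) : 80000 * q ≤ N := by
  have hq' : (16 : ℝ) ≤ q := by exact_mod_cast hq
  push_cast at h
  have hs := Real.mul_self_sqrt (Nat.cast_nonneg (α := ℝ) N)
  have hs0 := Real.sqrt_nonneg (N : ℝ)
  set s := √(N : ℝ)
  have hq2 : 16 * (q : ℝ) ≤ (q : ℝ) ^ 2 := by nlinarith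
  have hbig : (q : ℝ) ^ 2 * (q : ℝ) ^ 2 ≤ ((q : ℝ) ^ 2 + q + 1 - 1) * ((q : ℝ) ^ 2 + q + 1 - 2) := by
    apply mul_le_mul <;> nlinarith
  have hsq : (q : ℝ) ^ 2 * (q : ℝ) ^ 2 ≤ s := by
    by_contra! hlt
    have := mul_le_mul_of_nonneg_right (hlt.le.trans hbig) hs0
    nlinarith
  have h4096 : 4096 * (q : ℝ) ≤ (q : ℝ) ^ 2 * (q : ℝ) ^ 2 := by nlinarith
  have hs1 : 4096 * (q : ℝ) ≤ s := h4096.trans hsq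
  have : 80000 * (q : ℝ) ≤ N := by nlinarith
  exact_mod_cast this

theorem IsOddGenerator.le_card_rootless {F : Type*} [Field F] [Fintype F] [CharP F 2]
    [DecidableEq F] {σ : F →+* F} (hσ : IsOddGenerator σ) {m i : ℕ} (hm : Odd m) (hi : 0 < i)
    (hgcd : Nat.gcd i m = 1) (hF : Fintype.card F = 2 ^ m) (hq : ∀ x, σ x = x ^ 2 ^ i) {d : ℕ}
    (hd : d = (2 ^ i) ^ 2 + 2 ^ i + 1) :
    (Fintype.card F : ℝ) + 1 - ((d : ℝ) - 1) * ((d : ℝ) - 2) * √(Fintype.card F) - d ≤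
      d * #{a | companionRoots σ a = ∅} := by
  set B := #{a | companionRoots σ a = ∅} with hB
  have hB0 : (0 : ℝ) ≤ B := Nat.cast_nonneg _
  have hs0 := Real.sqrt_nonneg (Fintype.card F : ℝ)
  have hd7 : (7 : ℝ) ≤ d := by
    have hq2 : 2 ≤ 2 ^ i := Nat.le_self_pow hi.ne' 2
    have : 7 ≤ d := by rw [hd]; nlinarith
    exact_mod_cast this
  have hdd : (0 : ℝ) ≤ ((d : ℝ) - 1) * ((d : ℝ) - 2) :=
    mul_nonneg (by linarith) (by linarith)
  have hdds := mul_nonneg hdd hs0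
  by_cases h3 : 3 ∣ m
  swap
  · have hcop : Nat.Coprime (Fintype.card F - 1) d := by
      have h1 : Nat.Coprime (2 ^ m - 1) (2 ^ (3 * i) - 1) :=
        coprime_two_pow_sub_one (Nat.Coprime.mul_left
          ((Nat.Prime.coprime_iff_not_dvd Nat.prime_three).2 h3) hgcd)
      rw [hF, hd]
      refine h1.coprime_dvd_right ⟨2 ^ i - 1, (two_pow_mul_self_sub_one i).symm⟩
    have hcard := hσ.card_le_seven_mul fun c hc => by
      obtain ⟨t, ht0, ht⟩ := exists_pow_eq_of_coprime hcop hc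
      refine ⟨t, ht0, ?_⟩
      rw [← ht, hq, hq, hd]
      ring
    have hcard' : (Fintype.card F : ℝ) + 5 ≤ 7 * B := by exact_mod_cast hcard
    have := mul_le_mul_of_nonneg_right hd7 hB0
    linarith
  obtain ⟨M, hM⟩ : ∃ M, 2 ^ m = 7 * M + 1 := by
    obtain ⟨k, rfl⟩ := h3
    obtain ⟨w, hw⟩ := eight_pow_eq k
    exact ⟨w, by rw [pow_mul]; exact hw⟩
  have hFM := hF.trans hM
  obtain ⟨m, rfl⟩ : ∃ k, m = k + 1 := ⟨m - 1, by have := hm.pos; omega⟩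
  have hM0 : 0 < M := by
    rcases Nat.eq_zero_or_pos M with rfl | h
    · exact absurd hM (by simp)
    · exact h
  have hi3 : ¬3 ∣ i := fun h => by
    have := Nat.dvd_gcd h h3
    rw [hgcd] at this
    omega
  have hFM' : (Fintype.card F : ℝ) = 7 * M + 1 := by exact_mod_cast hFM
  rcases (show i = 1 ∨ i = 2 ∨ 4 ≤ i by omega) with rfl | rfl | hi4
  · have h := hσ.le_card_rootless_of_square hFM hM0 (by simpa using hq)
    rw [← hB] at h
    obtain rfl : d = 7 := hd
    push_cast
    linarith
  · have h := hσ.card_le_of_four hm hF (by simpa using hq)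
    rw [← hB, hM, Nat.add_sub_cancel] at h
    have h' : (7 * M : ℝ) ≤ 20 * B := by exact_mod_cast h
    obtain rfl : d = 21 := hd
    push_cast at hdds ⊢
    linarith
  have hq16 : 16 ≤ 2 ^ i := Nat.pow_le_pow_right (n := 2) (by norm_num) hi4
  rcases le_or_gt ((Fintype.card F : ℝ) + 1 - ((d : ℝ) - 1) * ((d : ℝ) - 2) * √(Fintype.card F) - d)
    0 with hle | hpos
  · exact hle.trans (by positivity)
  rw [hd] at hpos
  have hbig := mul_le_of_bound_pos hq16 hpos
  have hbig' : 10000 * 2 ^ i ≤ M := by omega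
  have hcases : (∃ v, 2 ^ i = 56 * v + 16 ∧ (v = 0 → i = 4)) ∨ ∃ v, 2 ^ i = 56 * v + 32 := by
    rcases (show i % 3 = 1 ∨ i % 3 = 2 by omega) with hmod | hmod
    · obtain ⟨k, rfl⟩ : ∃ k, i = 3 * k + 4 := ⟨(i - 4) / 3, by omega⟩
      obtain ⟨w, hw⟩ := eight_pow_eq k
      refine Or.inl ⟨2 * w, ?_, fun hw0 => ?_⟩
      · rw [pow_add, pow_mul, show 2 ^ 3 = 8 from rfl, hw]
        ring
      · obtain rfl : k = 0 := by
          by_contra hk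
          have := Nat.one_lt_pow hk (by norm_num : 1 < 8)
          omega
        rfl
    · obtain ⟨k, rfl⟩ : ∃ k, i = 3 * k + 5 := ⟨(i - 5) / 3, by omega⟩
      obtain ⟨w, hw⟩ := eight_pow_eq k
      refine Or.inr ⟨4 * w, ?_⟩
      rw [pow_add, pow_mul, show 2 ^ 3 = 8 from rfl, hw]
      ring
  obtain ⟨d', hd'⟩ : ∃ d', (2 ^ i) ^ 2 + 2 ^ i + 1 = 7 * d' := by
    rcases hcases with ⟨v, hv, -⟩ | ⟨v, hv⟩ <;> rw [hv]
    · exact ⟨448 * v ^ 2 + 264 * v + 39, by ring⟩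
    · exact ⟨448 * v ^ 2 + 520 * v + 151, by ring⟩
  have hcop := coprime_of_seven_mul_eq hgcd h3 hM.symm hd'
  have hempty : 7 * M ≤ 3 * d * #(emptyFibres σ M) ∧ ¬7 ∣ 2 ^ i ∧ ¬7 ∣ 2 ^ i + 1 := by
    have hdq : 28 * 2 ^ i ≤ 3 * d := by
      rw [hd]
      nlinarith
    have hgap : M ≤ 4 * 2 ^ i * #(emptyFibres σ M) → 7 * M ≤ 3 * d * #(emptyFibres σ M) := by
      intro h
      have := Nat.mul_le_mul_right #(emptyFibres σ M) hdq
      linarith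
    rcases hcases with ⟨v, hv, hv4⟩ | ⟨v, hv⟩
    · refine ⟨?_, by omega, by omega⟩
      rcases eq_or_ne v 0 with h0 | h0
      · obtain rfl := hv4 h0
        have := hσ.le_card_emptyFibres_of_sixteen hFM hM.symm hq hbig'
        obtain rfl : d = 273 := hd
        omega
      · exact hgap (hσ.le_card_emptyFibres_of_two hFM hM.symm hq hv h0 hbig')
    · exact ⟨hgap (hσ.le_card_emptyFibres_of_four hFM hM.symm hq hv hbig'), by omega, by omega⟩
  have hfin := hσ.le_card_rootless_of_emptyFibres hFM hM0 hq hempty.2.1 hempty.2.2 (by omega) hcop hd'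
  rw [← hB] at hfin
  have hempty' : (7 * M : ℝ) ≤ 3 * d * #(emptyFibres σ M) := by exact_mod_cast hempty.1
  have hmul := mul_le_mul_of_nonneg_left hfin (by linarith : (0 : ℝ) ≤ d)
  have hslack : 0 ≤ (((d : ℝ) - 1) * ((d : ℝ) - 2) - 18 / 7 * d) * √(Fintype.card F) :=
    mul_nonneg (by nlinarith) hs0
  linarith

theorem stmt_14 (m i : ℕ) (hm : 3 ≤ m) (hmodd : Odd m) (hi : 0 < i)
    (hgcd : Nat.gcd i m = 1) (q d : ℕ) (hq : q = 2 ^ i) (hd : d = q ^ 2 + q + 1)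
    (F : Type*) [Field F] [Fintype F] (hF : Fintype.card F = 2 ^ m) :
    (((2 : ℝ) ^ m + 1 - ((d : ℝ) - 1) * ((d : ℝ) - 2) * Real.sqrt ((2 : ℝ) ^ m)
        - (d : ℝ)) / (d : ℝ) ≤
      ({a : F | a ≠ 0 ∧
        ¬ ∃ t : F, t ≠ 0 ∧ t ^ (q ^ 2 + q + 1) + a * t + 1 = 0}.ncard : ℝ)) ∧
    (∀ a : F, a ≠ 0 →
      (¬ ∃ t : F, t ≠ 0 ∧ t ^ (q ^ 2 + q + 1) + a * t + 1 = 0) →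
      Function.Bijective (Gmap q a) ∧ IsAPN (Gmap q a)) := by
  classical
  have : CharP F 2 := charP_of_card_eq_prime_pow hF
  set σ := iterateFrobenius F 2 i with hσdef
  have hσ : IsOddGenerator σ := isOddGenerator_iterateFrobenius hmodd hi hgcd hF
  have hpow : ∀ x, σ x = x ^ q := fun x => by rw [hσdef, iterateFrobenius_def, hq]
  have hroot : ∀ a t : F,
      t ^ (q ^ 2 + q + 1) + a * t + 1 = t * σ t * σ (σ t) + a * t + 1 := by
    intro a t
    rw [hpow, hpow]
    ring
  simp only [hroot]
  refine ⟨?_, fun a _ ha => ?_⟩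
  · have hset : {a : F | a ≠ 0 ∧ ¬ ∃ t : F, t ≠ 0 ∧ t * σ t * σ (σ t) + a * t + 1 = 0} =
        ({a | companionRoots σ a = ∅} : Finset F) := by
      ext a
      simp only [Set.mem_ofPred_eq, coe_filter, mem_univ, true_and, companionRoots,
        filter_eq_empty_iff]
      constructor
      · exact fun h t _ ht => h.2 ⟨t, ht⟩
      · refine fun h => ⟨?_, fun ⟨t, ht⟩ => h (x := t) trivial ht⟩
        rintro rfl
        exact h (x := 1) trivial ⟨one_ne_zero, by simp [CharTwo.add_self_eq_zero]⟩
    rw [hset, Set.ncard_coe_finset]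
    have hd0 : (0 : ℝ) < d := by rw [hd]; positivity
    have hbound := hσ.le_card_rootless hmodd hi hgcd hF (hq ▸ hpow) (hq ▸ hd)
    rw [hF] at hbound
    push_cast at hbound
    rw [div_le_iff₀ hd0]
    linarith
  · have ha' : ∀ t, t ≠ 0 → t * σ t * σ (σ t) + a * t + 1 ≠ 0 := fun t ht h => ha ⟨t, ht, h⟩
    exact ⟨hσ.bijective_Gmap hpow ha', hσ.isAPN_Gmap hpow ha'⟩
end

section
/- Let m ≥ 3 be an odd integer, let i be a positive integer with gcd(i,m) = 1, set q = 2^i, and let a ∈ 𝔽_{2^m}^*. Then the map H_a : 𝔽_{2^m}³ → 𝔽_{2^m}³ is almost perfect nonlinear (APN) if and only if the polynomial P_a'(T) = T^{q²+q+1} + aT^{q²+q} + 1 has no root in 𝔽_{2^m}. -/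
/-- The trivariate map `H_a(x,y,z) = (x^{q+1}+a x y^q + y z^q, x y^q + z^{q+1},
x^q z + y^{q+1} + a y^q z)`. -/
def Hmap {F : Type*} [Field F] (q : ℕ) (a : F) : F × F × F → F × F × F :=
  fun v =>
    (v.1 ^ (q + 1) + a * v.1 * v.2.1 ^ q + v.2.1 * v.2.2 ^ q,
     v.1 * v.2.1 ^ q + v.2.2 ^ (q + 1),
     v.1 ^ q * v.2.2 + v.2.1 ^ (q + 1) + a * v.2.1 ^ q * v.2.2)

/-- If `gcd(i, m) = 1`, the only fixed points of `c ↦ c ^ 2 ^ i` in a field with `2 ^ m` elements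
are `0` and `1`. -/
lemma eq_zero_or_one_of_pow_two_pow_eq {F : Type*} [Field F] [Fintype F] {m i : ℕ}
    (hgcd : Nat.gcd i m = 1) (hF : Fintype.card F = 2 ^ m) {c : F} (hc : c ^ 2 ^ i = c) :
    c = 0 ∨ c = 1 := by
  have hi : Function.IsPeriodicPt (fun x : F => x ^ 2) i c := by
    simpa [Function.IsPeriodicPt, Function.IsFixedPt, pow_iterate] using hc
  have hm : Function.IsPeriodicPt (fun x : F => x ^ 2) m c := by
    have := FiniteField.pow_card c
    rw [hF] at this
    simpa [Function.IsPeriodicPt, Function.IsFixedPt, pow_iterate] using this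
  have h := hi.gcd hm
  rw [hgcd] at h
  have h2 : c ^ 2 = c := by
    simpa [Function.IsPeriodicPt, Function.IsFixedPt] using h
  have h3 : c * (c - 1) = 0 := by linear_combination h2
  rcases mul_eq_zero.1 h3 with h | h
  · exact Or.inl h
  · exact Or.inr (sub_eq_zero.1 h)

/-- `Hmap` vanishes on the line spanned by `(1, t ^ (q + 1), t ^ q)` when `t` is a root. -/
lemma Hmap_line_eq_zero {F : Type*} [Field F] [CharP F 2] (q : ℕ) {a t : F}
    (ht : t ^ (q ^ 2 + q + 1) + a * t ^ (q ^ 2 + q) + 1 = 0) (c : F) :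
    Hmap q a (c, c * t ^ (q + 1), c * t ^ q) = 0 := by
  have h2 : (2 : F) = 0 := CharTwo.two_eq_zero
  have e : q ^ 2 = q * q := sq q
  rw [e] at ht
  simp only [pow_add, pow_mul, pow_one] at ht
  simp only [Hmap, Prod.mk_eq_zero, mul_pow, pow_add, pow_one]
  generalize (t ^ q) ^ q = A at *
  generalize t ^ q = B at *
  generalize c ^ q = C at *
  refine ⟨?_, ?_, ?_⟩
  · linear_combination C * c * ht
  · linear_combination C * c * A * B * h2
  · linear_combination C * c * B * ht

/-- A semilinear map preserving a plane fixes a line: if the covector `(w₁, w₂, w₃)` satisfies the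
semilinear eigenvector equation for `(x, y, z) ↦ (z ^ q, x ^ q + a y ^ q, y ^ q)` with
multiplier `μ`, then some nonzero vector is an eigenvector with eigenvalue `μ`. -/
lemma exists_fixed_line {F : Type*} [Field F] [Fintype F] {q : ℕ} (hq : q ≠ 0)
    (hadd : ∀ x y : F, (x - y) ^ q = x ^ q - y ^ q) {a w₁ w₂ w₃ μ : F}
    (hw : ¬ (w₁ = 0 ∧ w₂ = 0 ∧ w₃ = 0)) (h₁ : w₂ = μ * w₁ ^ q)
    (h₂ : a * w₂ + w₃ = μ * w₂ ^ q) (h₃ : w₁ = μ * w₃ ^ q) :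
    ∃ x y z : F, ¬ (x = 0 ∧ y = 0 ∧ z = 0) ∧
      z ^ q = μ * x ∧ x ^ q + a * y ^ q = μ * y ∧ y ^ q = μ * z := by
  have hadd' : ∀ x y : F, (x + y) ^ q = x ^ q + y ^ q := fun x y => by
    have := hadd (x + y) y
    rw [add_sub_cancel_right] at this
    linear_combination -this
  have hns : ¬ Function.Surjective (fun s : F => μ * (s ^ q - s)) := fun hs => by
    have := Finite.injective_iff_surjective.2 hs
    exact zero_ne_one (this (by simp [hq]) : (0 : F) = 1)
  let g : F × F × F → F × F × F := fun p =>
    (p.2.2 ^ q - μ * p.1, p.1 ^ q + a * p.2.1 ^ q - μ * p.2.1, p.2.1 ^ q - μ * p.2.2)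
  have hg : ¬ Function.Injective g := fun hinj => hns fun τ => by
    have hsurj := Finite.injective_iff_surjective.1 hinj
    obtain ⟨b, hb⟩ : ∃ b : F × F × F, w₁ * b.1 + w₂ * b.2.1 + w₃ * b.2.2 = τ := by
      by_cases k₁ : w₁ = 0
      · by_cases k₂ : w₂ = 0
        · have k₃ : w₃ ≠ 0 := fun k₃ => hw ⟨k₁, k₂, k₃⟩
          exact ⟨(0, 0, τ / w₃), by field_simp; ring⟩
        · exact ⟨(0, τ / w₂, 0), by field_simp; ring⟩
      · exact ⟨(τ / w₁, 0, 0), by field_simp; ring⟩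
    obtain ⟨⟨x, y, z⟩, hp⟩ := hsurj b
    refine ⟨w₁ * x + w₂ * y + w₃ * z, ?_⟩
    subst hp
    simp only [hadd', mul_pow, g] at hb ⊢
    linear_combination hb - x ^ q * h₁ - y ^ q * h₂ - z ^ q * h₃
  simp only [Function.Injective, not_forall] at hg
  obtain ⟨⟨x, y, z⟩, ⟨x', y', z'⟩, hpq, hne⟩ := hg
  simp only [g, Prod.mk.injEq] at hpq
  obtain ⟨e₁, e₂, e₃⟩ := hpq
  refine ⟨x - x', y - y', z - z', ?_, ?_, ?_, ?_⟩
  · rintro ⟨k₁, k₂, k₃⟩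
    exact hne (by rw [sub_eq_zero.1 k₁, sub_eq_zero.1 k₂, sub_eq_zero.1 k₃])
  all_goals simp only [hadd]
  · linear_combination e₁
  · linear_combination e₂
  · linear_combination e₃

/-- An eigenvector of `(x, y, z) ↦ (z ^ q, x ^ q + a y ^ q, y ^ q)` yields a root. -/
lemma exists_root_of_fixed_line {F : Type*} [Field F] [CharP F 2] {q : ℕ} (hq : q ≠ 0)
    {a x y z μ : F} (hne : ¬ (x = 0 ∧ y = 0 ∧ z = 0)) (h₁ : z ^ q = μ * x)
    (h₂ : x ^ q + a * y ^ q = μ * y) (h₃ : y ^ q = μ * z) :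
    ∃ t : F, t ^ (q ^ 2 + q + 1) + a * t ^ (q ^ 2 + q) + 1 = 0 := by
  have h2 : (2 : F) = 0 := CharTwo.two_eq_zero
  have hz : z ≠ 0 := by
    rintro rfl
    have hy : y = 0 := by simpa [hq] using h₃
    subst hy
    have hx : x = 0 := by simpa [hq] using h₂
    exact hne ⟨hx, rfl, rfl⟩
  refine ⟨y / z, ?_⟩
  have hy2 : (y ^ q) ^ q = μ ^ q * z ^ q := by rw [h₃, mul_pow]
  have hz2 : (z ^ q) ^ q = μ ^ q * x ^ q := by rw [h₁, mul_pow]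
  have key : (y ^ q) ^ q * y ^ q * (y + a * z) + (z ^ q) ^ q * z ^ q * z = 0 := by
    rw [hy2, hz2]
    linear_combination μ ^ q * z ^ q * (y + a * z) * h₃ + μ ^ q * z ^ q * z * h₂
      - μ ^ q * z ^ q * z * a * h₃ + μ ^ (q + 1) * z ^ (q + 1) * y * h2
  have hzq : z ^ q ≠ 0 := pow_ne_zero _ hz
  have hzqq : (z ^ q) ^ q ≠ 0 := pow_ne_zero _ hzq
  rw [sq]
  simp only [pow_add, pow_mul, pow_one, div_pow]
  generalize (z ^ q) ^ q = A at *
  generalize z ^ q = B at *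
  generalize (y ^ q) ^ q = C at *
  generalize y ^ q = D at *
  field_simp
  linear_combination key

/-- Two nonproportional vectors whose polar form under `Hmap` vanishes span an invariant plane,
which gives a root. -/
lemma exists_root_of_polar_eq_zero {F : Type*} [Field F] [Fintype F] [CharP F 2] {q : ℕ}
    (hq : q ≠ 0) (hadd : ∀ x y : F, (x - y) ^ q = x ^ q - y ^ q) {a : F} {x y z r s t : F}
    (hw : ¬ (y * t - z * s = 0 ∧ z * r - x * t = 0 ∧ x * s - y * r = 0))
    (h : Hmap q a ((x, y, z) + (r, s, t)) = Hmap q a (x, y, z) + Hmap q a (r, s, t)) :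
    ∃ t : F, t ^ (q ^ 2 + q + 1) + a * t ^ (q ^ 2 + q) + 1 = 0 := by
  have h2 : (2 : F) = 0 := CharTwo.two_eq_zero
  have hadd' : ∀ x y : F, (x + y) ^ q = x ^ q + y ^ q := fun x y => by
    have := hadd (x + y) y
    rw [add_sub_cancel_right] at this
    linear_combination -this
  simp only [Hmap, Prod.mk_add_mk, Prod.mk.injEq, pow_add, pow_one, hadd'] at h
  obtain ⟨e₁, e₂, e₃⟩ := h
  set w₁ := y * t - z * s with hw₁
  set w₂ := z * r - x * t with hw₂
  set w₃ := x * s - y * r with hw₃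
  have f₁ : w₁ ^ q = y ^ q * t ^ q - z ^ q * s ^ q := by simp only [hw₁, hadd, mul_pow]
  have f₂ : w₂ ^ q = z ^ q * r ^ q - x ^ q * t ^ q := by simp only [hw₂, hadd, mul_pow]
  have f₃ : w₃ ^ q = x ^ q * s ^ q - y ^ q * r ^ q := by simp only [hw₃, hadd, mul_pow]
  have gu : w₂ * x ^ q + (a * w₂ + w₃) * y ^ q + w₁ * z ^ q = 0 := by
    grind
  have gv : w₂ * r ^ q + (a * w₂ + w₃) * s ^ q + w₁ * t ^ q = 0 := by
    grind
  have c₁ : (a * w₂ + w₃) * w₃ ^ q = w₁ * w₂ ^ q := by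
    rw [f₃, f₂]; linear_combination x ^ q * gv - r ^ q * gu
  have c₂ : w₁ * w₁ ^ q = w₂ * w₃ ^ q := by
    rw [f₁, f₃]; linear_combination y ^ q * gv - s ^ q * gu
  have c₃ : w₂ * w₂ ^ q = (a * w₂ + w₃) * w₁ ^ q := by
    rw [f₁, f₂]; linear_combination z ^ q * gv - t ^ q * gu
  obtain ⟨μ, m₁, m₂, m₃⟩ : ∃ μ, w₂ = μ * w₁ ^ q ∧ a * w₂ + w₃ = μ * w₂ ^ q ∧
      w₁ = μ * w₃ ^ q := by
    clear_value w₁ w₂ w₃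
    by_cases k₁ : w₁ = 0
    · by_cases k₂ : w₂ = 0
      · have k₃ : w₃ ^ q ≠ 0 := pow_ne_zero _ fun k₃ => hw ⟨k₁, k₂, k₃⟩
        refine ⟨w₁ / w₃ ^ q, ?_, ?_, ?_⟩ <;> field_simp <;> grind
      · have k₂ : w₂ ^ q ≠ 0 := pow_ne_zero _ k₂
        refine ⟨(a * w₂ + w₃) / w₂ ^ q, ?_, ?_, ?_⟩ <;> field_simp <;> grind
    · have k₁ : w₁ ^ q ≠ 0 := pow_ne_zero _ k₁
      refine ⟨w₂ / w₁ ^ q, ?_, ?_, ?_⟩ <;> field_simp <;> grind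
  obtain ⟨x', y', z', hne, l₁, l₂, l₃⟩ := exists_fixed_line hq hadd hw m₁ m₂ m₃
  exact exists_root_of_fixed_line hq hne l₁ l₂ l₃

/-- If the polar form of `Hmap` vanishes at `(u, c • u)` with `u ≠ 0` and `c ^ q ≠ c`, then `u` spans
a fixed line, which gives a root. -/
lemma exists_root_of_polar_smul_eq_zero {F : Type*} [Field F] [CharP F 2] {q : ℕ} (hq : q ≠ 0)
    (hadd : ∀ x y : F, (x + y) ^ q = x ^ q + y ^ q) {a : F} {x y z c : F}
    (hu : ¬ (x = 0 ∧ y = 0 ∧ z = 0)) (hc : c ^ q ≠ c)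
    (h : Hmap q a ((x, y, z) + (c * x, c * y, c * z)) =
      Hmap q a (x, y, z) + Hmap q a (c * x, c * y, c * z)) :
    ∃ t : F, t ^ (q ^ 2 + q + 1) + a * t ^ (q ^ 2 + q) + 1 = 0 := by
  have h2 : (2 : F) = 0 := CharTwo.two_eq_zero
  have hc' : c ^ q + c ≠ 0 := fun k => hc (by linear_combination k - c * h2)
  simp only [Hmap, Prod.mk_add_mk, Prod.mk.injEq, pow_add, pow_one, hadd, mul_pow] at h
  obtain ⟨e₁, e₂, e₃⟩ := h
  have d₁ : x ^ q * x + a * x * y ^ q + y * z ^ q = 0 :=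
    (mul_eq_zero.1 (by linear_combination e₁ :
      (c ^ q + c) * (x ^ q * x + a * x * y ^ q + y * z ^ q) = 0)).resolve_left hc'
  have d₂ : x * y ^ q + z ^ q * z = 0 :=
    (mul_eq_zero.1 (by linear_combination e₂ :
      (c ^ q + c) * (x * y ^ q + z ^ q * z) = 0)).resolve_left hc'
  have d₃ : x ^ q * z + y ^ q * y + a * y ^ q * z = 0 :=
    (mul_eq_zero.1 (by linear_combination e₃ :
      (c ^ q + c) * (x ^ q * z + y ^ q * y + a * y ^ q * z) = 0)).resolve_left hc'
  have hz : z ≠ 0 := by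
    rintro rfl
    have hy : y = 0 := by simpa [hq] using d₃
    subst hy
    have hx : x = 0 := by simpa [hq] using d₁
    exact hu ⟨hx, rfl, rfl⟩
  refine exists_root_of_fixed_line (x := x) (y := y) (z := z) (μ := y ^ q / z) hq hu ?_ ?_ ?_ <;>
    field_simp <;> grind

theorem stmt_15 (m i : ℕ) (hm : 3 ≤ m) (hmodd : Odd m) (hi : 0 < i)
    (hgcd : Nat.gcd i m = 1) (q : ℕ) (hq : q = 2 ^ i)
    (F : Type*) [Field F] [Fintype F] (hF : Fintype.card F = 2 ^ m)
    (a : F) (ha : a ≠ 0) :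
    IsAPN (Hmap q a) ↔
      (¬ ∃ t : F, t ^ (q ^ 2 + q + 1) + a * t ^ (q ^ 2 + q) + 1 = 0) := by
  have : Fact (Nat.Prime 2) := ⟨Nat.prime_two⟩
  have : CharP F 2 := charP_of_card_eq_prime_pow hF
  have h2 : (2 : F) = 0 := CharTwo.two_eq_zero
  have hq0 : q ≠ 0 := by rw [hq]; positivity
  have hadd : ∀ x y : F, (x + y) ^ q = x ^ q + y ^ q := by
    intro x y; rw [hq]; exact add_pow_char_pow x y 2 i
  have hsub : ∀ x y : F, (x - y) ^ q = x ^ q - y ^ q := by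
    intro x y; rw [hq]; exact sub_pow_char_pow x y i
  constructor
  · rintro hapn ⟨t, ht⟩
    have hle := hapn (1, t ^ (q + 1), t ^ q) (by simp) 0
    let f : F → F × F × F := fun c => (c, c * t ^ (q + 1), c * t ^ q)
    have hf : Function.Injective f := fun c d hcd => congrArg Prod.fst hcd
    have hsubset : Set.range f ⊆
        {x | Hmap q a (x + (1, t ^ (q + 1), t ^ q)) + Hmap q a x = 0} := by
      rintro _ ⟨c, rfl⟩
      have e : f c + (1, t ^ (q + 1), t ^ q) = f (c + 1) := by
        simp only [f, Prod.mk_add_mk]; ring_nf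
      simp only [Set.mem_ofPred_eq, e]
      simp only [f, Hmap_line_eq_zero q ht, add_zero]
    have hcard := Set.ncard_le_ncard hsubset (Set.toFinite _)
    rw [← Set.image_univ, Set.ncard_image_of_injective _ hf, Set.ncard_univ,
      Nat.card_eq_fintype_card, hF] at hcard
    have : 2 ^ 3 ≤ 2 ^ m := Nat.pow_le_pow_right (by norm_num) hm
    omega
  · intro hroot u hu b
    have polar : ∀ v : F × F × F, Hmap q a (u + v) = Hmap q a u + Hmap q a v →
        v = 0 ∨ v = u := by
      rintro ⟨r, s, t⟩ hv
      obtain ⟨x, y, z⟩ := u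
      have hu' : ¬ (x = 0 ∧ y = 0 ∧ z = 0) := by simpa using hu
      by_cases hw : y * t - z * s = 0 ∧ z * r - x * t = 0 ∧ x * s - y * r = 0
      · obtain ⟨c, rfl, rfl, rfl⟩ : ∃ c, r = c * x ∧ s = c * y ∧ t = c * z := by
          obtain ⟨k₁, k₂, k₃⟩ := hw
          by_cases hx : x = 0
          · by_cases hy : y = 0
            · have hz : z ≠ 0 := fun hz => hu' ⟨hx, hy, hz⟩
              refine ⟨t / z, ?_, ?_, ?_⟩ <;> field_simp <;> grind
            · refine ⟨s / y, ?_, ?_, ?_⟩ <;> field_simp <;> grind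
          · refine ⟨r / x, ?_, ?_, ?_⟩ <;> field_simp <;> grind
        by_cases hc : c ^ q = c
        · rw [hq] at hc
          rcases eq_zero_or_one_of_pow_two_pow_eq hgcd hF hc with rfl | rfl <;> simp
        · exact absurd (exists_root_of_polar_smul_eq_zero hq0 hadd hu' hc hv) hroot
      · exact absurd (exists_root_of_polar_eq_zero hq0 hsub hw hv) hroot
    by_cases hne : ∃ x₀, Hmap q a (x₀ + u) + Hmap q a x₀ = b
    · obtain ⟨x₀, hx₀⟩ := hne
      refine (Set.ncard_le_ncard (t := {x₀, x₀ + u}) ?_ (Set.toFinite _)).trans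
        ((Set.ncard_insert_le _ _).trans (by rw [Set.ncard_singleton]))
      intro x hx
      have hx : Hmap q a (x + u) + Hmap q a x = b := hx
      have hv := polar (x - x₀) (by
        obtain ⟨x₁, y₁, z₁⟩ := x
        obtain ⟨x₂, y₂, z₂⟩ := x₀
        obtain ⟨x₃, y₃, z₃⟩ := u
        rw [← hx₀] at hx
        simp only [Hmap, Prod.mk_add_mk, Prod.mk_sub_mk, Prod.mk.injEq, pow_add, pow_one, hadd,
          hsub] at hx ⊢
        obtain ⟨e₁, e₂, e₃⟩ := hx
        refine ⟨?_, ?_, ?_⟩ <;> grind)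
      rcases hv with hv | hv
      · left; exact sub_eq_zero.1 hv
      · right; rw [Set.mem_singleton_iff, ← hv]; abel
    · have : {x | Hmap q a (x + u) + Hmap q a x = b} = ∅ :=
        Set.eq_empty_iff_forall_notMem.2 fun x hx => hne ⟨x, hx⟩
      rw [this]; simp
end
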